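/- Let F be a field of characteristic 2. Then the essential dimension of PGL₄ over F is either 4 or 5: 4 ≤ ed(PGL₄) ≤ 5. -/

import Mathlib

/-!
Statement 14: Let `F` be a field of characteristic `2`.  Then the essential dimension of
`PGL₄` over `F` — the essential dimension of the functor assigning to each field extension
`K/F` the set of isomorphism classes of central simple `K`-algebras of degree `4` — is either
`4` or `5`: `4 ≤ ed(PGL₄) ≤ 5`.

An isomorphism class of central simple `K`-algebras of degree `4` (i.e. of dimension `16`)
is defined over an intermediate field `F ⊆ E ⊆ K` precisely when it descends to `E`: there is
a central simple `E`-algebra `B` of degree `4` with `B ⊗_E K ≅ A`.  Thus `ed(PGL₄) ≤ m` says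
that every such `A/K` descends to an intermediate field of transcendence degree at most `m`
over `F`; `4 ≤ ed(PGL₄)` says that `ed(PGL₄) ≤ m` fails for every `m < 4`, and
`ed(PGL₄) ≤ 5` is the statement `csaDegFourEdLE F 5`.
-/

universe u

noncomputable section

open scoped TensorProduct

/-- `trdeg_F E ≤ n`: there are at most `n` elements of `E` over which `E` is algebraic. -/
def TrdegLE (F E : Type*) [Field F] [Field E] [Algebra F E] (n : ℕ) : Prop :=
  ∃ s : Finset E, s.card ≤ n ∧
    Algebra.IsAlgebraic (IntermediateField.adjoin F (s : Set E)) E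

/-- `ed(PGL₄) ≤ m` over `F`: every central simple algebra of degree `4` over every field
extension `K/F` is defined over (i.e. descends to) some intermediate field `E` of
transcendence degree at most `m` over `F`. -/
def csaDegFourEdLE (F : Type u) [Field F] (m : ℕ) : Prop :=
  ∀ (K : Type u) [Field K] [Algebra F K] (A : Type u) [Ring A] [Algebra K A],
    Module.finrank K A = 16 → Algebra.IsCentral K A → IsSimpleRing A →
    ∃ E : IntermediateField F K, TrdegLE F E m ∧
      ∃ (B : Type u) (_ : Ring B) (_ : Algebra E B),
        Module.finrank E B = 16 ∧ Algebra.IsCentral E B ∧ IsSimpleRing B ∧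
        Nonempty ((K ⊗[E] B) ≃ₐ[K] A)

set_option linter.unusedSimpArgs false
set_option linter.unusedVariables false
open MvPolynomial in
theorem exists_common_zero {Ω ι κ : Type*} [Field Ω] [IsAlgClosed Ω] [Fintype ι] [Fintype κ]
    (f : κ → MvPolynomial ι Ω) (hf : ∀ j, eval 0 (f j) = 0)
    (h : Fintype.card κ < Fintype.card ι) : ∃ v : ι → Ω, v ≠ 0 ∧ ∀ j, eval v (f j) = 0 := by
  classical
  by_contra hcon
  push Not at hcon
  set I : Ideal (MvPolynomial ι Ω) := Ideal.span (Set.range f) with hI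
  have hz : zeroLocus Ω I = {0} := by
    ext v
    rw [mem_zeroLocus_iff]
    simp only [Set.mem_singleton_iff]
    constructor
    · intro hv
      by_contra hne
      obtain ⟨j, hj⟩ := hcon v hne
      exact hj (by simpa [aeval_eq_eval] using hv (f j) (Ideal.subset_span ⟨j, rfl⟩))
    · rintro rfl p hp
      have : I ≤ RingHom.ker (eval (0 : ι → Ω)) := by
        rw [hI, Ideal.span_le]
        rintro _ ⟨j, rfl⟩
        exact hf j
      simpa [aeval_eq_eval] using! this hp
  have hrad := vanishingIdeal_zeroLocus_eq_radical (K := Ω) I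
  rw [hz] at hrad
  -- all maximal ideals have the same height
  have hht : ∀ x : ι → Ω, (vanishingIdeal Ω {x} : Ideal (MvPolynomial ι Ω)).height =
      (vanishingIdeal Ω {(0 : ι → Ω)} : Ideal (MvPolynomial ι Ω)).height := by
    intro x
    let g : (ι → Ω) → MvPolynomial ι Ω →ₐ[Ω] MvPolynomial ι Ω := fun y => aeval fun i => X i + C (y i)
    have hg : ∀ y, (g y).comp (g (-y)) = AlgHom.id _ _ := by
      intro y
      ext1 i
      simp [g]
    let e : MvPolynomial ι Ω ≃ₐ[Ω] MvPolynomial ι Ω :=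
      AlgEquiv.ofAlgHom (g x) (g (-x)) (hg x) (by simpa using hg (-x))
    have : (vanishingIdeal Ω {x} : Ideal (MvPolynomial ι Ω)) =
        (vanishingIdeal Ω {(0 : ι → Ω)} : Ideal (MvPolynomial ι Ω)).comap e.toRingEquiv := by
      ext p
      rw [Ideal.mem_comap, mem_vanishingIdeal_singleton_iff, mem_vanishingIdeal_singleton_iff]
      have : (aeval (0 : ι → Ω)).comp (g x) = (aeval x : MvPolynomial ι Ω →ₐ[Ω] Ω) := by
        ext i
        simp [g]
      have h2 := DFunLike.congr_fun this p
      rw [← h2]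
      rfl
    rw [this, RingEquiv.height_comap]
  have h1 : (vanishingIdeal Ω {(0 : ι → Ω)} : Ideal (MvPolynomial ι Ω)) ∈ I.minimalPrimes := by
    rw [← Ideal.radical_minimalPrimes, ← hrad, Ideal.minimalPrimes_eq_subsingleton_self]
    rfl
  have h2 := Ideal.height_le_card_of_mem_minimalPrimes_span (Set.finite_range f) h1
  have h3 : (Set.range f).ncard ≤ Fintype.card κ := by
    rw [← Set.image_univ, ← Nat.card_eq_fintype_card, ← Set.ncard_univ]
    exact Set.ncard_image_le
  have h4 : ringKrullDim (MvPolynomial ι Ω) ≤ ((Fintype.card κ : ℕ) : WithBot ℕ∞) := by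
    rw [ringKrullDim_le_iff_isMaximal_height_le]
    intro p hp
    obtain ⟨x, rfl⟩ := isMaximal_iff_eq_vanishingIdeal_singleton.mp hp
    rw [hht x]
    have := h2.trans (Nat.cast_le.mpr h3)
    exact_mod_cast this
  rw [MvPolynomial.ringKrullDim_of_isNoetherianRing, ringKrullDim_eq_zero_of_field, zero_add,
    Nat.card_eq_fintype_card] at h4
  have : Fintype.card ι ≤ Fintype.card κ := by exact_mod_cast h4
  omega

theorem isotropic_of_subspaces {Ω M ι : Type*} [Field Ω] [IsAlgClosed Ω] [Field M] [Algebra Ω M] [Fintype ι]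
    (a : ι → ι → M) (V W : Submodule Ω M) [FiniteDimensional Ω V] [FiniteDimensional Ω W]
    (hVW : ∀ i j, ∀ v ∈ V, ∀ w ∈ V, a i j * v * w ∈ W)
    (hd : Module.finrank Ω W < Fintype.card ι * Module.finrank Ω V) :
    ∃ x : ι → M, x ≠ 0 ∧ ∑ i, ∑ j, a i j * x i * x j = 0 := by
  classical
  let bV := Module.finBasis Ω V
  let bW := Module.finBasis Ω W
  let g : ι → ι → Fin (Module.finrank Ω V) → Fin (Module.finrank Ω V) → W := fun i j k l =>
    ⟨a i j * bV k * bV l, hVW i j _ (bV k).2 _ (bV l).2⟩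
  let f : Fin (Module.finrank Ω W) → MvPolynomial (ι × Fin (Module.finrank Ω V)) Ω := fun m =>
    ∑ i, ∑ j, ∑ k, ∑ l, MvPolynomial.C (bW.repr (g i j k l) m) * MvPolynomial.X (i, k) * MvPolynomial.X (j, l)
  obtain ⟨v, hv0, hv⟩ := exists_common_zero f (by intro j; simp [f]) (by simpa using hd)
  refine ⟨fun i => ∑ k, v (i, k) • (bV k : M), ?_, ?_⟩
  · intro h
    apply hv0
    ext ⟨i, k⟩
    have h1 := congrFun h i
    have h2 : ∑ k, v (i, k) • bV k = 0 := by
      apply Subtype.ext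
      simpa using h1
    exact Fintype.linearIndependent_iff.mp bV.linearIndependent (fun k => v (i,k)) h2 k
  · have key : ∑ i, ∑ j, ∑ k, ∑ l, (v (i,k) * v (j,l)) • g i j k l = 0 := by
      apply bW.repr.injective
      ext m
      have := hv m
      simp only [f, map_sum, map_mul, MvPolynomial.eval_C, MvPolynomial.eval_X] at this
      simp only [map_sum, map_smul, Finsupp.coe_finsetSum, Finset.sum_apply, Finsupp.smul_apply, smul_eq_mul, map_zero, Finsupp.zero_apply]
      rw [← this]
      refine Finset.sum_congr rfl fun i _ => Finset.sum_congr rfl fun j _ => Finset.sum_congr rfl fun k _ => Finset.sum_congr rfl fun l _ => ?_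
      ring
    have key2 := congrArg (Subtype.val) key
    simp only [Submodule.coe_sum, Submodule.coe_smul, ZeroMemClass.coe_zero] at key2
    rw [← key2]
    refine Finset.sum_congr rfl fun i _ => Finset.sum_congr rfl fun j _ => ?_
    beta_reduce
    rw [mul_assoc, Finset.sum_mul_sum, Finset.mul_sum]
    refine Finset.sum_congr rfl fun k _ => ?_
    rw [Finset.mul_sum]
    refine Finset.sum_congr rfl fun l _ => ?_
    simp only [g, Algebra.smul_def, map_mul]
    ring

theorem box_linearIndependent {Ω M σ : Type*} [Field Ω] [Field M] [Algebra Ω M] [Fintype σ]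
    (s : σ → M) (hs : AlgebraicIndependent Ω s) (N : ℕ) :
    LinearIndependent Ω (fun γ : σ → Fin N => ∏ i, s i ^ (γ i : ℕ)) := by
  have h2 : LinearIndependent Ω (fun γ : σ →₀ ℕ => MvPolynomial.aeval s (MvPolynomial.monomial γ (1:Ω))) := by
    have := (MvPolynomial.basisMonomials σ Ω).linearIndependent.map' (MvPolynomial.aeval s).toLinearMap
      (LinearMap.ker_eq_bot.mpr hs)
    rwa [MvPolynomial.coe_basisMonomials] at this
  have h3 := h2.comp (fun γ : σ → Fin N => Finsupp.equivFunOnFinite.symm (fun i => (γ i : ℕ))) (by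
    intro γ γ' h
    have h' := Finsupp.equivFunOnFinite.symm.injective h
    funext i
    exact Fin.ext (congrFun h' i))
  have h4 : (fun γ : σ → Fin N => ∏ i, s i ^ (γ i : ℕ)) =
      (fun γ : σ →₀ ℕ => MvPolynomial.aeval s (MvPolynomial.monomial γ (1:Ω))) ∘
      (fun γ : σ → Fin N => Finsupp.equivFunOnFinite.symm (fun i => (γ i : ℕ))) := by
    funext γ
    simp [MvPolynomial.aeval_monomial, Finsupp.prod_fintype]
  rw [h4]
  exact h3

theorem tower_linearIndependent {Ω M ι κ : Type*} [Field Ω] [Field M] [Algebra Ω M]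
    (k : IntermediateField Ω M) (g : ι → M) (e : κ → M) (hg : ∀ i, g i ∈ k)
    (h1 : LinearIndependent Ω g) (h2 : LinearIndependent k e) :
    LinearIndependent Ω (fun p : ι × κ => g p.1 * e p.2) := by
  have h3 : LinearIndependent Ω (fun i => (⟨g i, hg i⟩ : k)) :=
    LinearIndependent.of_comp k.val.toLinearMap h1
  have h4 := linearIndependent_smul (R := Ω) (S := k) (A := M) h3 h2
  have h5 : (fun p : ι × κ => g p.1 * e p.2) = fun p : ι × κ => (⟨g p.1, hg p.1⟩ : k) • e p.2 := by
    funext p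
    rfl
  rw [h5]
  exact h4

open scoped IntermediateField.algebraAdjoinAdjoin in
theorem tsen_aux {Ω M σ : Type*} [Field Ω] [IsAlgClosed Ω] [Field M] [Algebra Ω M] [Fintype σ]
    (hσ : Fintype.card σ ≤ 3) (s : σ → M) (hs : AlgebraicIndependent Ω s)
    (halg : Algebra.IsAlgebraic (IntermediateField.adjoin Ω (Set.range s)) M)
    (a : Fin 9 → Fin 9 → M) :
    ∃ x : Fin 9 → M, x ≠ 0 ∧ ∑ i, ∑ j, a i j * x i * x j = 0 := by
  classical
  set k := IntermediateField.adjoin Ω (Set.range s) with hk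
  set T : Set M := Set.range (fun p : Fin 9 × Fin 9 => a p.1 p.2) with hT
  have hTf : Finite T := Set.finite_range _
  set M0 := IntermediateField.adjoin k T with hM0
  have hfd : FiniteDimensional k M0 :=
    IntermediateField.finiteDimensional_adjoin fun x _ => (halg.isAlgebraic x).isIntegral
  let b := Module.finBasis k M0
  set d := Module.finrank k M0 with hd
  have hdpos : 0 < d := Module.finrank_pos
  let e : Fin d → M := fun m => (b m : M)
  have heLI : LinearIndependent k e := b.linearIndependent.map' M0.val.toLinearMap (by
    exact LinearMap.ker_eq_bot.mpr M0.val.injective)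
  have hamem : ∀ i j, a i j ∈ M0 := fun i j => IntermediateField.subset_adjoin k T ⟨(i, j), rfl⟩
  let c : (Fin 9 × Fin 9 × Fin d × Fin d) × Fin d → k := fun q =>
    b.repr (⟨a q.1.1 q.1.2.1, hamem _ _⟩ * b q.1.2.2.1 * b q.1.2.2.2) q.2
  have hc : ∀ i j p q, a i j * e p * e q = ∑ m, (c ((i, j, p, q), m) : M) * e m := by
    intro i j p q
    have := congrArg (Subtype.val) (b.sum_repr (⟨a i j, hamem _ _⟩ * b p * b q))
    simp only [IntermediateField.coe_sum, MulMemClass.coe_mul] at this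
    rw [← this]
    refine Finset.sum_congr rfl fun m _ => ?_
    rfl
  obtain ⟨δ, hδ⟩ := IsLocalization.exist_integer_multiples_of_finite
    (nonZeroDivisors (Algebra.adjoin Ω (Set.range s))) c
  have hδ0 : ((δ : Algebra.adjoin Ω (Set.range s)) : M) ≠ 0 := by
    have := nonZeroDivisors.ne_zero δ.2
    simpa using this
  have hpol : ∀ q, ∃ p : MvPolynomial σ Ω, MvPolynomial.aeval s p =
      ((δ : Algebra.adjoin Ω (Set.range s)) : M) * (c q : M) := by
    intro q
    obtain ⟨z, hz⟩ := hδ q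
    have hz2 : (z : M) ∈ (MvPolynomial.aeval (R := Ω) s).range := by
      rw [← Algebra.adjoin_range_eq_range_aeval]
      exact z.2
    obtain ⟨p, hp⟩ := hz2
    refine ⟨p, ?_⟩
    have := congrArg (Subtype.val) hz
    exact hp.trans this
  choose P hP using hpol
  let D : ℕ := (Finset.univ.sup fun q => (P q).totalDegree) + 1
  have hDle : ∀ q, (P q).totalDegree < D := fun q => Nat.lt_succ_of_le
    (Finset.le_sup (f := fun q => (P q).totalDegree) (Finset.mem_univ q))
  let mon : (N : ℕ) → (σ → Fin N) × Fin d → M := fun N p => (∏ i, s i ^ (p.1 i : ℕ)) * e p.2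
  have hmonLI : ∀ N, LinearIndependent Ω (mon N) := by
    intro N
    have hm : ∀ γ : σ → Fin N, ∏ i, s i ^ (γ i : ℕ) ∈ k := fun γ =>
      prod_mem fun i _ => pow_mem (IntermediateField.subset_adjoin Ω (Set.range s) (Set.mem_range_self i)) _
    exact tower_linearIndependent k _ e hm (box_linearIndependent s hs N) heLI
  let V : ℕ → Submodule Ω M := fun N => Submodule.span Ω (Set.range (mon N))
  have hVfin : ∀ N, Module.finrank Ω (V N) = N ^ Fintype.card σ * d := by
    intro N
    rw [finrank_span_eq_card (hmonLI N)]
    simp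
  have hmem : ∀ (N : ℕ) (γ : σ → ℕ) (m : Fin d), (∀ i, γ i < N) → (∏ i, s i ^ (γ i)) * e m ∈ V N := by
    intro N γ m h
    exact Submodule.subset_span ⟨(fun i => ⟨γ i, h i⟩, m), rfl⟩
  set δM : M := ((δ : Algebra.adjoin Ω (Set.range s)) : M) with hδM
  obtain ⟨N, hN⟩ : ∃ N, N = 25 * (D + 1) := ⟨_, rfl⟩
  let W : Submodule Ω M := (V (2 * N + D)).map (LinearMap.mulLeft Ω δM⁻¹)
  have hfV : ∀ N, FiniteDimensional Ω (V N) := fun N => FiniteDimensional.span_of_finite Ω (Set.finite_range _)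
  have hfW : FiniteDimensional Ω W := inferInstance
  refine isotropic_of_subspaces a (V N) W ?_ ?_
  · intro i j v hv w hw
    induction hv using Submodule.span_induction with
    | zero => simp
    | add x y _ _ hx hy => rw [mul_add, add_mul]; exact add_mem hx hy
    | smul t x _ hx => rw [mul_smul_comm, smul_mul_assoc]; exact Submodule.smul_mem _ _ hx
    | mem x hx =>
      obtain ⟨⟨γ, p⟩, rfl⟩ := hx
      induction hw using Submodule.span_induction with
      | zero => simp
      | add x y _ _ hx hy => rw [mul_add]; exact add_mem hx hy
      | smul t x _ hx => rw [mul_smul_comm]; exact Submodule.smul_mem _ _ hx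
      | mem x hx =>
        obtain ⟨⟨γ', q⟩, rfl⟩ := hx
        rw [Submodule.mem_map]
        refine ⟨δM * (a i j * mon N (γ, p) * mon N (γ', q)), ?_, ?_⟩
        · have : δM * (a i j * mon N (γ, p) * mon N (γ', q)) =
              ∑ m, MvPolynomial.aeval s (P ((i,j,p,q),m)) * ((∏ i, s i ^ (γ i + γ' i : ℕ)) * e m) := by
            simp only [hP, mon, pow_add, Finset.prod_mul_distrib]
            calc _ = δM * ((∏ i, s i ^ (γ i:ℕ)) * ∏ i, s i ^ (γ' i:ℕ)) * (a i j * e p * e q) := by ring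
              _ = _ := by
                rw [hc, Finset.mul_sum]
                exact Finset.sum_congr rfl fun m _ => by ring
          rw [this]
          refine Submodule.sum_mem _ fun m _ => ?_
          rw [MvPolynomial.aeval_def, MvPolynomial.eval₂_eq', Finset.sum_mul]
          refine Submodule.sum_mem _ fun η hη => ?_
          rw [mul_assoc, ← Algebra.smul_def]
          refine Submodule.smul_mem _ _ ?_
          rw [← mul_assoc, ← Finset.prod_mul_distrib]
          simp only [← pow_add]
          apply hmem
          intro t
          have h1 : η t < D := by
            refine lt_of_le_of_lt ?_ (hDle ((i,j,p,q),m))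
            refine le_trans ?_ (MvPolynomial.le_totalDegree hη)
            rw [Finsupp.sum_fintype _ _ (fun _ => rfl)]
            exact Finset.single_le_sum (f := fun i => η i) (fun _ _ => Nat.zero_le _) (Finset.mem_univ t)
          have := (γ t).2
          have := (γ' t).2
          omega
        · simp [hδ0]
  · have h1 : Module.finrank Ω W ≤ Module.finrank Ω (V (2*N+D)) := Submodule.finrank_map_le _ _
    refine lt_of_le_of_lt h1 ?_
    rw [hVfin, hVfin, Fintype.card_fin]
    have h2 : 2 * N + D ≤ 51 * (D + 1) := by omega
    have h3 : (2 * N + D) ^ Fintype.card σ ≤ (51 * (D+1)) ^ Fintype.card σ := Nat.pow_le_pow_left h2 _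
    have h4 : (51 * (D+1)) ^ Fintype.card σ < 9 * N ^ Fintype.card σ := by
      simp only [hN, mul_pow]
      have : 0 < (D+1) ^ Fintype.card σ := by positivity
      generalize (D+1) ^ Fintype.card σ = y at *
      interval_cases Fintype.card σ <;> omega
    rw [← mul_assoc]
    exact Nat.mul_lt_mul_of_pos_right (lt_of_le_of_lt h3 h4) hdpos

theorem tsen_lang {Ω M : Type*} [Field Ω] [IsAlgClosed Ω] [Field M] [Algebra Ω M]
    (S : Finset M) (hS : S.card ≤ 3)
    (halg : Algebra.IsAlgebraic (IntermediateField.adjoin Ω (S : Set M)) M)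
    (a : Fin 9 → Fin 9 → M) :
    ∃ x : Fin 9 → M, x ≠ 0 ∧ ∑ i, ∑ j, a i j * x i * x j = 0 := by
  classical
  have : Algebra.IsAlgebraic (Algebra.adjoin Ω (S : Set M)) M := by
    open scoped IntermediateField.algebraAdjoinAdjoin in
    exact Algebra.IsAlgebraic.trans (Algebra.adjoin Ω (S : Set M)) (IntermediateField.adjoin Ω (S : Set M)) M
  obtain ⟨t, htS, ht⟩ := exists_isTranscendenceBasis_subset (R := Ω) (S : Set M)
  lift t to Finset M using S.finite_toSet.subset htS
  refine tsen_aux (σ := t) ?_ _ ht.1 ?_ a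
  · rw [Fintype.card_coe]
    exact (Finset.card_le_card (by exact_mod_cast htS)).trans hS
  · exact ht.isAlgebraic_field


/-- quadratic forms in 9 variables are isotropic -/
def C9 (M : Type*) [Field M] : Prop := ∀ a : Fin 9 → Fin 9 → M,
    ∃ x : Fin 9 → M, x ≠ 0 ∧ ∑ i, ∑ j, a i j * x i * x j = 0

theorem C9.exists_isotropic {M V : Type*} [Field M] (h : C9 M) [AddCommGroup V] [Module M V]
    [FiniteDimensional M V] (B : V →ₗ[M] V →ₗ[M] M) (W : Submodule M V) (hW : 9 ≤ Module.finrank M W) :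
    ∃ w ∈ W, w ≠ 0 ∧ B w w = 0 := by
  classical
  let b := Module.finBasis M W
  let w : Fin 9 → V := fun i => b (Fin.castLE hW i)
  have hw : LinearIndependent M w := by
    have h1 : LinearIndependent M (fun i => (b i : V)) :=
      b.linearIndependent.map' W.subtype (Submodule.ker_subtype W)
    exact h1.comp _ (Fin.castLE_injective hW)
  obtain ⟨x, hx0, hx⟩ := h fun i j => B (w i) (w j)
  refine ⟨∑ i, x i • w i, Submodule.sum_mem _ fun i _ => Submodule.smul_mem _ _ (b _).2, ?_, ?_⟩
  · intro h0
    exact hx0 (funext (Fintype.linearIndependent_iff.mp hw x h0))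
  · rw [← hx]
    simp only [map_sum, map_smul, LinearMap.sum_apply, LinearMap.smul_apply, smul_eq_mul]
    simp only [Finset.mul_sum]
    rw [Finset.sum_comm]
    refine Finset.sum_congr rfl fun i _ => Finset.sum_congr rfl fun j _ => ?_
    ring

theorem C9.exists_totally_isotropic {M V : Type*} [Field M] (h : C9 M) [AddCommGroup V] [Module M V]
    [FiniteDimensional M V] (hV : Module.finrank M V = 16) (B : V →ₗ[M] V →ₗ[M] M) (k : ℕ) (hk : k ≤ 4) :
    ∃ U : Submodule M V, Module.finrank M U = k ∧ ∀ u ∈ U, B u u = 0 := by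
  induction k with
  | zero => exact ⟨⊥, by simp, by simp⟩
  | succ k ih =>
    obtain ⟨U, hU, hiso⟩ := ih (by omega)
    obtain ⟨C, hC⟩ := U.exists_isCompl
    let g : V →ₗ[M] Module.Dual M U := (B + B.flip).domRestrict₂ U
    have hg := g.finrank_range_add_finrank_ker
    have hr : Module.finrank M (LinearMap.range g) ≤ k := by
      have := Submodule.finrank_le (LinearMap.range g)
      rwa [Subspace.dual_finrank_eq, hU] at this
    have hCU := Submodule.finrank_add_eq_of_isCompl hC
    have hs := Submodule.finrank_sup_add_finrank_inf_eq C (LinearMap.ker g)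
    have hs2 := Submodule.finrank_le (C ⊔ LinearMap.ker g)
    obtain ⟨w, hw, hw0, hww⟩ := h.exists_isotropic B (C ⊓ LinearMap.ker g) (by omega)
    obtain ⟨hwC, hwg⟩ := hw
    have hwU : w ∉ U := fun hwU => hw0 (by
      have := hC.disjoint.le_bot ⟨hwU, hwC⟩
      simpa using this)
    refine ⟨U ⊔ Submodule.span M {w}, ?_, ?_⟩
    · have h1 := Submodule.finrank_sup_add_finrank_inf_eq U (Submodule.span M {w})
      have h2 : U ⊓ Submodule.span M {w} = ⊥ := by
        rw [← disjoint_iff, disjoint_comm]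
        exact (Submodule.disjoint_span_singleton' hw0).mpr hwU |>.symm
      rw [h2, finrank_bot, finrank_span_singleton hw0] at h1
      omega
    · intro u hu
      obtain ⟨y, hy, z, hz, rfl⟩ := Submodule.mem_sup.mp hu
      obtain ⟨c, rfl⟩ := Submodule.mem_span_singleton.mp hz
      have h1 : B w y + B y w = 0 := by
        have := LinearMap.congr_fun (LinearMap.mem_ker.mp hwg) ⟨y, hy⟩
        exact this
      have h2 := hiso y hy
      simp only [map_add, map_smul, LinearMap.add_apply, LinearMap.smul_apply, smul_eq_mul, h2, hww]
      linear_combination c * h1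

theorem isotropic_contra {M K A : Type*} [Field M] [Field K] [Algebra M K] [AddCommGroup A] [Module K A]
    (hC : C9 M) (Q : QuadraticForm K A) (e : Module.Basis (Fin 16) K A)
    (hM : ∀ x : Fin 16 → M, ∃ m : M, algebraMap M K m = Q (∑ i, algebraMap M K (x i) • e i))
    (V : Submodule K A) (hV : 13 ≤ Module.finrank K V) (hani : ∀ v ∈ V, Q v = 0 → v = 0) : False := by
  classical
  have hfd : FiniteDimensional K A := Module.Finite.of_basis e
  have h16 : Module.finrank K A = 16 := by rw [Module.finrank_eq_card_basis e]; simp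
  have hinj : Function.Injective (algebraMap M K) := (algebraMap M K).injective
  let J : (Fin 16 → M) → A := fun x => ∑ i, algebraMap M K (x i) • e i
  have hJadd : ∀ x y, J (x + y) = J x + J y := by
    intro x y; simp [J, add_smul, Finset.sum_add_distrib]
  have hJ1 : ∀ i, J (Pi.single i 1) = e i := by
    intro i
    simp [J, Pi.single_apply]
  let B := Q.toBilin e
  have hB : ∀ x, B x x = Q x := by
    intro x
    have := congrArg (fun q => q x) (Q.toQuadraticMap_toBilin e)
    simpa using this
  have hBm : ∀ i j, ∃ m, algebraMap M K m = B (e i) (e j) := by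
    intro i j
    simp only [B, QuadraticMap.toBilin_apply]
    split_ifs with h1 h2
    · obtain ⟨m, hm⟩ := hM (Pi.single i 1)
      exact ⟨m, by rw [hm]; exact congrArg Q (hJ1 i)⟩
    · obtain ⟨m, hm⟩ := hM (Pi.single i 1)
      obtain ⟨m', hm'⟩ := hM (Pi.single j 1)
      obtain ⟨m'', hm''⟩ := hM (Pi.single i 1 + Pi.single j 1)
      refine ⟨m'' - m - m', ?_⟩
      rw [map_sub, map_sub, hm, hm', hm'']
      change Q (J _) - Q (J _) - Q (J _) = _
      rw [hJadd, hJ1, hJ1]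
      rfl
    · exact ⟨0, by simp⟩
  choose a ha using hBm
  let B' : (Fin 16 → M) →ₗ[M] (Fin 16 → M) →ₗ[M] M := Matrix.toLinearMap₂' M (Matrix.of a)
  have hB' : ∀ x y, algebraMap M K (B' x y) = B (J x) (J y) := by
    intro x y
    simp only [B', Matrix.toLinearMap₂'_apply, J, map_sum, map_mul, LinearMap.sum_apply, LinearMap.map_smul,
      LinearMap.smul_apply, smul_eq_mul, Matrix.of_apply, ha]
    rw [Finset.sum_comm]
  obtain ⟨U, hU, hiso⟩ := hC.exists_totally_isotropic (by simp) B' 4 le_rfl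
  let bU := Module.finBasisOfFinrankEq M U hU
  have hLI : LinearIndependent K (fun i => J (bU i)) := by
    have h1 : LinearIndependent M (fun i => (bU i : Fin 16 → M)) :=
      bU.linearIndependent.map' U.subtype (Submodule.ker_subtype U)
    have h2 := (linearIndependent_algebraMap_comp_iff (S := K)).mpr h1
    have h3 := h2.map' e.equivFun.symm.toLinearMap (LinearEquiv.ker _)
    convert! h3 using 1
    funext i
    simp [J, Module.Basis.equivFun_symm_apply]
  let W := Submodule.span K (Set.range fun i => J (bU i))
  have hW : Module.finrank K W = 4 := by
    rw [finrank_span_eq_card hLI]; simp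
  have hpol : ∀ x ∈ W, ∀ y ∈ W, B x y + B y x = 0 := by
    intro x hx y hy
    induction hx using Submodule.span_induction with
    | zero => simp
    | add x x' _ _ h h' => simp only [map_add, LinearMap.add_apply]; linear_combination h + h'
    | smul c x _ h => simp only [map_smul, LinearMap.smul_apply, smul_eq_mul]; linear_combination c * h
    | mem x hx =>
      obtain ⟨i, rfl⟩ := hx
      induction hy using Submodule.span_induction with
      | zero => simp
      | add x x' _ _ h h' => simp only [map_add, LinearMap.add_apply]; linear_combination h + h'
      | smul c x _ h => simp only [map_smul, LinearMap.smul_apply, smul_eq_mul]; linear_combination c * h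
      | mem y hy =>
        obtain ⟨j, rfl⟩ := hy
        have h1 := hiso _ (U.add_mem (bU i).2 (bU j).2)
        simp only [map_add, LinearMap.add_apply] at h1
        rw [hiso _ (bU i).2, hiso _ (bU j).2] at h1
        beta_reduce
        rw [← hB', ← hB', ← map_add]
        rw [zero_add, add_zero] at h1
        rw [add_comm, h1]
        simp
  have hQ : ∀ x ∈ W, Q x = 0 := by
    intro x hx
    rw [← hB]
    induction hx using Submodule.span_induction with
    | zero => simp
    | smul c x _ h => simp [h]
    | mem x hx =>
      obtain ⟨i, rfl⟩ := hx
      beta_reduce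
      rw [← hB', hiso _ (bU i).2, map_zero]
    | add x y hx hy h h' =>
      simp only [map_add, LinearMap.add_apply]
      linear_combination h + h' + hpol x hx y hy
  have hdisj : Disjoint V W := by
    rw [Submodule.disjoint_def]
    intro x hx hx'
    exact hani x hx (hQ x hx')
  have := Submodule.finrank_add_finrank_le_of_disjoint hdisj
  omega


theorem trdeg_adjoin_le {F K : Type u} [Field F] [Field K] [Algebra F K] (S : Set K) :
    Algebra.trdeg F (IntermediateField.adjoin F S) ≤ Cardinal.mk S := by
  open scoped IntermediateField.algebraAdjoinAdjoin in
  have h1 := _root_.trdeg_add_eq F (Algebra.adjoin F S) (A := IntermediateField.adjoin F S)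
  have h2 : Algebra.trdeg (Algebra.adjoin F S) (IntermediateField.adjoin F S) = 0 := by
    open scoped IntermediateField.algebraAdjoinAdjoin in
    exact _root_.trdeg_eq_zero_iff.mpr inferInstance
  rw [← h1, h2, add_zero]
  have h3 : Algebra.adjoin F S = (MvPolynomial.aeval (R := F) ((↑) : S → K)).range :=
    Algebra.adjoin_eq_range F S
  rw [h3]
  refine (trdeg_le_of_surjective (MvPolynomial.aeval (R := F) ((↑) : S → K)).rangeRestrict
    (AlgHom.rangeRestrict_surjective _)).trans ?_
  rw [MvPolynomial.trdeg_of_isDomain]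
  simp

theorem tsen_lang_trdeg {Ω M : Type u} [Field Ω] [IsAlgClosed Ω] [Field M] [Algebra Ω M]
    (h : Algebra.trdeg Ω M ≤ 3) : C9 M := by
  obtain ⟨ι, x, hx⟩ := exists_isTranscendenceBasis' Ω M
  have h1 : Cardinal.mk ι ≤ 3 := by rw [hx.cardinalMk_eq_trdeg]; exact h
  have hf : Finite ι := by
    rw [← Cardinal.mk_lt_aleph0_iff]
    exact lt_of_le_of_lt h1 (by exact_mod_cast Cardinal.natCast_lt_aleph0 (n := 3))
  have := Fintype.ofFinite ι
  rw [Cardinal.mk_fintype] at h1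
  intro a
  exact tsen_aux (by exact_mod_cast h1) x hx.1 hx.isAlgebraic_field a

theorem charpoly_dvd_pow {L n : Type*} [Field L] [Fintype n] [DecidableEq n]
    (A : Matrix n n L) (f : Polynomial L) (hf : Polynomial.aeval A f = 0) :
    A.charpoly ∣ f ^ Fintype.card n := by
  open Polynomial in
  let a : Matrix n n L[X] := A.map C
  let x : Matrix n n L[X] := Matrix.scalar n X
  have hxa : Commute x a := Matrix.scalar_commute _ (fun _ => Commute.all _ _) _
  have key : ∀ p : L[X], ∃ G : Matrix n n L[X], Matrix.scalar n p = (x - a) * G + (aeval A p).map C := by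
    intro p
    induction p using Polynomial.induction_on with
    | C c =>
      refine ⟨0, ?_⟩
      ext i j
      by_cases h : i = j <;> simp [h, Matrix.algebraMap_matrix_apply]
    | add p q hp hq =>
      obtain ⟨G, hG⟩ := hp
      obtain ⟨H, hH⟩ := hq
      refine ⟨G + H, ?_⟩
      rw [map_add, hG, hH, map_add, Matrix.map_add _ (by simp), mul_add]
      abel
    | monomial k c h =>
      obtain ⟨G, hG⟩ := h
      rw [pow_succ, ← mul_assoc]
      generalize C c * X ^ k = p at *
      refine ⟨G * x + (aeval A p).map C, ?_⟩
      rw [map_mul, hG, map_mul, aeval_X, Matrix.map_mul, add_mul, mul_add, sub_mul _ _ (Matrix.map _ _)]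
      have h1 : a * (aeval A p).map C = (aeval A p).map C * a := by
        simp only [a]
        rw [← Matrix.map_mul, ← Matrix.map_mul]
        congr 1
        have : A = aeval A (X : L[X]) := by simp
        nth_rewrite 1 [this]
        nth_rewrite 4 [this]
        rw [← map_mul, ← map_mul, mul_comm]
      have h2 : x * (aeval A p).map C = (aeval A p).map C * x :=
        Matrix.scalar_commute _ (fun _ => Commute.all _ _) _
      rw [h1, h2]
      change (x - a) * G * x + _ * x = _ + _ + _ * a
      rw [mul_assoc (x - a)]
      abel
  obtain ⟨G, hG⟩ := key f
  rw [hf] at hG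
  have h3 : (Matrix.scalar n f : Matrix n n (Polynomial L)).det = f ^ Fintype.card n := by
    simp
  rw [← h3, hG]
  refine ⟨G.det, ?_⟩
  rw [Matrix.charpoly, ← Matrix.det_mul]
  congr 1
  simp [Matrix.charmatrix, a, x]

theorem integral_coeff_charpoly {M K L A : Type*} [Field M] [Field K] [Field L] [Algebra M K] [Algebra K L]
    [Ring A] [Algebra K A] (ρ : A →ₐ[K] Matrix (Fin 4) (Fin 4) L) (z : A) (f : Polynomial M) (hf : f.Monic)
    (hz : Polynomial.aeval z (f.map (algebraMap M K)) = 0) (c : K) (i : ℕ)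
    (hc : algebraMap K L c = (ρ z).charpoly.coeff i) : IsIntegral M c := by
  let _ : Algebra M L := ((algebraMap K L).comp (algebraMap M K)).toAlgebra
  have : IsScalarTower M K L := IsScalarTower.of_algebraMap_eq fun _ => rfl
  have h1 : Polynomial.aeval (ρ z) (f.map (algebraMap M L)) = 0 := by
    have := congrArg ρ hz
    rw [map_zero, ← Polynomial.aeval_algHom_apply] at this
    rw [← this, IsScalarTower.algebraMap_eq M K L, ← Polynomial.map_map, Polynomial.aeval_map_algebraMap]
  have h2 := charpoly_dvd_pow _ _ h1
  rw [← Polynomial.map_pow] at h2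
  have h3 := Polynomial.isIntegral_coeff_of_dvd _ _ (hf.pow _) (Matrix.charpoly_monic _) h2 i
  rw [← hc] at h3
  exact (isIntegral_algHom_iff (IsScalarTower.toAlgHom M K L) (algebraMap K L).injective).mp h3

theorem exists_poly_of_descent {E M K A B : Type*} [Field E] [Field M] [Field K] [Algebra E M] [Algebra M K]
    [Algebra E K] [IsScalarTower E M K] [Ring A] [Algebra K A] [Ring B] [Algebra E B] [FiniteDimensional E B]
    (φ : (K ⊗[E] B) ≃ₐ[K] A) {ι : Type*} [Fintype ι] (β : ι → B) (x : ι → M) :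
    ∃ f : Polynomial M, f.Monic ∧ Polynomial.aeval (∑ i, algebraMap M K (x i) • φ (1 ⊗ₜ β i)) (f.map (algebraMap M K)) = 0 := by
  let g : M ⊗[E] B →ₐ[M] K ⊗[E] B := Algebra.TensorProduct.map (Algebra.ofId M K) (AlgHom.id E B)
  let z : M ⊗[E] B := ∑ i, x i ⊗ₜ β i
  obtain ⟨f, hf, hz⟩ := (Algebra.IsIntegral.isIntegral (R := M) z)
  refine ⟨f, hf, ?_⟩
  have h1 : Polynomial.aeval (g z) f = 0 := by
    rw [Polynomial.aeval_algHom_apply]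
    have : Polynomial.aeval z f = 0 := hz
    rw [this, map_zero]
  have h2 : ∑ i, algebraMap M K (x i) • φ (1 ⊗ₜ β i) = φ (g z) := by
    simp only [z, g, map_sum, Algebra.TensorProduct.map_tmul, AlgHom.id_apply, Algebra.ofId_apply]
    refine Finset.sum_congr rfl fun i _ => ?_
    rw [← map_smul, TensorProduct.smul_tmul', smul_eq_mul, mul_one]
  rw [h2, Polynomial.aeval_algHom_apply, Polynomial.aeval_map_algebraMap, h1, map_zero]


theorem descent_contra {F Ω K L : Type u} {A : Type*} [Field F] [Field Ω] [IsAlgClosed Ω] [Field K] [Algebra F Ω]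
    [Algebra Ω K] [Algebra F K] [IsScalarTower F Ω K] [Field L] [Algebra K L]
    [Ring A] [Algebra K A] (ρ : A →ₐ[K] Matrix (Fin 4) (Fin 4) L)
    (Q : QuadraticForm K A) (hQ : ∀ z, algebraMap K L (Q z) = (ρ z).charpoly.coeff 2)
    (V : Submodule K A) (hV : 13 ≤ Module.finrank K V) (hani : ∀ v ∈ V, Q v = 0 → v = 0)
    (E : IntermediateField F K) (s : Finset E) (hs : s.card ≤ 3)
    (hE : Algebra.IsAlgebraic (IntermediateField.adjoin F (s : Set E)) E)
    (B : Type*) [Ring B] [Algebra E B] (hB : Module.finrank E B = 16)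
    (φ : (K ⊗[E] B) ≃ₐ[K] A) : False := by
  classical
  let S : Set K := (fun x : E => (x : K)) '' (s : Set E)
  let k : IntermediateField Ω K := IntermediateField.adjoin Ω S
  let M := algebraicClosure k K
  have hSk : ∀ x ∈ IntermediateField.adjoin F (s : Set E), (x : K) ∈ k := by
    intro x hx
    have h1 : IntermediateField.adjoin F (s : Set E) ≤ (k.restrictScalars F).comap E.val := by
      rw [IntermediateField.adjoin_le_iff]
      intro y hy
      exact IntermediateField.subset_adjoin Ω S ⟨y, hy, rfl⟩
    exact h1 hx
  have hEM : ∀ x : E, (x : K) ∈ M := by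
    intro x
    rw [mem_algebraicClosure_iff]
    let f : IntermediateField.adjoin F (s : Set E) →+* k :=
      (((algebraMap E K).comp (algebraMap (IntermediateField.adjoin F (s : Set E)) E))).codRestrict k
        (fun x => hSk x x.2)
    exact (hE.isAlgebraic x).ringHom_of_comp_eq f (algebraMap E K) f.injective (by ext y; rfl)
  let iEM : E →+* M := (algebraMap E K).codRestrict M hEM
  let _ : Algebra E M := iEM.toAlgebra
  have : IsScalarTower E M K := IsScalarTower.of_algebraMap_eq fun _ => rfl
  have htr : Algebra.trdeg Ω M ≤ 3 := by
    have hfs : FaithfulSMul k M := (faithfulSMul_iff_algebraMap_injective k M).mpr (algebraMap k M).injective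
    have h1 := _root_.trdeg_add_eq Ω k (A := M)
    have h2 : Algebra.trdeg k M = 0 := _root_.trdeg_eq_zero
    rw [← h1, h2, add_zero]
    refine (trdeg_adjoin_le S).trans ?_
    refine Cardinal.mk_image_le.trans ?_
    have h3 : Cardinal.mk (s : Set E) = s.card := by simp
    rw [h3]
    exact_mod_cast hs
  have hC : C9 M := tsen_lang_trdeg htr
  have hfd : FiniteDimensional E B := Module.finite_of_finrank_pos (by omega)
  let β : Module.Basis (Fin 16) E B := Module.finBasisOfFinrankEq E B hB
  let e : Module.Basis (Fin 16) K A := (β.baseChange K).map φ.toLinearEquiv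
  refine isotropic_contra hC Q e ?_ V hV hani
  intro x
  obtain ⟨f, hf, hfz⟩ := exists_poly_of_descent φ β x
  have he : ∀ i, e i = φ (1 ⊗ₜ β i) := by intro i; simp [e]
  simp only [he]
  have h1 := integral_coeff_charpoly ρ _ f hf hfz _ 2 (hQ _)
  have h2 : Q (∑ i, algebraMap M K (x i) • φ (1 ⊗ₜ β i)) ∈ M := by
    rw [mem_algebraicClosure_iff]
    exact (isIntegral_trans _ h1).isAlgebraic
  exact ⟨⟨_, h2⟩, rfl⟩


/-- biquadratic Artin-Schreier data -/
structure Biq (K L : Type*) [Field K] [Field L] [Algebra K L] where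
  two : (2 : L) = 0
  x : L
  y : L
  σ : L →ₐ[K] L
  τ : L →ₐ[K] L
  σx : σ x = x + 1
  σy : σ y = y
  τx : τ x = x
  τy : τ y = y + 1
  σσ : ∀ l, σ (σ l) = l
  ττ : ∀ l, τ (τ l) = l
  στ : ∀ l, τ (σ l) = σ (τ l)
  fix : ∀ l, σ l = l → τ l = l → ∃ k, algebraMap K L k = l

namespace Biq
variable {K L : Type*} [Field K] [Field L] [Algebra K L] (S : Biq K L)
include S

theorem add_self (l : L) : l + l = 0 := by
  rw [← two_mul, S.two, zero_mul]

theorem exists_rep (l : L) : ∃ p : Fin 4 → K, l = algebraMap K L (p 0) + algebraMap K L (p 1) * S.x + algebraMap K L (p 2) * S.y + algebraMap K L (p 3) * (S.x * S.y) := by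
  have h2 := S.two
  have key : ∀ l, S.σ l = l → ∃ p q : K, l = algebraMap K L p + algebraMap K L q * S.y := by
    intro l hl
    obtain ⟨q, hq⟩ := S.fix (l + S.τ l) (by rw [map_add, ← S.στ, hl]) (by rw [map_add, S.ττ, add_comm])
    obtain ⟨p, hp⟩ := S.fix (l + (l + S.τ l) * S.y) (by rw [map_add, map_mul, map_add, ← S.στ, hl, S.σy])
      (by rw [map_add, map_mul, map_add, S.ττ, S.τy]; linear_combination S.τ l * h2)
    refine ⟨p, q, ?_⟩
    rw [hp, hq]
    linear_combination (-(l + S.τ l) * S.y) * h2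
  obtain ⟨p, q, h1⟩ := key (l + S.σ l) (by rw [map_add, S.σσ, add_comm])
  obtain ⟨p', q', h3⟩ := key (l + (l + S.σ l) * S.x) (by rw [map_add, map_mul, map_add, S.σσ, S.σx]; linear_combination S.σ l * h2)
  refine ⟨![p', p, q', q], ?_⟩
  simp
  linear_combination h3 + h1 * S.x - h2 * (l + S.σ l) * S.x

theorem rep_indep (p : Fin 4 → K) (h : algebraMap K L (p 0) + algebraMap K L (p 1) * S.x + algebraMap K L (p 2) * S.y + algebraMap K L (p 3) * (S.x * S.y) = 0) : p = 0 := by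
  have h1 := congrArg S.σ h
  have h2 := congrArg S.τ h
  simp only [map_add, map_mul, AlgHom.commutes, S.σx, S.σy, S.τx, S.τy, map_zero] at h1 h2
  have h3 := congrArg S.σ h2
  simp only [map_add, map_mul, AlgHom.commutes, S.σx, S.σy, S.τx, S.τy, map_zero, map_one] at h3
  have e3 : algebraMap K L (p 3) = 0 := by linear_combination h3 - h1 - h2 + h
  have e1 : algebraMap K L (p 1) = 0 := by rw [e3] at h1 h; linear_combination h1 - h
  have e2 : algebraMap K L (p 2) = 0 := by rw [e3] at h2 h; linear_combination h2 - h
  have e0 : algebraMap K L (p 0) = 0 := by rw [e3, e2, e1] at h; linear_combination h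
  rw [map_eq_zero] at e0 e1 e2 e3
  funext i
  fin_cases i <;> assumption

theorem finrank_eq : Module.finrank K L = 4 := by
  let f : (Fin 4 → K) →ₗ[K] L := Fintype.linearCombination K ![1, S.x, S.y, S.x * S.y]
  have hf : ∀ p, f p = algebraMap K L (p 0) + algebraMap K L (p 1) * S.x + algebraMap K L (p 2) * S.y + algebraMap K L (p 3) * (S.x * S.y) := by
    intro p
    simp [f, Fintype.linearCombination_apply, Fin.sum_univ_four, Algebra.smul_def]
  have hinj : Function.Injective f := by
    rw [← LinearMap.ker_eq_bot, LinearMap.ker_eq_bot']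
    intro p hp
    exact S.rep_indep p (by rw [← hf, hp])
  have hsurj : Function.Surjective f := by
    intro l
    obtain ⟨p, hp⟩ := S.exists_rep l
    exact ⟨p, by rw [hf, hp]⟩
  rw [← (LinearEquiv.ofBijective f ⟨hinj, hsurj⟩).finrank_eq]
  simp
end Biq

/-- crossed product data in a ring `R`. -/
structure CP {K L : Type*} [Field K] [Field L] [Algebra K L] (S : Biq K L) (R : Type*) [Ring R] [Algebra K R] where
  D : L →ₐ[K] R
  u : R
  v : R
  b₁ : L
  b₂ : L
  c : L
  hb₁ : b₁ ≠ 0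
  hb₂ : b₂ ≠ 0
  hu : ∀ l, u * D l = D (S.σ l) * u
  hv : ∀ l, v * D l = D (S.τ l) * v
  huu : u * u = D b₁
  hvv : v * v = D b₂
  hvu : v * u = D c * (u * v)

namespace CP
variable {K L : Type*} [Field K] [Field L] [Algebra K L] {S : Biq K L} {R : Type*} [Ring R] [Algebra K R] (P : CP S R)

/-- general element -/
def el : (Fin 4 → L) →ₗ[K] R where
  toFun p := P.D (p 0) + P.D (p 1) * P.u + P.D (p 2) * P.v + P.D (p 3) * (P.u * P.v)
  map_add' p q := by simp [add_mul]; abel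
  map_smul' k p := by simp [smul_add]

theorem el_apply (p : Fin 4 → L) : P.el p = P.D (p 0) + P.D (p 1) * P.u + P.D (p 2) * P.v + P.D (p 3) * (P.u * P.v) := rfl

theorem mem0 (l : L) : P.D l ∈ LinearMap.range P.el := ⟨![l, 0, 0, 0], by simp [el_apply]⟩
theorem mem1 (l : L) : P.D l * P.u ∈ LinearMap.range P.el := ⟨![0, l, 0, 0], by simp [el_apply]⟩
theorem mem2 (l : L) : P.D l * P.v ∈ LinearMap.range P.el := ⟨![0, 0, l, 0], by simp [el_apply]⟩
theorem mem3 (l : L) : P.D l * (P.u * P.v) ∈ LinearMap.range P.el := ⟨![0, 0, 0, l], by simp [el_apply]⟩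

theorem hu' (l : L) (z : R) : P.u * (P.D l * z) = P.D (S.σ l) * (P.u * z) := by
  rw [← mul_assoc, P.hu, mul_assoc]
theorem hv' (l : L) (z : R) : P.v * (P.D l * z) = P.D (S.τ l) * (P.v * z) := by
  rw [← mul_assoc, P.hv, mul_assoc]
theorem huu' (z : R) : P.u * (P.u * z) = P.D P.b₁ * z := by rw [← mul_assoc, P.huu]
theorem hvv' (z : R) : P.v * (P.v * z) = P.D P.b₂ * z := by rw [← mul_assoc, P.hvv]
theorem hvu' (z : R) : P.v * (P.u * z) = P.D P.c * (P.u * (P.v * z)) := by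
  rw [← mul_assoc, P.hvu, mul_assoc, mul_assoc]
theorem hDD (l m : L) : P.D l * P.D m = P.D (l * m) := (map_mul _ _ _).symm
theorem hDD' (l m : L) (z : R) : P.D l * (P.D m * z) = P.D (l * m) * z := by rw [← mul_assoc, hDD]

theorem mul_mem {z w : R} (hz : z ∈ LinearMap.range P.el) (hw : w ∈ LinearMap.range P.el) :
    z * w ∈ LinearMap.range P.el := by
  obtain ⟨p, rfl⟩ := hz
  obtain ⟨q, rfl⟩ := hw
  simp only [el_apply, mul_add, add_mul, mul_assoc, hu, hu', hv, hv', huu, huu', hvv, hvv', hvu, hvu', hDD, hDD']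
  have m0 := P.mem0
  have m1 := P.mem1
  have m2 := P.mem2
  have m3 := P.mem3
  repeat' apply Submodule.add_mem
  all_goals first | apply m0 | apply m1 | apply m2 | apply m3

/-- the crossed product subalgebra -/
def sub : Subalgebra K R where
  carrier := LinearMap.range P.el
  mul_mem' := P.mul_mem
  add_mem' := Submodule.add_mem _
  algebraMap_mem' k := by
    have := P.mem0 (algebraMap K L k)
    rwa [AlgHom.commutes] at this

theorem mem_sub {z : R} : z ∈ P.sub ↔ ∃ p, P.el p = z := Iff.rfl
theorem u_mem : P.u ∈ P.sub := by have := P.mem1 1; rwa [map_one, one_mul] at this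
theorem v_mem : P.v ∈ P.sub := by have := P.mem2 1; rwa [map_one, one_mul] at this
theorem el_mem (p) : P.el p ∈ P.sub := ⟨p, rfl⟩

variable [Nontrivial R]

omit [Nontrivial R] in
include P in
theorem two : (2 : R) = 0 := by
  have := congrArg P.D S.two
  rwa [map_zero, map_ofNat] at this

omit [Nontrivial R] in
theorem D_mul_el (m : L) (p : Fin 4 → L) : P.D m * P.el p = P.el ![m * p 0, m * p 1, m * p 2, m * p 3] := by
  simp [el_apply, mul_add, mul_assoc]

omit [Nontrivial R] in
theorem el_mul_D (m : L) (p : Fin 4 → L) :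
    P.el p * P.D m = P.el ![p 0 * m, p 1 * S.σ m, p 2 * S.τ m, p 3 * S.σ (S.τ m)] := by
  simp only [el_apply, add_mul, mul_assoc, hu, hu', hv, hDD, hDD']
  simp

omit [Nontrivial R] in
theorem adx (p : Fin 4 → L) : P.D S.x * P.el p + P.el p * P.D S.x = P.el ![0, p 1, 0, p 3] := by
  have h2 := S.two
  rw [D_mul_el, el_mul_D, ← map_add]
  congr 1
  funext i
  fin_cases i <;> simp [S.σx, S.τx]
  · linear_combination S.x * p 0 * h2
  · linear_combination S.x * p 1 * h2
  · linear_combination S.x * p 2 * h2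
  · linear_combination S.x * p 3 * h2

omit [Nontrivial R] in
theorem ady (p : Fin 4 → L) : P.D S.y * P.el p + P.el p * P.D S.y = P.el ![0, 0, p 2, p 3] := by
  have h2 := S.two
  rw [D_mul_el, el_mul_D, ← map_add]
  congr 1
  funext i
  fin_cases i <;> simp [S.σy, S.τy]
  · linear_combination S.y * p 0 * h2
  · linear_combination S.y * p 1 * h2
  · linear_combination S.y * p 2 * h2
  · linear_combination S.y * p 3 * h2

omit [Nontrivial R] in
theorem hbD {l : L} (hl : l ≠ 0) : P.D l⁻¹ * P.D l = 1 := by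
  rw [hDD, inv_mul_cancel₀ hl, map_one]

omit [Nontrivial R] in
/-- The four components of an element of a set closed under multiplication by `D`
and `u`,`v`: if nonzero, it contains `1`. -/
theorem one_mem (I : AddSubgroup R) (hI : ∀ z ∈ P.sub, ∀ w ∈ I, z * w ∈ I ∧ w * z ∈ I) (p : Fin 4 → L) (hp : P.el p ∈ I)
    (hp0 : p ≠ 0) : (1 : R) ∈ I := by
  have hD : ∀ l, P.D l ∈ P.sub := P.mem0
  have hx : ∀ p, P.el p ∈ I → P.el ![0, p 1, 0, p 3] ∈ I := fun p hp => by
    rw [← adx]; exact I.add_mem (hI _ (hD _) _ hp).1 (hI _ (hD _) _ hp).2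
  have hy : ∀ p, P.el p ∈ I → P.el ![0, 0, p 2, p 3] ∈ I := fun p hp => by
    rw [← ady]; exact I.add_mem (hI _ (hD _) _ hp).1 (hI _ (hD _) _ hp).2
  have huI : P.u ∈ P.sub := P.u_mem
  have hvI : P.v ∈ P.sub := P.v_mem
  have h3 : P.el ![0, 0, 0, p 3] ∈ I := by simpa using hy _ (hx _ hp)
  have h1 : P.el ![0, p 1, 0, 0] ∈ I := by
    have := I.sub_mem (hx _ hp) h3
    rw [← map_sub] at this
    convert this using 2
    funext i
    fin_cases i <;> simp
  have h2 : P.el ![0, 0, p 2, 0] ∈ I := by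
    have := I.sub_mem (hy _ hp) h3
    rw [← map_sub] at this
    convert this using 2
    funext i
    fin_cases i <;> simp
  have h0 : P.el ![p 0, 0, 0, 0] ∈ I := by
    have := I.sub_mem (I.sub_mem (I.sub_mem hp h1) h2) h3
    rw [← map_sub, ← map_sub, ← map_sub] at this
    convert this using 2
    funext i
    fin_cases i <;> simp [-Matrix.sub_cons]
  have key : ∀ l : L, l ≠ 0 → P.D l ∈ I → (1 : R) ∈ I := by
    intro l hl h
    rw [← P.hbD hl]
    exact (hI _ (hD _) _ h).1
  obtain ⟨i, hi⟩ := Function.ne_iff.mp hp0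
  fin_cases i
  · simp [el_apply] at h0
    exact key _ hi h0
  · simp [el_apply] at h1
    have := (hI _ huI _ h1).2
    rw [mul_assoc, P.huu, hDD] at this
    exact key _ (mul_ne_zero hi P.hb₁) this
  · simp [el_apply] at h2
    have := (hI _ hvI _ h2).2
    rw [mul_assoc, P.hvv, hDD] at this
    exact key _ (mul_ne_zero hi P.hb₂) this
  · simp [el_apply] at h3
    have := (hI _ hvI _ h3).2
    rw [mul_assoc, mul_assoc, P.hvv, P.hu, ← mul_assoc, hDD] at this
    have := (hI _ huI _ this).2
    rw [mul_assoc, P.huu, hDD] at this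
    exact key _ (mul_ne_zero (mul_ne_zero hi (by simpa using P.hb₂)) P.hb₁) this

theorem el_injective : Function.Injective P.el := by
  rw [← LinearMap.ker_eq_bot, LinearMap.ker_eq_bot']
  intro p hp
  by_contra h
  exact one_ne_zero ((AddSubgroup.mem_bot).mp (P.one_mem ⊥ (by rintro z - w hw; rw [AddSubgroup.mem_bot] at hw; simp [hw]) p (by simp [hp]) h))

theorem finrank_sub : Module.finrank K P.sub = 16 := by
  have hfd : FiniteDimensional K L := Module.finite_of_finrank_pos (by rw [S.finrank_eq]; norm_num)
  have e : (Fin 4 → L) ≃ₗ[K] P.sub := LinearEquiv.ofInjective P.el P.el_injective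
  rw [← e.finrank_eq, Module.finrank_pi_fintype]
  simp [S.finrank_eq]

instance isSimpleRing_sub : IsSimpleRing P.sub := by
  rw [isSimpleRing_iff_isTwoSided_imp]
  refine ⟨inferInstance, ?_⟩
  intro I hI
  rw [or_iff_not_imp_left]
  intro hne
  obtain ⟨⟨z, hz⟩, hzI, hz0⟩ := Submodule.exists_mem_ne_zero_of_ne_bot hne
  obtain ⟨p, rfl⟩ := hz
  rw [Ideal.eq_top_iff_one]
  have := P.one_mem (I.toAddSubgroup.map P.sub.val.toAddMonoidHom) ?_ p ⟨_, hzI, rfl⟩ ?_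
  · obtain ⟨w, hw, h⟩ := this
    have : w = 1 := Subtype.ext h
    rwa [← this]
  · rintro z hz _ ⟨w, hw, rfl⟩
    exact ⟨⟨⟨z, hz⟩ * w, I.mul_mem_left _ hw, rfl⟩, ⟨w * ⟨z, hz⟩, I.mul_mem_right _ hw, rfl⟩⟩
  · rintro rfl
    exact hz0 (Subtype.ext (map_zero _))

instance isCentral_sub : Algebra.IsCentral K P.sub := by
  constructor
  rintro ⟨z, p, rfl⟩ hz
  rw [Subalgebra.mem_center_iff] at hz
  have hz' : ∀ w ∈ P.sub, w * P.el p = P.el p * w := fun w hw => congrArg Subtype.val (hz ⟨w, hw⟩)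
  have h0 : ∀ z : R, z + z = 0 := fun z => by rw [← two_mul, P.two, zero_mul]
  have hx : P.el ![0, p 1, 0, p 3] = 0 := by
    rw [← adx, hz' _ (P.mem0 _), h0]
  have hy : P.el ![0, 0, p 2, p 3] = 0 := by
    rw [← ady, hz' _ (P.mem0 _), h0]
  rw [← map_zero P.el] at hx hy
  have hx := P.el_injective hx
  have hy := P.el_injective hy
  have p1 : p 1 = 0 := by simpa using congrFun hx 1
  have p2 : p 2 = 0 := by simpa using congrFun hy 2
  have p3 : p 3 = 0 := by simpa using congrFun hy 3
  have hel : P.el p = P.D (p 0) := by simp [el_apply, p1, p2, p3]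
  have hu := hz' P.u P.u_mem
  have hv := hz' P.v P.v_mem
  rw [hel] at hu hv
  rw [P.hu] at hu
  rw [P.hv] at hv
  have e1 : S.σ (p 0) = p 0 := by
    have : P.el ![0, S.σ (p 0), 0, 0] = P.el ![0, p 0, 0, 0] := by simpa [el_apply] using hu
    simpa using congrFun (P.el_injective this) 1
  have e2 : S.τ (p 0) = p 0 := by
    have : P.el ![0, 0, S.τ (p 0), 0] = P.el ![0, 0, p 0, 0] := by simpa [el_apply] using hv
    simpa using congrFun (P.el_injective this) 2
  obtain ⟨k, hk⟩ := S.fix _ e1 e2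
  rw [Algebra.mem_bot]
  refine ⟨k, Subtype.ext ?_⟩
  change algebraMap K R k = P.el p
  rw [hel, ← hk, AlgHom.commutes]

end CP


section
variable {K L : Type*} [Field K] [Field L] [Algebra K L] (S : Biq K L)
def matU (b₁ : L) : Matrix (Fin 4) (Fin 4) L := !![0, b₁, 0, 0; 1, 0, 0, 0; 0, 0, 0, S.τ b₁; 0, 0, 1, 0]
def matV (b₂ c : L) : Matrix (Fin 4) (Fin 4) L := !![0, 0, b₂, 0; 0, 0, 0, S.σ c * b₂; 1, 0, 0, 0; 0, S.σ (S.τ c), 0, 0]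

theorem matU_mulVec (b₁ : L) (w : Fin 4 → L) : (matU S b₁).mulVec w = ![b₁ * w 1, w 0, S.τ b₁ * w 3, w 2] := by
  funext i; fin_cases i <;> simp [matU, Matrix.mulVec, dotProduct, Fin.sum_univ_four]
theorem matV_mulVec (b₂ c : L) (w : Fin 4 → L) : (matV S b₂ c).mulVec w = ![b₂ * w 2, S.σ c * b₂ * w 3, w 0, S.σ (S.τ c) * w 1] := by
  funext i; fin_cases i <;> simp [matV, Matrix.mulVec, dotProduct, Fin.sum_univ_four]

theorem mat_ext_mulVec {A B : Matrix (Fin 4) (Fin 4) L} (h : ∀ w, A.mulVec w = B.mulVec w) : A = B :=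
  Matrix.toLin'.injective (LinearMap.ext h)

def matD : L →ₐ[K] Matrix (Fin 4) (Fin 4) L :=
    { toFun := fun l => Matrix.diagonal ![l, S.σ l, S.τ l, S.σ (S.τ l)]
      map_one' := by rw [← Matrix.diagonal_one]; congr 1; funext i; fin_cases i <;> simp
      map_zero' := by rw [← Matrix.diagonal_zero]; congr 1; funext i; fin_cases i <;> simp
      map_add' := by intro a b; rw [Matrix.diagonal_add]; congr 1; funext i; fin_cases i <;> simp
      map_mul' := by intro a b; rw [Matrix.diagonal_mul_diagonal]; congr 1; funext i; fin_cases i <;> simp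
      commutes' := by intro r; rw [Matrix.algebraMap_eq_diagonal]; congr 1; funext i; fin_cases i <;> simp }

theorem matD_mulVec (l : L) (w : Fin 4 → L) : (matD S l).mulVec w = ![l * w 0, S.σ l * w 1, S.τ l * w 2, S.σ (S.τ l) * w 3] := by
  funext i
  simp only [matD, AlgHom.coe_mk, RingHom.coe_mk, MonoidHom.coe_mk, OneHom.coe_mk, Matrix.mulVec_diagonal]
  fin_cases i <;> simp

/-- matrix model -/
def matCP (b₁ b₂ c : L) (hb₁ : b₁ ≠ 0) (hb₂ : b₂ ≠ 0)
    (h1 : S.σ b₁ = b₁) (h2 : S.τ b₂ = b₂) (hc1 : c * S.σ c * b₁ = S.τ b₁) (hc2 : c * S.τ c * S.σ b₂ = b₂) :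
    CP S (Matrix (Fin 4) (Fin 4) L) where
  D := matD S
  u := matU S b₁
  v := matV S b₂ c
  b₁ := b₁
  b₂ := b₂
  c := c
  hb₁ := hb₁
  hb₂ := hb₂
  hu l := by
    refine mat_ext_mulVec fun w => ?_
    simp only [← Matrix.mulVec_mulVec, matU_mulVec, matD_mulVec, matV_mulVec]
    simp [S.σσ, S.ττ, S.στ]
    refine ⟨?_, ?_⟩ <;> ring
  hv l := by
    refine mat_ext_mulVec fun w => ?_
    simp only [← Matrix.mulVec_mulVec, matU_mulVec, matD_mulVec, matV_mulVec]
    simp [S.σσ, S.ττ, S.στ]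
    refine ⟨?_, ?_, ?_⟩ <;> ring
  huu := by
    refine mat_ext_mulVec fun w => ?_
    simp only [← Matrix.mulVec_mulVec, matU_mulVec, matD_mulVec, matV_mulVec]
    simp [S.σσ, S.ττ, ← S.στ, h1]
  hvv := by
    have := congrArg S.σ hc2
    simp only [map_mul, S.σσ] at this
    refine mat_ext_mulVec fun w => ?_
    simp only [← Matrix.mulVec_mulVec, matU_mulVec, matD_mulVec, matV_mulVec]
    simp [S.σσ, S.ττ, h2]
    exact ⟨by linear_combination this * w 1, by linear_combination this * w 3⟩
  hvu := by
    have e1 := congrArg S.τ hc1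
    simp only [map_mul, S.ττ, S.στ] at e1
    have e2 := congrArg S.σ hc2
    simp only [map_mul, S.σσ] at e2
    refine mat_ext_mulVec fun w => ?_
    simp only [← Matrix.mulVec_mulVec, matU_mulVec, matD_mulVec, matV_mulVec]
    simp [S.σσ, S.ττ, S.στ]
    exact ⟨by linear_combination -hc1 * b₂ * w 3, by ring, by linear_combination -e1 * w 1⟩
end

theorem charpoly_coeff_two {L : Type*} [Field L] (X : Matrix (Fin 4) (Fin 4) L) :
    X.charpoly.coeff 2 = (X 0 0 * X 1 1 - X 0 1 * X 1 0) + (X 0 0 * X 2 2 - X 0 2 * X 2 0)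
      + (X 0 0 * X 3 3 - X 0 3 * X 3 0) + (X 1 1 * X 2 2 - X 1 2 * X 2 1)
      + (X 1 1 * X 3 3 - X 1 3 * X 3 1) + (X 2 2 * X 3 3 - X 2 3 * X 3 2) := by
  have h : X.charpoly = Polynomial.X ^ 4 + Polynomial.C (-(X 0 0 + X 1 1 + X 2 2 + X 3 3)) * Polynomial.X ^ 3
      + Polynomial.C ((X 0 0 * X 1 1 - X 0 1 * X 1 0) + (X 0 0 * X 2 2 - X 0 2 * X 2 0)
      + (X 0 0 * X 3 3 - X 0 3 * X 3 0) + (X 1 1 * X 2 2 - X 1 2 * X 2 1)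
      + (X 1 1 * X 3 3 - X 1 3 * X 3 1) + (X 2 2 * X 3 3 - X 2 3 * X 3 2)) * Polynomial.X ^ 2
      + Polynomial.C (0 - X 0 0*X 1 1*X 2 2 + X 0 0*X 1 2*X 2 1 + X 0 1*X 1 0*X 2 2 - X 0 1*X 1 2*X 2 0 - X 0 2*X 1 0*X 2 1 + X 0 2*X 1 1*X 2 0 - X 0 0*X 1 1*X 3 3 + X 0 0*X 1 3*X 3 1 + X 0 1*X 1 0*X 3 3 - X 0 1*X 1 3*X 3 0 - X 0 3*X 1 0*X 3 1 + X 0 3*X 1 1*X 3 0 - X 0 0*X 2 2*X 3 3 + X 0 0*X 2 3*X 3 2 + X 0 2*X 2 0*X 3 3 - X 0 2*X 2 3*X 3 0 - X 0 3*X 2 0*X 3 2 + X 0 3*X 2 2*X 3 0 - X 1 1*X 2 2*X 3 3 + X 1 1*X 2 3*X 3 2 + X 1 2*X 2 1*X 3 3 - X 1 2*X 2 3*X 3 1 - X 1 3*X 2 1*X 3 2 + X 1 3*X 2 2*X 3 1) * Polynomial.X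
      + Polynomial.C (0 + X 0 0*X 1 1*X 2 2*X 3 3 - X 0 0*X 1 1*X 2 3*X 3 2 - X 0 0*X 1 2*X 2 1*X 3 3 + X 0 0*X 1 2*X 2 3*X 3 1 + X 0 0*X 1 3*X 2 1*X 3 2 - X 0 0*X 1 3*X 2 2*X 3 1 - X 0 1*X 1 0*X 2 2*X 3 3 + X 0 1*X 1 0*X 2 3*X 3 2 + X 0 1*X 1 2*X 2 0*X 3 3 - X 0 1*X 1 2*X 2 3*X 3 0 - X 0 1*X 1 3*X 2 0*X 3 2 + X 0 1*X 1 3*X 2 2*X 3 0 + X 0 2*X 1 0*X 2 1*X 3 3 - X 0 2*X 1 0*X 2 3*X 3 1 - X 0 2*X 1 1*X 2 0*X 3 3 + X 0 2*X 1 1*X 2 3*X 3 0 + X 0 2*X 1 3*X 2 0*X 3 1 - X 0 2*X 1 3*X 2 1*X 3 0 - X 0 3*X 1 0*X 2 1*X 3 2 + X 0 3*X 1 0*X 2 2*X 3 1 + X 0 3*X 1 1*X 2 0*X 3 2 - X 0 3*X 1 1*X 2 2*X 3 0 - X 0 3*X 1 2*X 2 0*X 3 1 + X 0 3*X 1 2*X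 2 1*X 3 0) := by
    rw [Matrix.charpoly, Matrix.det_succ_row_zero]
    simp [Fin.sum_univ_succ, Matrix.det_fin_three, Matrix.charmatrix_apply, Fin.succAbove, Matrix.submatrix_apply]
    ring
  rw [h]
  simp only [Polynomial.coeff_add, Polynomial.coeff_C_mul, Polynomial.coeff_X_pow, Polynomial.coeff_X, Polynomial.coeff_C]
  norm_num


/-- second coefficient as quadratic map -/
def sMat (L : Type*) [Field L] : QuadraticMap L (Matrix (Fin 4) (Fin 4) L) L :=
  LinearMap.BilinMap.toQuadraticMap (LinearMap.mk₂ L (fun X Y : Matrix (Fin 4) (Fin 4) L =>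
    (X 0 0 * Y 1 1 - X 0 1 * Y 1 0) + (X 0 0 * Y 2 2 - X 0 2 * Y 2 0)
      + (X 0 0 * Y 3 3 - X 0 3 * Y 3 0) + (X 1 1 * Y 2 2 - X 1 2 * Y 2 1)
      + (X 1 1 * Y 3 3 - X 1 3 * Y 3 1) + (X 2 2 * Y 3 3 - X 2 3 * Y 3 2))
    (by intros; simp only [Matrix.add_apply]; ring) (by intros; simp only [Matrix.smul_apply, smul_eq_mul]; ring)
    (by intros; simp only [Matrix.add_apply]; ring) (by intros; simp only [Matrix.smul_apply, smul_eq_mul]; ring))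

theorem sMat_apply {L : Type*} [Field L] (X : Matrix (Fin 4) (Fin 4) L) : sMat L X = X.charpoly.coeff 2 := by
  rw [charpoly_coeff_two]; rfl

section
variable {K L : Type*} [Field K] [Field L] [Algebra K L] (S : Biq K L) (b₁ b₂ c : L) (hb₁ : b₁ ≠ 0) (hb₂ : b₂ ≠ 0)
    (h1 : S.σ b₁ = b₁) (h2 : S.τ b₂ = b₂) (hc1 : c * S.σ c * b₁ = S.τ b₁) (hc2 : c * S.τ c * S.σ b₂ = b₂)

def e2 (l : L) : L := l * S.σ l + l * S.τ l + l * S.σ (S.τ l) + S.σ l * S.τ l + S.σ l * S.σ (S.τ l) + S.τ l * S.σ (S.τ l)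
def q1 (l : L) : L := b₁ * l * S.σ l + S.τ (b₁ * l * S.σ l)
def q2 (l : L) : L := b₂ * l * S.τ l + S.σ (b₂ * l * S.τ l)
def q3 (b₃ l : L) : L := b₃ * l * S.σ (S.τ l) + S.σ (b₃ * l * S.σ (S.τ l))

theorem matCP_el (p : Fin 4 → L) : (matCP S b₁ b₂ c hb₁ hb₂ h1 h2 hc1 hc2).el p =
    !![p 0, p 1 * b₁, p 2 * b₂, p 3 * (b₁ * b₂ * S.σ c);
       S.σ (p 1), S.σ (p 0), S.σ (p 3) * b₂, S.σ (p 2) * S.σ c * b₂;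
       S.τ (p 2), S.τ (p 3) * S.τ b₁ * S.σ (S.τ c), S.τ (p 0), S.τ (p 1) * S.τ b₁;
       S.σ (S.τ (p 3)), S.σ (S.τ (p 2)) * S.σ (S.τ c), S.σ (S.τ (p 1)), S.σ (S.τ (p 0))] := by
  refine mat_ext_mulVec fun w => ?_
  rw [CP.el_apply]
  simp only [matCP, Matrix.add_mulVec, ← Matrix.mulVec_mulVec, matU_mulVec, matD_mulVec, matV_mulVec]
  funext i
  fin_cases i <;> simp [Matrix.mulVec, dotProduct, Fin.sum_univ_four] <;> ring

theorem s2_el (p : Fin 4 → L) : sMat L ((matCP S b₁ b₂ c hb₁ hb₂ h1 h2 hc1 hc2).el p) =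
    e2 S (p 0) + q1 S b₁ (p 1) + q2 S b₂ (p 2) + q3 S (b₁ * b₂ * S.σ c) (p 3) := by
  have e3 := congrArg S.σ hc2
  have two := S.two
  simp only [map_mul, S.σσ] at e3
  have e4 : b₂ * S.τ b₁ * S.σ (S.τ c) = c * b₁ * S.σ b₂ := by rw [← hc1, ← e3]; ring
  rw [sMat_apply, charpoly_coeff_two, matCP_el]
  simp [e2, q1, q2, q3, S.σσ, S.ττ, S.στ, h1, h2]
  linear_combination (-1 * S.σ (p 2) * S.σ (S.τ (p 2))) * e3 - S.σ (p 3) * S.τ (p 3) * e4 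
   - (p 1 * b₁ * S.σ (p 1) + S.τ (p 1) * S.τ b₁ * S.σ (S.τ (p 1)) + p 2 * b₂ * S.τ (p 2) + S.σ (p 2) * S.σ (S.τ (p 2)) * S.σ b₂ + p 3 * (b₁ * b₂ * S.σ c) * S.σ (S.τ (p 3)) + S.σ (p 3) * S.τ (p 3) * (c * b₁ * S.σ b₂)) * two

theorem s2_fix (p : Fin 4 → L) : ∃ k, algebraMap K L k = sMat L ((matCP S b₁ b₂ c hb₁ hb₂ h1 h2 hc1 hc2).el p) := by
  have e3 := congrArg S.σ hc2
  simp only [map_mul, S.σσ] at e3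
  have e5 := congrArg S.τ hc1
  simp only [map_mul, S.ττ, S.στ] at e5
  have e4 : b₂ * S.τ b₁ * S.σ (S.τ c) = c * b₁ * S.σ b₂ := by rw [← hc1, ← e3]; ring
  have e6 := congrArg S.τ e4
  simp only [map_mul, S.ττ, S.στ, h2, h1] at e6
  apply S.fix
  · rw [s2_el]
    simp only [e2, q1, q2, q3, map_add, map_mul, S.σσ, S.ττ, S.στ, h1, h2]
    have : S.σ (S.τ b₁) = S.τ b₁ := by rw [← S.στ, h1]
    rw [this]
    ring
  · rw [s2_el]
    simp only [e2, q1, q2, q3, map_add, map_mul, S.σσ, S.ττ, S.στ, h1, h2]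
    have : S.σ (S.τ b₁) = S.τ b₁ := by rw [← S.στ, h1]
    linear_combination S.τ (p 3) * S.σ (p 3) * e4 - p 3 * S.σ (S.τ (p 3)) * e6
end


theorem lower_core {F Ω K L : Type u} [Field F] [Field Ω] [IsAlgClosed Ω] [Field K] [Algebra F Ω]
    [Algebra Ω K] [Algebra F K] [IsScalarTower F Ω K] [Field L] [Algebra K L]
    (S : Biq K L) (b₁ b₂ c : L) (hb₁ : b₁ ≠ 0) (hb₂ : b₂ ≠ 0)
    (h1 : S.σ b₁ = b₁) (h2 : S.τ b₂ = b₂) (hc1 : c * S.σ c * b₁ = S.τ b₁) (hc2 : c * S.τ c * S.σ b₂ = b₂)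
    (hani : ∀ (k : K) (l₁ l₂ l₃ : L), algebraMap K L k ^ 2 + q1 S b₁ l₁ + q2 S b₂ l₂ + q3 S (b₁ * b₂ * S.σ c) l₃ = 0 →
      k = 0 ∧ l₁ = 0 ∧ l₂ = 0 ∧ l₃ = 0) (m : ℕ) (hm : csaDegFourEdLE F m) : 4 ≤ m := by
  by_contra hlt
  let P := matCP S b₁ b₂ c hb₁ hb₂ h1 h2 hc1 hc2
  obtain ⟨E, ⟨s, hs, hE⟩, B, _, _, hB, -, -, ⟨φ⟩⟩ := hm K P.sub P.finrank_sub P.isCentral_sub P.isSimpleRing_sub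
  obtain ⟨lam, hlam⟩ := LinearMap.exists_leftInverse_of_injective (Algebra.linearMap K L)
    (LinearMap.ker_eq_bot.mpr (algebraMap K L).injective)
  have hlam' : ∀ k, lam (algebraMap K L k) = k := fun k => congrArg (fun f => f k) hlam
  let Q : QuadraticForm K P.sub := lam.compQuadraticMap ((QuadraticMap.restrictScalars (S := K) (sMat L)).comp P.sub.val.toLinearMap)
  have hQ' : ∀ z : P.sub, Q z = lam (sMat L (z : Matrix _ _ L)) := fun z => rfl
  have hQ : ∀ z : P.sub, algebraMap K L (Q z) = sMat L (z : Matrix _ _ L) := by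
    rintro ⟨_, p, rfl⟩
    rw [hQ']
    obtain ⟨k, hk⟩ := s2_fix S b₁ b₂ c hb₁ hb₂ h1 h2 hc1 hc2 p
    simp only
    rw [← hk, hlam']
  let g : K × (Fin 3 → L) →ₗ[K] (Fin 4 → L) :=
    { toFun := fun r => ![algebraMap K L r.1 * S.y, r.2 0, r.2 1, r.2 2]
      map_add' := by intro r s; funext i; fin_cases i <;> simp [add_mul]
      map_smul' := by intro k r; funext i; fin_cases i <;> simp [Algebra.smul_def, mul_assoc] }
  let el' : (Fin 4 → L) →ₗ[K] P.sub := P.el.codRestrict (Subalgebra.toSubmodule P.sub) P.el_mem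
  have hel' : ∀ p, (el' p : Matrix _ _ L) = P.el p := fun p => rfl
  have hy : S.y ≠ 0 := by
    intro h
    have := S.τy
    rw [h, map_zero, zero_add] at this
    exact zero_ne_one this
  have hfd : FiniteDimensional K L := Module.finite_of_finrank_pos (by rw [S.finrank_eq]; norm_num)
  refine descent_contra (Ω := Ω) P.sub.val Q (fun z => by rw [hQ, sMat_apply]; rfl) (LinearMap.range (el' ∘ₗ g)) ?_ ?_ E s (by omega) hE B hB φ
  · rw [LinearMap.finrank_range_of_inj]
    · rw [Module.finrank_prod, Module.finrank_pi_fintype]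
      simp [S.finrank_eq]
    · intro r r' h
      have h' : P.el (g r) = P.el (g r') := congrArg Subtype.val h
      have h'' := P.el_injective h'
      have e0 := congrFun h'' 0
      have e1 := congrFun h'' 1
      have e2 := congrFun h'' 2
      have e3 := congrFun h'' 3
      simp [g, hy] at e0 e1 e2 e3
      ext i
      · exact e0
      · fin_cases i <;> assumption
  · rintro _ ⟨⟨k, l⟩, rfl⟩ h0
    have h := hQ ((el' ∘ₗ g) (k, l))
    rw [h0, map_zero, LinearMap.comp_apply, hel', s2_el] at h
    have two := S.two
    have he : e2 S (algebraMap K L k * S.y) = algebraMap K L k ^ 2 := by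
      simp only [e2, map_mul, AlgHom.commutes, S.σy, S.τy, map_add, map_one]
      linear_combination (algebraMap K L k ^ 2 * (3 * S.y ^ 2 + 3 * S.y)) * two
    simp [g, he] at h
    obtain ⟨hk, hl0, hl1, hl2⟩ := hani _ _ _ _ h.symm
    apply Subtype.ext
    rw [LinearMap.comp_apply, hel']
    have : g (k, l) = 0 := by
      funext i
      fin_cases i <;> simp [g, hk, hl0, hl1, hl2]
    rw [this]; simp


/-- valuation-like function -/
structure VV (K Γ : Type*) [Field K] [AddCommGroup Γ] [LinearOrder Γ] [IsOrderedAddMonoid Γ] where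
  v : K → Γ
  mul : ∀ x y, x ≠ 0 → y ≠ 0 → v (x * y) = v x + v y
  add : ∀ x y, x ≠ 0 → y ≠ 0 → v x < v y → x + y ≠ 0 ∧ v (x + y) = v x

namespace VV
section
variable {K Γ : Type*} [Field K] [AddCommGroup Γ] [LinearOrder Γ] [IsOrderedAddMonoid Γ] (V : VV K Γ)
include V

theorem addne {x y : K} (hx : x ≠ 0) (hy : y ≠ 0) (h : V.v x ≠ V.v y) :
    x + y ≠ 0 ∧ ((V.v (x + y) = V.v x ∧ V.v x < V.v y) ∨ (V.v (x + y) = V.v y ∧ V.v y < V.v x)) := by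
  rcases lt_or_gt_of_ne h with h | h
  · have := V.add x y hx hy h
    exact ⟨this.1, Or.inl ⟨this.2, h⟩⟩
  · have := V.add y x hy hx h
    rw [add_comm x y]
    exact ⟨this.1, Or.inr ⟨this.2, h⟩⟩

theorem nform {α : K} (hα : α ≠ 0) (hneg : V.v α < 0) (χ : Γ →+ ZMod 2) (hχ : χ (V.v α) = 1) (e f : K)
    (h : e ≠ 0 ∨ f ≠ 0) : e ^ 2 + e * f + α * f ^ 2 ≠ 0 ∧
      ∃ g : Γ, V.v (e ^ 2 + e * f + α * f ^ 2) = g + g ∨ V.v (e ^ 2 + e * f + α * f ^ 2) = V.v α + (g + g) := by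
  have sq : ∀ z : K, z ≠ 0 → V.v (z ^ 2) = V.v z + V.v z := fun z hz => by rw [pow_two, V.mul z z hz hz]
  by_cases he : e = 0
  · subst he
    have hf : f ≠ 0 := by simpa using h
    simp only [ne_eq, OfNat.ofNat_ne_zero, not_false_eq_true, zero_pow, zero_mul, add_zero, zero_add]
    refine ⟨mul_ne_zero hα (pow_ne_zero 2 hf), V.v f, Or.inr ?_⟩
    rw [V.mul _ _ hα (pow_ne_zero 2 hf), sq f hf]
  by_cases hf : f = 0
  · subst hf
    simp only [ne_eq, OfNat.ofNat_ne_zero, not_false_eq_true, zero_pow, mul_zero, add_zero]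
    exact ⟨pow_ne_zero 2 he, V.v e, Or.inl (sq e he)⟩
  have he2 := pow_ne_zero 2 he
  have hf2 := mul_ne_zero hα (pow_ne_zero 2 hf)
  have ve := sq e he
  have vf : V.v (α * f ^ 2) = V.v α + (V.v f + V.v f) := by rw [V.mul _ _ hα (pow_ne_zero 2 hf), sq f hf]
  have hne : V.v (e ^ 2) ≠ V.v (α * f ^ 2) := by
    intro h
    have := congrArg χ h
    rw [ve, vf, map_add, map_add, map_add, hχ, CharTwo.add_self_eq_zero, CharTwo.add_self_eq_zero] at this
    exact absurd this (by decide)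
  obtain ⟨h0, h1⟩ := V.addne he2 hf2 hne
  have hlt : V.v (e ^ 2 + α * f ^ 2) < V.v (e * f) := by
    rw [V.mul e f he hf]
    rcases lt_or_ge (V.v e) (V.v f) with h | h
    · have : V.v (e ^ 2 + α * f ^ 2) ≤ V.v e + V.v e := by
        rcases h1 with ⟨h1, -⟩ | ⟨h1, h2⟩
        · rw [h1, ve]
        · rw [h1, ← ve]; exact h2.le
      exact this.trans_lt (by gcongr)
    · have : V.v (e ^ 2 + α * f ^ 2) ≤ V.v α + (V.v f + V.v f) := by
        rcases h1 with ⟨h1, h2⟩ | ⟨h1, h2⟩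
        · rw [h1, ← vf]; exact h2.le
        · rw [h1, vf]
      refine this.trans_lt (lt_of_lt_of_le (b := 0 + (V.v f + V.v f)) (by gcongr) ?_)
      rw [zero_add]; gcongr
  have h3 := V.add _ _ h0 (mul_ne_zero he hf) hlt
  rw [show e ^ 2 + e * f + α * f ^ 2 = e ^ 2 + α * f ^ 2 + e * f by ring]
  refine ⟨h3.1, ?_⟩
  rw [h3.2]
  rcases h1 with ⟨h1, -⟩ | ⟨h1, -⟩
  · exact ⟨V.v e, Or.inl (h1.trans ve)⟩
  · exact ⟨V.v f, Or.inr (h1.trans vf)⟩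

theorem nform_par {α : K} (hα : α ≠ 0) (hneg : V.v α < 0) (χ : Γ →+ ZMod 2) (hχ : χ (V.v α) = 1) (e f : K)
    (h : e ≠ 0 ∨ f ≠ 0) : e ^ 2 + e * f + α * f ^ 2 ≠ 0 ∧
      ∀ χ' : Γ →+ ZMod 2, χ' (V.v α) = 0 → χ' (V.v (e ^ 2 + e * f + α * f ^ 2)) = 0 := by
  obtain ⟨h1, g, h2⟩ := V.nform hα hneg χ hχ e f h
  refine ⟨h1, fun χ' h' => ?_⟩
  rcases h2 with h2 | h2 <;> rw [h2] <;> simp [h', CharTwo.add_self_eq_zero]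

theorem pform {α n : K} (hα : α ≠ 0) (hn : n ≠ 0) (hneg : V.v α < 0) (χ χ' : Γ →+ ZMod 2) (hχ : χ (V.v α) = 1)
    (hχ' : χ' (V.v α) = 0) (hχn : χ' (V.v n) = 1) (e f g h : K)
    (hne : e ≠ 0 ∨ f ≠ 0 ∨ g ≠ 0 ∨ h ≠ 0) :
    (e ^ 2 + e * f + α * f ^ 2) + n * (g ^ 2 + g * h + α * h ^ 2) ≠ 0 ∧
      ∀ ρ : Γ →+ ZMod 2, ρ (V.v α) = 0 → ρ (V.v n) = 0 →
        ρ (V.v ((e ^ 2 + e * f + α * f ^ 2) + n * (g ^ 2 + g * h + α * h ^ 2))) = 0 := by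
  by_cases h1 : e ≠ 0 ∨ f ≠ 0
  · obtain ⟨a1, a2⟩ := V.nform_par hα hneg χ hχ e f h1
    by_cases h2 : g ≠ 0 ∨ h ≠ 0
    · obtain ⟨c1, c2⟩ := V.nform_par hα hneg χ hχ g h h2
      have hm := V.mul n _ hn c1
      obtain ⟨d1, d2⟩ := V.addne a1 (mul_ne_zero hn c1) (by
        intro hh
        have := congrArg χ' hh
        rw [hm, map_add, a2 χ' hχ', c2 χ' hχ', hχn] at this
        exact absurd this (by decide))
      refine ⟨d1, fun ρ r1 r2 => ?_⟩
      rcases d2 with ⟨d2, -⟩ | ⟨d2, -⟩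
      · rw [d2, a2 ρ r1]
      · rw [d2, hm, map_add, c2 ρ r1, r2, add_zero]
    · push Not at h2
      rw [h2.1, h2.2]
      simp only [ne_eq, OfNat.ofNat_ne_zero, not_false_eq_true, zero_pow, mul_zero, add_zero]
      exact ⟨a1, fun ρ r1 _ => a2 ρ r1⟩
  · have h2 : g ≠ 0 ∨ h ≠ 0 := by tauto
    push Not at h1
    obtain ⟨c1, c2⟩ := V.nform_par hα hneg χ hχ g h h2
    rw [h1.1, h1.2]
    simp only [ne_eq, OfNat.ofNat_ne_zero, not_false_eq_true, zero_pow, mul_zero, add_zero, zero_add]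
    refine ⟨mul_ne_zero hn c1, fun ρ r1 r2 => ?_⟩
    rw [V.mul n _ hn c1, map_add, c2 ρ r1, r2, add_zero]

/-- parity predicate -/
def Par (χ : Γ →+ ZMod 2) (c : ZMod 2) (z : K) : Prop := z ≠ 0 → χ (V.v z) = c

theorem par_zero {χ : Γ →+ ZMod 2} {c d : ZMod 2} {z w : K} (hcd : c ≠ d) (hz : V.Par χ c z) (hw : V.Par χ d w)
    (h : z + w = 0) : z = 0 ∧ w = 0 := by
  by_cases h1 : z = 0
  · subst h1; simpa using h
  by_cases h2 : w = 0
  · subst h2; simpa using h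
  exact absurd h (V.addne h1 h2 (fun hh => hcd (by rw [← hz h1, ← hw h2, hh]))).1

theorem par_add {χ χ' : Γ →+ ZMod 2} {c d e : ZMod 2} {z w : K} (hcd : c ≠ d) (hz : V.Par χ c z) (hw : V.Par χ d w)
    (hz' : V.Par χ' e z) (hw' : V.Par χ' e w) : V.Par χ' e (z + w) := by
  by_cases h1 : z = 0
  · subst h1; simpa using hw'
  by_cases h2 : w = 0
  · subst h2; simpa using hz'
  intro _
  obtain ⟨-, ⟨h, -⟩ | ⟨h, -⟩⟩ := V.addne h1 h2 (fun hh => hcd (by rw [← hz h1, ← hw h2, hh]))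
  · rw [h, hz' h1]
  · rw [h, hw' h2]

theorem par4 {χ χ' : Γ →+ ZMod 2} {z0 z1 z2 z3 : K} (a0 : V.Par χ 0 z0) (b0 : V.Par χ' 0 z0)
    (a1 : V.Par χ 1 z1) (b1 : V.Par χ' 0 z1) (a2 : V.Par χ 0 z2) (b2 : V.Par χ' 1 z2)
    (a3 : V.Par χ 1 z3) (b3 : V.Par χ' 1 z3) (h : z0 + z1 + z2 + z3 = 0) : z0 = 0 ∧ z1 = 0 ∧ z2 = 0 ∧ z3 = 0 := by
  have h01 : (0 : ZMod 2) ≠ 1 := by decide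
  obtain ⟨h1, h2⟩ := V.par_zero h01 (V.par_add h01 a0 a1 b0 b1) (V.par_add h01 a2 a3 b2 b3) (by rw [← h]; ring)
  obtain ⟨r0, r1⟩ := V.par_zero h01 a0 a1 h1
  obtain ⟨r2, r3⟩ := V.par_zero h01 a2 a3 h2
  exact ⟨r0, r1, r2, r3⟩
end
end VV

/-- four parameters with independent parities -/
structure Dat (K Γ : Type*) [Field K] [AddCommGroup Γ] [LinearOrder Γ] [IsOrderedAddMonoid Γ] where
  V : VV K Γ
  two : (2 : K) = 0
  t : K
  s : K
  t1 : K
  t2 : K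
  ht : t ≠ 0
  hs : s ≠ 0
  ht1 : t1 ≠ 0
  ht2 : t2 ≠ 0
  v1 : V.v 1 = 0
  tneg : V.v t < 0
  spos : 0 < V.v s
  χt : Γ →+ ZMod 2
  χs : Γ →+ ZMod 2
  χ1 : Γ →+ ZMod 2
  χ2 : Γ →+ ZMod 2
  tt : χt (V.v t) = 1
  st : χs (V.v t) = 0
  ot : χ1 (V.v t) = 0
  wt : χ2 (V.v t) = 0
  ss : χs (V.v s) = 1
  os : χ1 (V.v s) = 0
  ws : χ2 (V.v s) = 0
  oo : χ1 (V.v t1) = 1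
  wo : χ2 (V.v t1) = 0
  ow : χ1 (V.v t2) = 0
  ww : χ2 (V.v t2) = 1


theorem form_b_aux {K : Type*} [CommRing K] {t s r : K} (h2 : (2 : K) = 0) (hs : s * r = 1) (e f g h : K) :
    (e + t * f + t * (g + (t + 1) * h)) ^ 2 + (e + t * f + t * (g + (t + 1) * h)) * f + t * f ^ 2 +
        s * (((t ^ 2 * r + t) * h + t * r * f) ^ 2 + ((t ^ 2 * r + t) * h + t * r * f) * (g + (t + 1) * h) +
            t * (g + (t + 1) * h) ^ 2) =
      e ^ 2 + e * f + (t ^ 2 + t ^ 2 * r) * f ^ 2 + (t ^ 2 + t * s) * (g ^ 2 + g * h + (t ^ 2 + t ^ 2 * r) * h ^ 2) := by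
  grind

namespace Dat
section
variable {K Γ : Type*} [Field K] [AddCommGroup Γ] [LinearOrder Γ] [IsOrderedAddMonoid Γ] (D : Dat K Γ)
include D

def a : K := D.t ^ 2 + D.t * D.s
def b : K := D.t ^ 2 + D.t ^ 2 * D.s⁻¹
def n : K := D.t * D.s⁻¹ * (D.s + 1) * (D.t + D.s)

theorem v_sinv : D.V.v D.s⁻¹ = - D.V.v D.s := by
  have := D.V.mul D.s D.s⁻¹ D.hs (inv_ne_zero D.hs)
  rw [mul_inv_cancel₀ D.hs, D.v1] at this
  exact (neg_eq_of_add_eq_zero_right this.symm).symm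

theorem v_t2 : D.V.v (D.t ^ 2) = D.V.v D.t + D.V.v D.t := by rw [pow_two, D.V.mul _ _ D.ht D.ht]

theorem v_t2s : D.V.v (D.t ^ 2 * D.s⁻¹) = D.V.v D.t + D.V.v D.t - D.V.v D.s := by
  rw [D.V.mul _ _ (pow_ne_zero 2 D.ht) (inv_ne_zero D.hs), v_t2, v_sinv, sub_eq_add_neg]

theorem t2s_ne : D.t ^ 2 * D.s⁻¹ ≠ 0 := mul_ne_zero (pow_ne_zero 2 D.ht) (inv_ne_zero D.hs)

theorem v_s1 : 1 + D.s ≠ 0 ∧ D.V.v (1 + D.s) = 0 := by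
  have := D.V.add 1 D.s one_ne_zero D.hs (by rw [D.v1]; exact D.spos)
  exact ⟨this.1, this.2.trans D.v1⟩

theorem v_α : D.t * (1 + D.s) ≠ 0 ∧ D.V.v (D.t * (1 + D.s)) = D.V.v D.t :=
  ⟨mul_ne_zero D.ht D.v_s1.1, by rw [D.V.mul _ _ D.ht D.v_s1.1, D.v_s1.2, add_zero]⟩

theorem v_b : D.b ≠ 0 ∧ D.V.v D.b = D.V.v D.t + D.V.v D.t - D.V.v D.s := by
  have := D.V.add _ _ D.t2s_ne (pow_ne_zero 2 D.ht) (by rw [v_t2s, v_t2]; exact sub_lt_self _ D.spos)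
  rw [add_comm] at this
  exact ⟨this.1, this.2.trans D.v_t2s⟩

theorem neg2 : D.V.v D.t + D.V.v D.t - D.V.v D.s < D.V.v D.t := by
  rw [add_sub_assoc]
  exact add_lt_of_neg_right _ (sub_neg.mpr (D.tneg.trans D.spos))

theorem v_b' : D.t ^ 2 * D.s⁻¹ + D.t ≠ 0 ∧ D.V.v (D.t ^ 2 * D.s⁻¹ + D.t) = D.V.v D.t + D.V.v D.t - D.V.v D.s := by
  have := D.V.add _ _ D.t2s_ne D.ht (by rw [v_t2s]; exact D.neg2)
  exact ⟨this.1, this.2.trans D.v_t2s⟩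

theorem v_ab : D.t ^ 2 * D.s⁻¹ + D.t * D.s ≠ 0 ∧ D.V.v (D.t ^ 2 * D.s⁻¹ + D.t * D.s) = D.V.v D.t + D.V.v D.t - D.V.v D.s := by
  have := D.V.add _ _ D.t2s_ne (mul_ne_zero D.ht D.hs) (by
    rw [v_t2s, D.V.mul _ _ D.ht D.hs]; exact D.neg2.trans (lt_add_of_pos_right _ D.spos))
  exact ⟨this.1, this.2.trans D.v_t2s⟩

theorem v_n : D.n ≠ 0 ∧ D.V.v D.n = D.V.v D.t + D.V.v D.t - D.V.v D.s := by
  have h1 := D.V.add D.t D.s D.ht D.hs (D.tneg.trans D.spos)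
  have h2 := D.v_s1
  rw [add_comm] at h2
  have h3 := mul_ne_zero D.ht (inv_ne_zero D.hs)
  refine ⟨mul_ne_zero (mul_ne_zero h3 h2.1) h1.1, ?_⟩
  rw [n, D.V.mul _ _ (mul_ne_zero h3 h2.1) h1.1, D.V.mul _ _ h3 h2.1, D.V.mul _ _ D.ht (inv_ne_zero D.hs), h1.2, h2.2, v_sinv]
  abel

theorem χs2 : D.χs (D.V.v D.t + D.V.v D.t - D.V.v D.s) = 1 := by
  rw [map_sub, map_add, D.st, D.ss]; decide

theorem neg3 : D.V.v D.t + D.V.v D.t - D.V.v D.s < 0 := D.neg2.trans D.tneg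

theorem ρ2 (ρ : Γ →+ ZMod 2) (h1 : ρ (D.V.v D.t) = 0) (h2 : ρ (D.V.v D.s) = 0) : ρ (D.V.v D.t + D.V.v D.t - D.V.v D.s) = 0 := by
  rw [map_sub, map_add, h1, h2]; decide

theorem na (e f : K) : e ^ 2 + e * f + D.a * f ^ 2 = (e + D.t * f) ^ 2 + (e + D.t * f) * f + D.t * (1 + D.s) * f ^ 2 := by
  have := D.two
  rw [a]
  linear_combination (- D.t * f * e - D.t * f ^ 2) * this

theorem nb (e f : K) : e ^ 2 + e * f + D.b * f ^ 2 = (e + D.t * f) ^ 2 + (e + D.t * f) * f + (D.t ^ 2 * D.s⁻¹ + D.t) * f ^ 2 := by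
  have := D.two
  rw [b]
  linear_combination (- D.t * f * e - D.t * f ^ 2) * this

theorem as_a (r : K) : r ^ 2 + r ≠ D.a := by
  intro h
  have h1 := (D.V.nform D.v_α.1 (by rw [D.v_α.2]; exact D.tneg) D.χt (by rw [D.v_α.2]; exact D.tt) (r + D.t * 1) 1 (by simp)).1
  rw [← D.na] at h1
  apply h1
  linear_combination h + D.a * D.two

theorem as_b (r : K) : r ^ 2 + r ≠ D.b := by
  intro h
  have h1 := (D.V.nform D.v_b'.1 (by rw [D.v_b'.2]; exact D.neg3) D.χs (by rw [D.v_b'.2]; exact D.χs2) (r + D.t * 1) 1 (by simp)).1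
  rw [← D.nb] at h1
  apply h1
  linear_combination h + D.b * D.two

theorem as_ab (r : K) : r ^ 2 + r ≠ D.a + D.b := by
  intro h
  have h1 := (D.V.nform D.v_ab.1 (by rw [D.v_ab.2]; exact D.neg3) D.χs (by rw [D.v_ab.2]; exact D.χs2) r 1 (by simp)).1
  apply h1
  rw [a, b] at h
  linear_combination h + (D.t ^ 2 + D.t ^ 2 * D.s⁻¹ + D.t * D.s) * D.two

theorem form_a {m : K} (hm : m ≠ 0) (hv : D.V.v m = D.V.v D.t + D.V.v D.t - D.V.v D.s) (e f g h : K)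
    (hne : e ≠ 0 ∨ f ≠ 0 ∨ g ≠ 0 ∨ h ≠ 0) :
    (e ^ 2 + e * f + D.a * f ^ 2) + m * (g ^ 2 + g * h + D.a * h ^ 2) ≠ 0 ∧
      ∀ ρ : Γ →+ ZMod 2, ρ (D.V.v D.t) = 0 → ρ (D.V.v D.s) = 0 →
        ρ (D.V.v ((e ^ 2 + e * f + D.a * f ^ 2) + m * (g ^ 2 + g * h + D.a * h ^ 2))) = 0 := by
  have := D.V.pform D.v_α.1 hm (by rw [D.v_α.2]; exact D.tneg) D.χt D.χs (by rw [D.v_α.2]; exact D.tt)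
    (by rw [D.v_α.2]; exact D.st) (by rw [hv]; exact D.χs2) (e + D.t * f) f (g + D.t * h) h (by
      by_contra hc
      push Not at hc
      obtain ⟨c1, c2, c3, c4⟩ := hc
      rw [c2, mul_zero, add_zero] at c1
      rw [c4, mul_zero, add_zero] at c3
      tauto)
  rw [← D.na, ← D.na, D.v_α.2, hv] at this
  exact ⟨this.1, fun ρ r1 r2 => this.2 ρ r1 (D.ρ2 ρ r1 r2)⟩

theorem form_b (e f g h : K) (hne : e ≠ 0 ∨ f ≠ 0 ∨ g ≠ 0 ∨ h ≠ 0) :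
    (e ^ 2 + e * f + D.b * f ^ 2) + D.a * (g ^ 2 + g * h + D.b * h ^ 2) ≠ 0 ∧
      ∀ ρ : Γ →+ ZMod 2, ρ (D.V.v D.t) = 0 → ρ (D.V.v D.s) = 0 →
        ρ (D.V.v ((e ^ 2 + e * f + D.b * f ^ 2) + D.a * (g ^ 2 + g * h + D.b * h ^ 2))) = 0 := by
  obtain ⟨l, hl⟩ : ∃ l, l = g + (D.t + 1) * h := ⟨_, rfl⟩
  obtain ⟨β, hβ⟩ : ∃ β, β = D.t ^ 2 * D.s⁻¹ + D.t := ⟨_, rfl⟩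
  have hβ0 : β ≠ 0 := hβ ▸ D.v_b'.1
  have := D.V.pform D.ht D.hs D.tneg D.χt D.χs D.tt D.st D.ss (e + D.t * f + D.t * l) f
    (β * h + D.t * D.s⁻¹ * f) l (by
      by_contra hc
      push Not at hc
      obtain ⟨c1, c2, c3, c4⟩ := hc
      rw [c2, mul_zero, add_zero] at c3
      have c5 : h = 0 := by simpa [hβ0] using c3
      rw [c2, c4, mul_zero, add_zero, add_zero] at c1
      rw [c5, mul_zero, add_zero, c4] at hl
      have := hl.symm
      tauto)
  have key : (e + D.t * f + D.t * l) ^ 2 + (e + D.t * f + D.t * l) * f + D.t * f ^ 2 + D.s * ((β * h + D.t * D.s⁻¹ * f) ^ 2 + (β * h + D.t * D.s⁻¹ * f) * l + D.t * l ^ 2)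
     = (e ^ 2 + e * f + D.b * f ^ 2) + D.a * (g ^ 2 + g * h + D.b * h ^ 2) := by
    rw [a, b, hl, hβ]
    exact form_b_aux D.two (mul_inv_cancel₀ D.hs) e f g h
  rw [key] at this
  exact this
end
end Dat


theorem q1_aux {L : Type*} [CommRing L] (h2 : (2 : L) = 0) {x y a b t1 : L} (hx : x ^ 2 + x = a) (hy : y ^ 2 + y = b) (p0 p1 p2 p3 : L) :
    t1 * y * (p0 + p1 * x + p2 * y + p3 * (x * y)) * (p0 + p1 * (x + 1) + p2 * y + p3 * ((x + 1) * y)) +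
    t1 * (y + 1) * (p0 + p1 * x + p2 * (y + 1) + p3 * (x * (y + 1))) * (p0 + p1 * (x + 1) + p2 * (y + 1) + p3 * ((x + 1) * (y + 1))) =
    t1 * (((p0 + p2) ^ 2 + (p0 + p2) * (p1 + p3) + a * (p1 + p3) ^ 2) + b * (p2 ^ 2 + p2 * p3 + a * p3 ^ 2)) := by
  subst hx hy
  grind

theorem q3_aux {L : Type*} [CommRing L] (h2 : (2 : L) = 0) {x y a b t w n : L} (hx : x ^ 2 + x = a) (hy : y ^ 2 + y = b)
    (hn : n = a + b + t ^ 2 + t) (p0 p1 p2 p3 : L) :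
    w * (x + y + t) * (p0 + p1 * x + p2 * y + p3 * (x * y)) * (p0 + p1 * (x + 1) + p2 * (y + 1) + p3 * ((x + 1) * (y + 1))) +
    w * (x + 1 + y + t) * (p0 + p1 * (x + 1) + p2 * y + p3 * ((x + 1) * y)) * (p0 + p1 * x + p2 * (y + 1) + p3 * (x * (y + 1))) =
    w * (((p0 + t * p2 + a * p3 + p2) ^ 2 + (p0 + t * p2 + a * p3 + p2) * (p1 + p2 + t * p3) + a * (p1 + p2 + t * p3) ^ 2)
      + n * (p2 ^ 2 + p2 * p3 + a * p3 ^ 2)) := by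
  subst hn hx hy
  grind

namespace Dat
section
variable {K Γ : Type*} [Field K] [AddCommGroup Γ] [LinearOrder Γ] [IsOrderedAddMonoid Γ] (D : Dat K Γ)

theorem n_eq : D.n = D.a + D.b + D.t ^ 2 + D.t := by
  have h2 := D.two
  have hs := mul_inv_cancel₀ D.hs
  rw [n, a, b]
  linear_combination (D.t ^ 2 + D.t * D.s + D.t) * hs - (D.t ^ 2) * h2

theorem par_mul {z w : K} {χ : Γ →+ ZMod 2} {c : ZMod 2} (hz : z ≠ 0) (h : χ (D.V.v z) = c) (hw : D.V.Par χ 0 w) :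
    D.V.Par χ c (z * w) := by
  intro h0
  have hw0 : w ≠ 0 := right_ne_zero_of_mul h0
  rw [D.V.mul _ _ hz hw0, map_add, h, hw hw0, add_zero]

def F (_ : Dat K Γ) (a m e f g h : K) : K := (e ^ 2 + e * f + a * f ^ 2) + m * (g ^ 2 + g * h + a * h ^ 2)

theorem form_aux {a m e f g h : K} (H : (e ≠ 0 ∨ f ≠ 0 ∨ g ≠ 0 ∨ h ≠ 0) → D.F a m e f g h ≠ 0 ∧
      ∀ ρ : Γ →+ ZMod 2, ρ (D.V.v D.t) = 0 → ρ (D.V.v D.s) = 0 → ρ (D.V.v (D.F a m e f g h)) = 0) :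
    (D.F a m e f g h = 0 → e = 0 ∧ f = 0 ∧ g = 0 ∧ h = 0) ∧
      ∀ ρ : Γ →+ ZMod 2, ρ (D.V.v D.t) = 0 → ρ (D.V.v D.s) = 0 → D.V.Par ρ 0 (D.F a m e f g h) := by
  constructor
  · intro h0
    by_contra hc
    exact (H (by tauto)).1 h0
  · intro ρ r1 r2 hF
    refine (H ?_).2 ρ r1 r2
    by_contra hc
    push Not at hc
    obtain ⟨rfl, rfl, rfl, rfl⟩ := hc
    exact hF (by rw [F]; ring)

theorem form_a' {m : K} (hm : m ≠ 0) (hv : D.V.v m = D.V.v D.t + D.V.v D.t - D.V.v D.s) (e f g h : K) :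
    (D.F D.a m e f g h = 0 → e = 0 ∧ f = 0 ∧ g = 0 ∧ h = 0) ∧
      ∀ ρ : Γ →+ ZMod 2, ρ (D.V.v D.t) = 0 → ρ (D.V.v D.s) = 0 → D.V.Par ρ 0 (D.F D.a m e f g h) :=
  D.form_aux (D.form_a hm hv e f g h)

theorem form_b' (e f g h : K) :
    (D.F D.b D.a e f g h = 0 → e = 0 ∧ f = 0 ∧ g = 0 ∧ h = 0) ∧
      ∀ ρ : Γ →+ ZMod 2, ρ (D.V.v D.t) = 0 → ρ (D.V.v D.s) = 0 → D.V.Par ρ 0 (D.F D.b D.a e f g h) :=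
  D.form_aux (D.form_b e f g h)

theorem hani {L : Type*} [Field L] [Algebra K L] (S : Biq K L) (hx : S.x ^ 2 + S.x = algebraMap K L D.a)
    (hy : S.y ^ 2 + S.y = algebraMap K L D.b) (k : K) (l₁ l₂ l₃ : L)
    (h : algebraMap K L k ^ 2 + q1 S (algebraMap K L D.t1 * S.y) l₁ + q2 S (algebraMap K L D.t2 * S.x) l₂ +
      q3 S (algebraMap K L (D.t1 * D.t2 * D.t) * (S.x + S.y + algebraMap K L D.t)) l₃ = 0) :
      k = 0 ∧ l₁ = 0 ∧ l₂ = 0 ∧ l₃ = 0 := by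
  obtain ⟨p, rfl⟩ := S.exists_rep l₁
  obtain ⟨q, rfl⟩ := S.exists_rep l₂
  obtain ⟨r, rfl⟩ := S.exists_rep l₃
  have e1 := q1_aux S.two (t1 := algebraMap K L D.t1) hx hy (algebraMap K L (p 0)) (algebraMap K L (p 1)) (algebraMap K L (p 2)) (algebraMap K L (p 3))
  have e2 := q1_aux S.two (t1 := algebraMap K L D.t2) hy hx (algebraMap K L (q 0)) (algebraMap K L (q 2)) (algebraMap K L (q 1)) (algebraMap K L (q 3))
  have e3 := q3_aux S.two (w := algebraMap K L (D.t1 * D.t2 * D.t)) (t := algebraMap K L D.t) (n := algebraMap K L D.n) hx hy (by rw [D.n_eq]; simp) (algebraMap K L (r 0)) (algebraMap K L (r 1)) (algebraMap K L (r 2)) (algebraMap K L (r 3))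
  have h1 : q1 S (algebraMap K L D.t1 * S.y) (algebraMap K L (p 0) + algebraMap K L (p 1) * S.x + algebraMap K L (p 2) * S.y + algebraMap K L (p 3) * (S.x * S.y)) =
      algebraMap K L (D.t1 * D.F D.a D.b (p 0 + p 2) (p 1 + p 3) (p 2) (p 3)) := by
    simp only [F, q1, map_add, map_mul, map_pow, map_one, AlgHom.commutes, S.σx, S.σy, S.τx, S.τy]
    exact e1
  have h2 : q2 S (algebraMap K L D.t2 * S.x) (algebraMap K L (q 0) + algebraMap K L (q 1) * S.x + algebraMap K L (q 2) * S.y + algebraMap K L (q 3) * (S.x * S.y)) =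
      algebraMap K L (D.t2 * D.F D.b D.a (q 0 + q 1) (q 2 + q 3) (q 1) (q 3)) := by
    simp only [F, q2, map_add, map_mul, map_pow, map_one, AlgHom.commutes, S.σx, S.σy, S.τx, S.τy]
    rw [← e2]; ring
  have h3 : q3 S (algebraMap K L (D.t1 * D.t2 * D.t) * (S.x + S.y + algebraMap K L D.t)) (algebraMap K L (r 0) + algebraMap K L (r 1) * S.x + algebraMap K L (r 2) * S.y + algebraMap K L (r 3) * (S.x * S.y)) =
      algebraMap K L (D.t1 * D.t2 * D.t * D.F D.a D.n (r 0 + D.t * r 2 + D.a * r 3 + r 2) (r 1 + r 2 + D.t * r 3) (r 2) (r 3)) := by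
    simp only [map_mul (algebraMap K L)] at e3
    simp only [F, q3, map_add, map_mul, map_pow, map_one, AlgHom.commutes, S.σx, S.σy, S.τx, S.τy]
    rw [show S.x + 1 + 1 = S.x by rw [add_assoc, S.add_self, add_zero]]
    exact e3
  have E1 := D.form_a' D.v_b.1 D.v_b.2 (p 0 + p 2) (p 1 + p 3) (p 2) (p 3)
  have E2 := D.form_b' (q 0 + q 1) (q 2 + q 3) (q 1) (q 3)
  have E3 := D.form_a' D.v_n.1 D.v_n.2 (r 0 + D.t * r 2 + D.a * r 3 + r 2) (r 1 + r 2 + D.t * r 3) (r 2) (r 3)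
  rw [h1, h2, h3, ← map_pow, ← map_add, ← map_add, ← map_add, map_eq_zero] at h
  have hT : D.t1 * D.t2 * D.t ≠ 0 := mul_ne_zero (mul_ne_zero D.ht1 D.ht2) D.ht
  have hk : ∀ ρ : Γ →+ ZMod 2, D.V.Par ρ 0 (k ^ 2) := by
    intro ρ hk
    have hk : k ≠ 0 := fun h => hk (by rw [h]; ring)
    rw [pow_two, D.V.mul _ _ hk hk, map_add, CharTwo.add_self_eq_zero]
  have T : ∀ ρ : Γ →+ ZMod 2, ρ (D.V.v D.t) = 0 → ρ (D.V.v (D.t1 * D.t2 * D.t)) = ρ (D.V.v D.t1) + ρ (D.V.v D.t2) := by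
    intro ρ h
    rw [D.V.mul _ _ (mul_ne_zero D.ht1 D.ht2) D.ht, D.V.mul _ _ D.ht1 D.ht2, map_add, map_add, h, add_zero]
  obtain ⟨z0, z1, z2, z3⟩ := D.V.par4 (hk D.χ1) (hk D.χ2)
    (D.par_mul D.ht1 D.oo (E1.2 D.χ1 D.ot D.os)) (D.par_mul D.ht1 D.wo (E1.2 D.χ2 D.wt D.ws))
    (D.par_mul D.ht2 D.ow (E2.2 D.χ1 D.ot D.os)) (D.par_mul D.ht2 D.ww (E2.2 D.χ2 D.wt D.ws))
    (D.par_mul hT (by rw [T _ D.ot, D.oo, D.ow, add_zero]) (E3.2 D.χ1 D.ot D.os))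
    (D.par_mul hT (by rw [T _ D.wt, D.wo, D.ww, zero_add]) (E3.2 D.χ2 D.wt D.ws)) h
  obtain ⟨a1, a2, a3, a4⟩ := E1.1 ((mul_eq_zero.mp z1).resolve_left D.ht1)
  obtain ⟨b1, b2, b3, b4⟩ := E2.1 ((mul_eq_zero.mp z2).resolve_left D.ht2)
  obtain ⟨c1, c2, c3, c4⟩ := E3.1 ((mul_eq_zero.mp z3).resolve_left hT)
  rw [a3, add_zero] at a1
  rw [a4, add_zero] at a2
  rw [b3, add_zero] at b1
  rw [b4, add_zero] at b2
  simp only [c3, c4, mul_zero, add_zero] at c1 c2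
  refine ⟨pow_eq_zero_iff two_ne_zero |>.mp z0, ?_, ?_, ?_⟩
  · simp [a1, a2, a3, a4]
  · simp [b1, b2, b3, b4]
  · simp [c1, c2, c3, c4]
end
end Dat

theorem lower_dat {F Ω K L : Type u} {Γ : Type*} [Field F] [Field Ω] [IsAlgClosed Ω] [Field K] [Algebra F Ω]
    [Algebra Ω K] [Algebra F K] [IsScalarTower F Ω K] [Field L] [Algebra K L]
    [AddCommGroup Γ] [LinearOrder Γ] [IsOrderedAddMonoid Γ] (D : Dat K Γ)
    (S : Biq K L) (hx : S.x ^ 2 + S.x = algebraMap K L D.a)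
    (hy : S.y ^ 2 + S.y = algebraMap K L D.b) (m : ℕ) (hm : csaDegFourEdLE F m) : 4 ≤ m := by
  have h2 := S.two
  have ha : algebraMap K L D.a ≠ 0 := by
    rw [ne_eq, map_eq_zero]; intro h; exact D.as_a 0 (by rw [h]; ring)
  have hb : algebraMap K L D.b ≠ 0 := by
    rw [ne_eq, map_eq_zero]; exact D.v_b.1
  have x0 : S.x ≠ 0 := by intro h; apply ha; rw [← hx, h]; ring
  have y0 : S.y ≠ 0 := by intro h; apply hb; rw [← hy, h]; ring
  have x1 : S.x + 1 ≠ 0 := by intro h; apply ha; rw [← hx]; linear_combination S.x * h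
  have y1 : S.y + 1 ≠ 0 := by intro h; apply hb; rw [← hy]; linear_combination S.y * h
  have t0 : algebraMap K L D.t ≠ 0 := by rw [ne_eq, map_eq_zero]; exact D.ht
  have u1 : algebraMap K L D.t1 ≠ 0 := by rw [ne_eq, map_eq_zero]; exact D.ht1
  have u2 : algebraMap K L D.t2 ≠ 0 := by rw [ne_eq, map_eq_zero]; exact D.ht2
  have xx : S.x + 1 + 1 = S.x := by rw [add_assoc, S.add_self, add_zero]
  have key : algebraMap K L D.t ^ 2 * ((S.x + S.y + algebraMap K L D.t) * (S.x + S.y + algebraMap K L D.t + 1)) = (S.x * (S.x + 1)) * (S.y * (S.y + 1)) := by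
    have e1 : (S.x + S.y + algebraMap K L D.t) * (S.x + S.y + algebraMap K L D.t + 1) = algebraMap K L D.n := by
      rw [D.n_eq]
      simp only [map_add, map_pow, ← hx, ← hy]
      linear_combination (S.x * S.y + S.x * algebraMap K L D.t + S.y * algebraMap K L D.t) * h2
    have e2 : D.t ^ 2 * D.n = D.a * D.b := by
      have hs := mul_inv_cancel₀ D.hs
      rw [Dat.n, Dat.a, Dat.b]
      linear_combination (D.t ^ 3 * (D.t + D.s)) * hs
    rw [e1, ← map_pow, ← map_mul, e2, map_mul, ← hx, ← hy]; ring
  have sc : S.σ (algebraMap K L D.t * (S.x + S.y + algebraMap K L D.t + 1) / (S.y * (S.x + 1))) = algebraMap K L D.t * (S.x + S.y + algebraMap K L D.t) / (S.y * S.x) := by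
    simp only [map_div₀, map_mul, map_add, map_one, AlgHom.commutes, S.σx, S.σy, xx]
    congr 2
    linear_combination h2
  have tc : S.τ (algebraMap K L D.t * (S.x + S.y + algebraMap K L D.t + 1) / (S.y * (S.x + 1))) = algebraMap K L D.t * (S.x + S.y + algebraMap K L D.t) / ((S.y + 1) * (S.x + 1)) := by
    simp only [map_div₀, map_mul, map_add, map_one, AlgHom.commutes, S.τx, S.τy]
    congr 2
    linear_combination h2
  refine lower_core (Ω := Ω) S (algebraMap K L D.t1 * S.y) (algebraMap K L D.t2 * S.x)
    (algebraMap K L D.t * (S.x + S.y + algebraMap K L D.t + 1) / (S.y * (S.x + 1)))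
    (mul_ne_zero u1 y0) (mul_ne_zero u2 x0) (by simp [S.σy]) (by simp [S.τx]) ?_ ?_ ?_ m hm
  · rw [sc, map_mul, AlgHom.commutes, S.τy]
    field_simp
    linear_combination key
  · rw [tc, map_mul, AlgHom.commutes, S.σx]
    field_simp
    linear_combination key
  · intro k l₁ l₂ l₃ h
    refine D.hani S hx hy k l₁ l₂ l₃ ?_
    rw [← h, sc]
    congr 2
    simp only [map_mul]
    field_simp


/-- conjugation -/
def qconj {k R : Type*} [CommRing k] [CommRing R] [Algebra k R] (a : R) (h2 : (2 : R) = 0) :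
    QuadraticAlgebra R a 1 →ₐ[k] QuadraticAlgebra R a 1 where
  toFun z := ⟨z.re + z.im, z.im⟩
  map_one' := QuadraticAlgebra.ext (add_zero (1 : R)) rfl
  map_zero' := by ext <;> simp
  map_mul' z w := by
    ext <;> simp
    · ring
    · linear_combination (-(z.im * w.im)) * h2
  map_add' z w := by
    ext <;> simp
    ring
  commutes' r := QuadraticAlgebra.ext (add_zero (algebraMap k R r)) rfl

/-- extension of a conjugation -/
def qmap {k R : Type*} [CommRing k] [CommRing R] [Algebra k R] (a : R) (f : R →ₐ[k] R) (hf : f a = a) :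
    QuadraticAlgebra R a 1 →ₐ[k] QuadraticAlgebra R a 1 where
  toFun z := ⟨f z.re, f z.im⟩
  map_one' := QuadraticAlgebra.ext (map_one f) (map_zero f)
  map_zero' := by ext <;> simp
  map_mul' z w := by ext <;> simp [hf]
  map_add' z w := by ext <;> simp
  commutes' r := QuadraticAlgebra.ext (f.commutes r) (map_zero f)

theorem q_two {R : Type*} [CommRing R] (a : R) (h2 : (2 : R) = 0) : (2 : QuadraticAlgebra R a 1) = 0 := by
  have := congrArg (algebraMap R (QuadraticAlgebra R a 1)) h2
  rwa [map_ofNat, map_zero] at this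

theorem q_fact {K : Type*} [Field K] (h2 : (2 : K) = 0) (a b : K) (hb : ∀ r : K, r ^ 2 + r ≠ b) (hab : ∀ r : K, r ^ 2 + r ≠ a + b)
    (r : QuadraticAlgebra K a 1) (h : r ^ 2 = algebraMap K (QuadraticAlgebra K a 1) b + 1 * r) : False := by
  rw [pow_two, one_mul] at h
  have e1 := congrArg QuadraticAlgebra.re h
  have e2 := congrArg QuadraticAlgebra.im h
  simp only [QuadraticAlgebra.re_mul, QuadraticAlgebra.im_mul, QuadraticAlgebra.re_add, QuadraticAlgebra.im_add, QuadraticAlgebra.algebraMap_re, QuadraticAlgebra.algebraMap_im] at e1 e2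
  have e3 : r.im * (r.im - 1) = 0 := by linear_combination e2 - r.re * r.im * h2
  rcases mul_eq_zero.mp e3 with e | e
  · rw [e] at e1
    exact hb r.re (by linear_combination e1 + r.re * h2)
  · have e : r.im = 1 := by linear_combination e
    rw [e] at e1
    exact hab r.re (by linear_combination e1 + (r.re - a) * h2)

theorem exists_biq {K : Type u} [Field K] (h2 : (2 : K) = 0) (a b : K) (ha : ∀ r : K, r ^ 2 + r ≠ a)
    (hb : ∀ r : K, r ^ 2 + r ≠ b) (hab : ∀ r : K, r ^ 2 + r ≠ a + b) :
    ∃ (L : Type u) (_ : Field L) (_ : Algebra K L) (S : Biq K L), S.x ^ 2 + S.x = algebraMap K L a ∧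
      S.y ^ 2 + S.y = algebraMap K L b := by
  have f1 : Fact (∀ r : K, r ^ 2 ≠ a + 1 * r) := ⟨fun r h => ha r (by linear_combination h + r * h2)⟩
  have h2M := q_two a h2
  have f2 : Fact (∀ r : QuadraticAlgebra K a 1, r ^ 2 ≠ algebraMap K (QuadraticAlgebra K a 1) b + 1 * r) := ⟨fun r h => q_fact h2 a b hb hab r h⟩
  have h2L := q_two (algebraMap K (QuadraticAlgebra K a 1) b) h2M
  refine ⟨QuadraticAlgebra (QuadraticAlgebra K a 1) (algebraMap K (QuadraticAlgebra K a 1) b) 1, inferInstance, inferInstance, 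
   { two := h2L
     x := ⟨⟨0, 1⟩, 0⟩
     y := ⟨0, 1⟩
     σ := qmap (algebraMap K (QuadraticAlgebra K a 1) b) (qconj a h2) (AlgHom.commutes _ _)
     τ := qconj _ h2M
     σx := ?_
     σy := ?_
     τx := ?_
     τy := ?_
     σσ := ?_
     ττ := ?_
     στ := ?_
     fix := ?_ }, ?_, ?_⟩
  · simp only [qmap, qconj, AlgHom.coe_mk, RingHom.coe_mk, MonoidHom.coe_mk, OneHom.coe_mk, map_zero]
    refine QuadraticAlgebra.ext (QuadraticAlgebra.ext ?_ ?_) (QuadraticAlgebra.ext ?_ ?_)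
    · exact (zero_add 1).trans (zero_add 1).symm
    · exact (add_zero 1).symm
    · show (0 : K) + 0 = 0 + 0
      rfl
    · exact (add_zero (0 : K)).symm
  · simp only [qmap, AlgHom.coe_mk, RingHom.coe_mk, MonoidHom.coe_mk, OneHom.coe_mk, map_zero, map_one]
  · simp only [qconj, AlgHom.coe_mk, RingHom.coe_mk, MonoidHom.coe_mk, OneHom.coe_mk, map_zero, map_one, add_zero]
  · simp only [qconj, AlgHom.coe_mk, RingHom.coe_mk, MonoidHom.coe_mk, OneHom.coe_mk, map_zero, map_one, add_zero]
    exact QuadraticAlgebra.ext rfl (add_zero 1).symm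
  · intro l
    have tw : ∀ p q : K, p + q + q = p := fun p q => by linear_combination q * h2
    simp only [qmap, qconj, AlgHom.coe_mk, RingHom.coe_mk, MonoidHom.coe_mk, OneHom.coe_mk, tw]
  · intro l
    have tw : ∀ p q : QuadraticAlgebra K a 1, p + q + q = p := fun p q => by linear_combination q * h2M
    simp only [qmap, qconj, AlgHom.coe_mk, RingHom.coe_mk, MonoidHom.coe_mk, OneHom.coe_mk, tw]
  · intro l
    simp only [qmap, qconj, AlgHom.coe_mk, RingHom.coe_mk, MonoidHom.coe_mk, OneHom.coe_mk]
    refine QuadraticAlgebra.ext (QuadraticAlgebra.ext ?_ rfl) rfl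
    simp; ring
  · intro l hs ht
    simp only [qmap, qconj, AlgHom.coe_mk, RingHom.coe_mk, MonoidHom.coe_mk, OneHom.coe_mk] at hs ht
    have e1 := congrArg QuadraticAlgebra.re ht
    simp only [add_eq_left] at e1
    have e2 := congrArg (fun z => z.re.re) hs
    simp only [add_eq_left] at e2
    refine ⟨l.re.re, QuadraticAlgebra.ext (QuadraticAlgebra.ext rfl ?_) ?_⟩
    · exact e2.symm
    · exact e1.symm
  · rw [pow_two]
    refine QuadraticAlgebra.ext (QuadraticAlgebra.ext ?_ ?_) (QuadraticAlgebra.ext ?_ ?_)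
    · simp; rfl
    · simp [← two_mul, h2]; rfl
    · simp; rfl
    · simp; rfl
  · rw [pow_two]
    refine QuadraticAlgebra.ext ?_ ?_
    · simp; rfl
    · simp [← two_mul, h2M]; rfl

/-- order as a valuation -/
def hahnVV {Γ Ω : Type*} [Field Ω] [AddCommGroup Γ] [LinearOrder Γ] [IsOrderedAddMonoid Γ] : VV (HahnSeries Γ Ω) Γ where
  v := HahnSeries.order
  mul x y hx hy := HahnSeries.order_mul hx hy
  add x y hx hy h := by
    have h' : x.orderTop < y.orderTop := by
      rw [HahnSeries.orderTop_of_ne_zero hx, HahnSeries.orderTop_of_ne_zero hy]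
      rw [HahnSeries.order_of_ne hx, HahnSeries.order_of_ne hy] at h
      exact_mod_cast h
    have h1 := HahnSeries.orderTop_add_eq_left h'
    have h0 : x + y ≠ 0 := by
      intro h0
      rw [h0, HahnSeries.orderTop_zero] at h1
      exact absurd h1.symm (HahnSeries.orderTop_ne_top.mpr hx)
    refine ⟨h0, ?_⟩
    have := HahnSeries.order_eq_orderTop_of_ne_zero h0
    rw [h1, ← HahnSeries.order_eq_orderTop_of_ne_zero hx] at this
    exact_mod_cast this

/-- parity of a coordinate -/
def parHom (i : Fin 4) : Lex (Fin 4 → ℤ) →+ ZMod 2 where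
  toFun g := ((ofLex g i : ℤ) : ZMod 2)
  map_zero' := Int.cast_zero
  map_add' g h := Int.cast_add _ _

/-- basis vector -/
def gvec (i : Fin 4) (n : ℤ) : Lex (Fin 4 → ℤ) := toLex (Pi.single i n)

theorem parHom_gvec (i j : Fin 4) (n : ℤ) : parHom i (gvec j n) = if i = j then (n : ZMod 2) else 0 := by
  simp [parHom, gvec, Pi.single_apply]

def hahnDat (Ω : Type*) [Field Ω] (h2 : (2 : Ω) = 0) : Dat (HahnSeries (Lex (Fin 4 → ℤ)) Ω) (Lex (Fin 4 → ℤ)) where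
  V := hahnVV
  two := by
    have := congrArg (HahnSeries.C (Γ := Lex (Fin 4 → ℤ))) h2
    rwa [map_ofNat, map_zero] at this
  t := HahnSeries.single (gvec 0 (-1)) 1
  s := HahnSeries.single (gvec 1 1) 1
  t1 := HahnSeries.single (gvec 2 1) 1
  t2 := HahnSeries.single (gvec 3 1) 1
  ht := HahnSeries.single_ne_zero one_ne_zero
  hs := HahnSeries.single_ne_zero one_ne_zero
  ht1 := HahnSeries.single_ne_zero one_ne_zero
  ht2 := HahnSeries.single_ne_zero one_ne_zero
  v1 := HahnSeries.order_one
  tneg := by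
    simp only [hahnVV, HahnSeries.order_single one_ne_zero]
    refine ⟨0, fun j hj => absurd hj (by simp), ?_⟩
    show (Pi.single 0 (-1) : Fin 4 → ℤ) 0 < 0
    simp
  spos := by
    simp only [hahnVV, HahnSeries.order_single one_ne_zero]
    refine ⟨1, fun j hj => ?_, ?_⟩
    · have : j = 0 := by omega
      subst this
      show (0 : ℤ) = (Pi.single 1 1 : Fin 4 → ℤ) 0
      simp
    · show (0 : ℤ) < (Pi.single 1 1 : Fin 4 → ℤ) 1
      simp
  χt := parHom 0
  χs := parHom 1
  χ1 := parHom 2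
  χ2 := parHom 3
  tt := by simp [hahnVV, HahnSeries.order_single, parHom_gvec]
  st := by simp [hahnVV, HahnSeries.order_single, parHom_gvec]
  ot := by simp [hahnVV, HahnSeries.order_single, parHom_gvec]
  wt := by simp [hahnVV, HahnSeries.order_single, parHom_gvec]
  ss := by simp [hahnVV, HahnSeries.order_single, parHom_gvec]
  os := by simp [hahnVV, HahnSeries.order_single, parHom_gvec]
  ws := by simp [hahnVV, HahnSeries.order_single, parHom_gvec]
  oo := by simp [hahnVV, HahnSeries.order_single, parHom_gvec]
  wo := by simp [hahnVV, HahnSeries.order_single, parHom_gvec]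
  ow := by simp [hahnVV, HahnSeries.order_single, parHom_gvec]
  ww := by simp [hahnVV, HahnSeries.order_single, parHom_gvec]

theorem lower_bound (F : Type u) [Field F] [CharP F 2] (m : ℕ) (hm : csaDegFourEdLE F m) : 4 ≤ m := by
  have h2 : (2 : AlgebraicClosure F) = 0 := by
    have h : (2 : F) = 0 := CharTwo.two_eq_zero
    have := congrArg (algebraMap F (AlgebraicClosure F)) h
    rwa [map_ofNat, map_zero] at this
  let D := hahnDat (AlgebraicClosure F) h2
  obtain ⟨L, _, _, S, hx, hy⟩ := exists_biq D.two D.a D.b D.as_a D.as_b D.as_ab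
  exact lower_dat (Ω := AlgebraicClosure F) D S hx hy m hm


theorem trdegLE_of_le {F E : Type u} [Field F] [Field E] [Algebra F E] (n : ℕ)
    (h : Algebra.trdeg F E ≤ n) : TrdegLE F E n := by
  obtain ⟨s, hs⟩ := exists_isTranscendenceBasis F E
  have h1 := hs.cardinalMk_eq_trdeg
  rw [← h1] at h
  have hfin : s.Finite := Cardinal.lt_aleph0_iff_set_finite.mp (lt_of_le_of_lt h (Cardinal.natCast_lt_aleph0))
  refine ⟨hfin.toFinset, ?_, ?_⟩
  · rw [← Nat.cast_le (α := Cardinal), ← Cardinal.mk_coe_finset]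
    simpa using h
  · have := hs.isAlgebraic_field
    rw [Subtype.range_coe] at this
    rwa [hfin.coe_toFinset]

section
variable {K A R : Type*} [Field K] [Ring A] [Algebra K A] [Algebra.IsCentral K A] [IsSimpleRing A]
  [Ring R] [Algebra K R]

theorem lin_disj (φ : A →ₐ[K] R) {ι : Type*} (r : ι → R) (hc : ∀ i a, φ a * r i = r i * φ a)
    (hr : LinearIndependent K r) (s : Finset ι) : ∀ (a : ι → A), ∑ i ∈ s, r i * φ (a i) = 0 →
    ∀ i ∈ s, a i = 0 := by
  classical
  induction s using Finset.induction_on with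
  | empty => simp
  | insert j s hj ih =>
    intro a ha
    by_cases haj : a j = 0
    · rw [Finset.sum_insert hj, haj, map_zero, mul_zero, zero_add] at ha
      intro i hi
      rcases Finset.mem_insert.mp hi with rfl | hi
      · exact haj
      · exact ih a ha i hi
    exfalso
    let J : TwoSidedIdeal A := .mk' {t | ∃ a' : ι → A, ∑ i ∈ insert j s, r i * φ (a' i) = 0 ∧ a' j = t}
      ⟨0, by simp, rfl⟩
      (by rintro _ _ ⟨a, h, rfl⟩ ⟨b, h', rfl⟩
          exact ⟨a + b, by simp [mul_add, Finset.sum_add_distrib, h, h'], rfl⟩)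
      (by rintro _ ⟨a, h, rfl⟩
          exact ⟨-a, by simp [h, -Finset.sum_insert], rfl⟩)
      (by rintro x _ ⟨a, h, rfl⟩
          refine ⟨fun i => x * a i, ?_, rfl⟩
          have := congrArg (φ x * ·) h
          simpa only [Finset.mul_sum, ← mul_assoc, hc, map_mul, mul_zero] using this)
      (by rintro _ x ⟨a, h, rfl⟩
          refine ⟨fun i => a i * x, ?_, rfl⟩
          have := congrArg (· * φ x) h
          simpa only [Finset.sum_mul, mul_assoc, map_mul, zero_mul] using this)
    have hJ : (1 : A) ∈ J := IsSimpleRing.one_mem_of_ne_zero_mem J haj (by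
      rw [TwoSidedIdeal.mem_mk']; exact ⟨a, ha, rfl⟩)
    rw [TwoSidedIdeal.mem_mk'] at hJ
    obtain ⟨a', h', h1⟩ := hJ
    have key : ∀ x, ∀ i ∈ s, x * a' i - a' i * x = 0 := by
      intro x
      apply ih
      have e1 := congrArg (φ x * ·) h'
      have e2 := congrArg (· * φ x) h'
      simp only [Finset.sum_insert hj, Finset.mul_sum, Finset.sum_mul, mul_add, add_mul, h1, map_one, mul_one, mul_zero, zero_mul, ← mul_assoc, hc] at e1 e2
      simp only [map_sub, map_mul, mul_sub, Finset.sum_sub_distrib, ← mul_assoc]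
      have := congrArg₂ (· - ·) e1 e2
      simpa using this
    have hk : ∀ i, ∃ k : K, i ∈ insert j s → a' i = algebraMap K A k := by
      intro i
      by_cases hi : i ∈ insert j s
      · rcases Finset.mem_insert.mp hi with rfl | hi
        · exact ⟨1, by simp [h1]⟩
        · have : a' i ∈ Subalgebra.center K A := by
            rw [Subalgebra.mem_center_iff]
            intro x
            exact sub_eq_zero.mp (key x i hi)
          obtain ⟨k, hk⟩ := (Algebra.IsCentral.mem_center_iff K).mp this
          exact ⟨k, fun _ => hk⟩
      · exact ⟨0, fun h => absurd h hi⟩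
    choose k hk using hk
    have h2 : ∑ i ∈ insert j s, k i • r i = 0 := by
      rw [← h']
      refine Finset.sum_congr rfl fun i hi => ?_
      rw [hk i hi, AlgHom.commutes, ← Algebra.commutes, Algebra.smul_def]
    have h3 := linearIndependent_iff'.mp hr _ _ h2 j (by simp)
    have h4 := hk j (by simp)
    rw [h1, h3, map_zero] at h4
    exact one_ne_zero h4
end

theorem descent {E K A B : Type*} [Field E] [Field K] [Algebra E K] [Ring A] [Algebra K A] [Algebra E A]
    [IsScalarTower E K A] [Ring B] [Algebra E B] [Algebra.IsCentral E B] [IsSimpleRing B] [Nontrivial A]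
    (φ : B →ₐ[E] A) (hA : Module.finrank K A = 16) (hB : Module.finrank E B = 16) :
    Nonempty ((K ⊗[E] B) ≃ₐ[K] A) := by
  have hcm : ∀ x y, Commute (Algebra.ofId K A x) (φ y) := fun x y => Algebra.commutes x (φ y)
  let f : K ⊗[E] B →ₐ[K] A := Algebra.TensorProduct.lift (Algebra.ofId K A) φ hcm
  have hf : Function.Injective f := by
    classical
    rw [injective_iff_map_eq_zero]
    intro z hz
    let b := Module.Basis.ofVectorSpace E K
    obtain ⟨w, rfl⟩ := (TensorProduct.equivFinsuppOfBasisLeft (N := B) b).symm.surjective z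
    rw [TensorProduct.equivFinsuppOfBasisLeft_symm_apply] at hz ⊢
    have h0 : ∑ i ∈ w.support, algebraMap K A (b i) * φ (w i) = 0 := by
      rw [← hz, Finsupp.sum, map_sum]
      refine Finset.sum_congr rfl fun i _ => ?_
      exact (Algebra.TensorProduct.lift_tmul (Algebra.ofId K A) φ hcm (b i) (w i)).symm
    have hr : LinearIndependent E (fun i => algebraMap K A (b i)) := by
      have := b.linearIndependent.map' (IsScalarTower.toAlgHom E K A).toLinearMap
        (LinearMap.ker_eq_bot.mpr (algebraMap K A).injective)
      exact this
    have h1 := lin_disj φ (fun i => algebraMap K A (b i)) (fun i a => (Algebra.commutes _ _).symm) hr w.support w h0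
    rw [Finsupp.sum]
    refine Finset.sum_eq_zero fun i hi => ?_
    rw [h1 i hi, TensorProduct.tmul_zero]
  have : FiniteDimensional E B := Module.finite_of_finrank_pos (by omega)
  have : FiniteDimensional K A := Module.finite_of_finrank_pos (by omega)
  have hd : Module.finrank K (K ⊗[E] B) = Module.finrank K A := by
    rw [Module.finrank_baseChange, hA, hB]
  exact ⟨AlgEquiv.ofBijective f ⟨hf, (LinearMap.injective_iff_surjective_of_finrank_eq_finrank (f := f.toLinearMap) hd).mp hf⟩⟩


/-- quadratic elements -/
def IsQ (K : Type*) {D : Type*} [Field K] [Ring D] [Algebra K D] (z : D) : Prop :=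
  ∃ α β : K, z * z = algebraMap K D α * z + algebraMap K D β

section
variable {K : Type*} {D : Type u} [Field K] [DivisionRing D] [Algebra K D]

theorem two_sided_indep [Algebra.IsCentral K D] {ι : Type*} [Fintype ι] (d : ι → D) (hd : LinearIndependent K d)
    (c : ι → D) (h : ∀ x, ∑ j, c j * x * d j = 0) (j : ι) : c j = 0 := by
  refine lin_disj (Algebra.lmul K D) (fun j => LinearMap.mulRight K (d j)) ?_ ?_ Finset.univ c ?_ j (Finset.mem_univ j)
  · intro i a
    ext x
    simp [mul_assoc]
  · refine LinearIndependent.of_comp (LinearMap.applyₗ (1 : D)) ?_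
    convert hd
    ext i
    simp
  · ext x
    have := h x
    simpa [LinearMap.sum_apply] using this

section
variable {M : Type*} [Field M] [Algebra K M]

theorem comm_dim [Algebra.IsCentral K D] [FiniteDimensional K D] (i : M →ₐ[K] D) :
    (Module.finrank K M) ^ 2 ≤ Module.finrank K D ∧ Module.finrank K M ∣ Module.finrank K D := by
  let : Module M D := Module.compHom D i.toRingHom
  have hsm : ∀ (m : M) (d : D), m • d = i m * d := fun _ _ => rfl
  have : IsScalarTower K M D := ⟨fun k m d => by rw [hsm, hsm, map_smul, smul_mul_assoc]⟩
  have : FiniteDimensional M D := FiniteDimensional.right K M D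
  have h1 := Module.finrank_mul_finrank K M D
  refine ⟨?_, h1 ▸ Dvd.intro _ rfl⟩
  let b := Module.finBasis K D
  have hR : ∀ j, ∃ f : D →ₗ[M] D, ∀ x, f x = x * b j := fun j =>
    ⟨{ toFun := fun x => x * b j, map_add' := fun x y => add_mul _ _ _, map_smul' := fun m x => by simp [hsm, mul_assoc] }, fun _ => rfl⟩
  choose r hr using hR
  have hli : LinearIndependent M r := by
    rw [Fintype.linearIndependent_iff]
    intro g hg j
    have := two_sided_indep b b.linearIndependent (fun j => i (g j)) (fun x => by
      have := LinearMap.congr_fun hg x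
      simpa [LinearMap.sum_apply, hr, hsm, mul_assoc] using this) j
    simpa using this
  have h2 := hli.fintype_card_le_finrank
  rw [Fintype.card_fin, Module.finrank_linearMap, ← h1] at h2
  have h3 : 0 < Module.finrank M D := Module.finrank_pos
  have := Nat.le_of_mul_le_mul_right h2 h3
  rw [← h1, sq]
  exact Nat.mul_le_mul_left _ this

end

theorem exists_field' [FiniteDimensional K D] (S : Subalgebra K D) (hS : ∀ a ∈ S, ∀ b ∈ S, a * b = b * a) :
    ∃ (M : Type u) (_ : Field M) (_ : Algebra K M) (i : M →ₐ[K] D), i.range = S := by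
  let c : CommRing S := { S.toRing with mul_comm := fun a b => Subtype.ext (hS _ a.2 _ b.2) }
  let a : Algebra K S := S.algebra
  have : IsDomain S := S.isDomain
  let := fieldOfFiniteDimensional K S
  exact ⟨S, this, a, S.val, S.range_val⟩

open IntermediateField in
theorem deg_dim [Algebra.IsCentral K D] [FiniteDimensional K D] (z : D) :
    (minpoly K z).natDegree ^ 2 ≤ Module.finrank K D ∧ (minpoly K z).natDegree ∣ Module.finrank K D := by
  obtain ⟨M, _, _, i, hi⟩ := exists_field' (Algebra.adjoin K {z}) (fun a ha b hb =>
    Algebra.commute_of_mem_adjoin_singleton_of_commute hb (Algebra.commute_of_mem_adjoin_self ha).symm)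
  have hz : z ∈ i.range := hi ▸ Algebra.subset_adjoin rfl
  obtain ⟨α, hα⟩ := hz
  have : FiniteDimensional K M := FiniteDimensional.of_injective i.toLinearMap i.toRingHom.injective
  have := comm_dim (i.comp (K⟮α⟯).val)
  rw [IntermediateField.adjoin.finrank (Algebra.IsIntegral.isIntegral α), ← minpoly.algHom_eq i i.toRingHom.injective α] at this
  rwa [show i α = z from hα] at this

theorem deg_pos [FiniteDimensional K D] (z : D) : 0 < (minpoly K z).natDegree :=
  minpoly.natDegree_pos (Algebra.IsIntegral.isIntegral z)

theorem isQ_of_deg [FiniteDimensional K D] (z : D) (h : (minpoly K z).natDegree ≤ 2) : IsQ K z := by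
  have hp := deg_pos (K := K) z
  have h0 := minpoly.aeval K z
  have hm : (minpoly K z).Monic := minpoly.monic (Algebra.IsIntegral.isIntegral z)
  have hm' := hm.coeff_natDegree
  rw [Polynomial.aeval_eq_sum_range] at h0
  set f := minpoly K z
  obtain h1 | h1 : f.natDegree = 1 ∨ f.natDegree = 2 := by omega
  · rw [h1] at h0 hm'
    simp [Finset.sum_range_succ, hm', Algebra.smul_def] at h0
    refine ⟨- f.coeff 0, 0, ?_⟩
    rw [eq_neg_of_add_eq_zero_right h0]; simp
  · rw [h1] at h0 hm'
    simp [Finset.sum_range_succ, hm', Algebra.smul_def] at h0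
    refine ⟨- f.coeff 1, - f.coeff 0, ?_⟩
    rw [← sq, eq_neg_of_add_eq_zero_right h0]; simp

theorem four_le [FiniteDimensional K D] (z : D) (h : LinearIndependent K (fun i : Fin 4 => z ^ (i : ℕ))) :
    4 ≤ Module.finrank K (Algebra.adjoin K {z}) := by
  have h1 := finrank_span_eq_card h
  rw [Fintype.card_fin] at h1
  rw [← h1]
  refine Submodule.finrank_mono (t := Subalgebra.toSubmodule (Algebra.adjoin K {z})) (Submodule.span_le.mpr ?_)
  rintro _ ⟨i, rfl⟩
  exact pow_mem (Algebra.self_mem_adjoin_singleton K z) _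

theorem isQ_four [Algebra.IsCentral K D] (h4 : Module.finrank K D = 4) (z : D) : IsQ K z := by
  have : FiniteDimensional K D := Module.finite_of_finrank_pos (by omega)
  refine isQ_of_deg z ?_
  have := (deg_dim (K := K) z).1
  rw [h4] at this
  nlinarith

section
variable [Algebra.IsCentral K D] (h16 : Module.finrank K D = 16)
include h16

theorem isQ_or (z : D) : IsQ K z ∨ (minpoly K z).natDegree = 4 := by
  have : FiniteDimensional K D := Module.finite_of_finrank_pos (by omega)
  by_cases h : (minpoly K z).natDegree ≤ 2
  · exact Or.inl (isQ_of_deg z h)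
  · right
    obtain ⟨h1, h2⟩ := deg_dim (K := K) z
    rw [h16] at h1 h2
    have h3 : (minpoly K z).natDegree ≤ 4 := by nlinarith
    generalize (minpoly K z).natDegree = n at *
    interval_cases n <;> omega

theorem finrank_comm_le (S : Subalgebra K D) (hS : ∀ a ∈ S, ∀ b ∈ S, a * b = b * a) : Module.finrank K S ≤ 4 := by
  have : FiniteDimensional K D := Module.finite_of_finrank_pos (by omega)
  obtain ⟨M, _, _, i, rfl⟩ := exists_field' S hS
  have h1 := (comm_dim i).1
  have h2 : Module.finrank K i.range = Module.finrank K M :=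
    (AlgEquiv.ofInjective i i.toRingHom.injective).toLinearEquiv.finrank_eq.symm
  rw [h2]
  rw [h16] at h1
  nlinarith

theorem mem_adjoin_of_comm (z p : D) (hz : ¬ IsQ K z) (hp : p * z = z * p) : p ∈ Algebra.adjoin K {z} := by
  have : FiniteDimensional K D := Module.finite_of_finrank_pos (by omega)
  have hd := (isQ_or h16 z).resolve_left hz
  have h1 : 4 ≤ Module.finrank K (Algebra.adjoin K {z}) := by
    have := linearIndependent_pow (K := K) z
    rw [hd] at this
    exact four_le z this
  have h2 : Module.finrank K (Algebra.adjoin K {z, p}) ≤ 4 := by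
    refine finrank_comm_le h16 _ ?_
    have := Algebra.isMulCommutative_adjoin K (s := {z, p}) (by
      rintro x (rfl | rfl) y (rfl | rfl) <;> simp [hp])
    intro a ha b hb
    exact setLike_mul_comm ha hb
  have hle : Algebra.adjoin K {z} ≤ Algebra.adjoin K {z, p} := Algebra.adjoin_mono (by simp)
  have := Submodule.eq_of_le_of_finrank_le (S₁ := Subalgebra.toSubmodule (Algebra.adjoin K {z})) (S₂ := Subalgebra.toSubmodule (Algebra.adjoin K {z, p})) hle (h2.trans h1)
  have hp : p ∈ Subalgebra.toSubmodule (Algebra.adjoin K {z, p}) := Algebra.subset_adjoin (by simp)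
  rw [← this] at hp
  exact hp

/-- L1 -/
theorem isQ_of_comm (z p q : D) (hp : p * z = z * p) (hq : q * z = z * q) (hpq : p * q ≠ q * p) : IsQ K z := by
  by_contra hz
  refine hpq ?_
  have h1 := mem_adjoin_of_comm h16 z p hz hp
  exact (Algebra.commute_of_mem_adjoin_singleton_of_commute h1 hq).symm

/-- L2 -/
theorem isQ_of_cubic (z : D) (a b c : K) (h : z * z * z + algebraMap K D a * (z * z) + algebraMap K D b * z + algebraMap K D c = 0) : IsQ K z := by
  have : FiniteDimensional K D := Module.finite_of_finrank_pos (by omega)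
  refine (isQ_or h16 z).resolve_right fun h4 => ?_
  let f : Polynomial K := Polynomial.X ^ 3 + Polynomial.C a * Polynomial.X ^ 2 + Polynomial.C b * Polynomial.X + Polynomial.C c
  have hf : f.natDegree = 3 := by simp only [f]; compute_degree!
  have h1 : f.Monic := by simp only [f]; monicity!
  have h2 := Polynomial.natDegree_le_natDegree (minpoly.min K z h1 (by simpa [f, pow_succ, mul_assoc] using h))
  omega

/-- L3 -/
theorem comm_quartic (p q : D) : IsQ K (p * q - q * p) ∨ ∃ α β γ : K, (p * q - q * p) ^ 4 +
    algebraMap K D α * (p * q - q * p) ^ 2 + algebraMap K D β * (p * q - q * p) + algebraMap K D γ = 0 := by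
  have : FiniteDimensional K D := Module.finite_of_finrank_pos (by omega)
  set a := p * q - q * p with ha
  refine (isQ_or h16 a).imp_right fun hd => ?_
  have hind := linearIndependent_pow (K := K) a
  rw [hd] at hind
  have h0 := minpoly.aeval K a
  have hm' := (minpoly.monic (A := K) (Algebra.IsIntegral.isIntegral a)).coeff_natDegree
  rw [Polynomial.aeval_eq_sum_range] at h0
  obtain ⟨M, _, _, i, hi⟩ := exists_field' (Algebra.adjoin K {a}) (fun x ha b hb =>
    Algebra.commute_of_mem_adjoin_singleton_of_commute hb (Algebra.commute_of_mem_adjoin_self ha).symm)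
  set f := minpoly K a
  rw [hd] at h0 hm'
  simp only [Finset.sum_range_succ, Finset.sum_range_zero, hm', Algebra.smul_def, pow_zero, mul_one, pow_one, map_one, one_mul, zero_add] at h0
  have hM : Module.finrank K M = 4 := by
    have h2 : Module.finrank K i.range = Module.finrank K M :=
      (AlgEquiv.ofInjective i i.toRingHom.injective).toLinearEquiv.finrank_eq.symm
    rw [hi] at h2
    refine le_antisymm (h2 ▸ finrank_comm_le h16 _ (fun x ha b hb =>
      Algebra.commute_of_mem_adjoin_singleton_of_commute hb (Algebra.commute_of_mem_adjoin_self ha).symm)) ?_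
    rw [← h2]
    exact four_le a hind
  let _ : Module M D := Module.compHom D i.toRingHom
  have hsm : ∀ (m : M) (d : D), m • d = i m * d := fun _ _ => rfl
  have : IsScalarTower K M D := ⟨fun k m d => by rw [hsm, hsm, map_smul, smul_mul_assoc]⟩
  have : FiniteDimensional M D := FiniteDimensional.right K M D
  have h1 := Module.finrank_mul_finrank K M D
  have hMD : Module.finrank M D = 4 := by rw [hM, h16] at h1; omega
  have hR : ∀ d : D, ∃ f : Module.End M D, ∀ x, f x = x * d := fun d =>
    ⟨{ toFun := fun x => x * d, map_add' := fun x y => add_mul _ _ _, map_smul' := fun m x => by simp [hsm, mul_assoc] }, fun _ => rfl⟩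
  choose r hr using hR
  have hra : r a = r q * r p - r p * r q := by
    ext x
    simp [hr, ha, mul_sub, mul_assoc]
  have htr : LinearMap.trace M D (r a) = 0 := by
    rw [hra, map_sub, LinearMap.trace_mul_comm, sub_self]
  have hch := (r a).aeval_self_charpoly
  have hcd : (r a).charpoly.natDegree = 4 := by rw [LinearMap.charpoly_natDegree, hMD]
  have hc3 : (r a).charpoly.coeff 3 = 0 := by
    have h := (LinearMap.charpoly_toMatrix (r a) (Module.finBasis M D))
    have h' := Matrix.trace_eq_neg_charpoly_nextCoeff (LinearMap.toMatrix (Module.finBasis M D) (Module.finBasis M D) (r a))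
    rw [h, ← LinearMap.trace_eq_matrix_trace, htr, Polynomial.nextCoeff_of_natDegree_pos (by omega), hcd] at h'
    simpa using h'
  have hc4 := (LinearMap.charpoly_monic (r a)).coeff_natDegree
  rw [hcd] at hc4
  rw [Polynomial.aeval_eq_sum_range, hcd] at hch
  set χ := (r a).charpoly
  have hpow : ∀ (n : ℕ) x, ((r a) ^ n) x = x * a ^ n := by
    intro n
    induction n with
    | zero => simp
    | succ n ih => intro x; rw [pow_succ', Module.End.mul_apply, ih, hr, mul_assoc, ← pow_succ]
  have key := two_sided_indep (K := K) (fun j : Fin 4 => a ^ (j : ℕ)) hind (fun j => i (χ.coeff j) - algebraMap K D (f.coeff j)) (by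
    intro x
    have h := LinearMap.congr_fun hch x
    simp only [Finset.sum_range_succ, Finset.sum_range_zero, hc4, LinearMap.add_apply, LinearMap.smul_apply, hsm, hpow, zero_add, map_one, one_mul, LinearMap.zero_apply, pow_zero, pow_one, mul_one] at h
    have h2 : x * (algebraMap K D (f.coeff 0) + algebraMap K D (f.coeff 1) * a + algebraMap K D (f.coeff 2) * a ^ 2 +
      algebraMap K D (f.coeff 3) * a ^ 3 + a ^ 4) = 0 := by rw [h0, mul_zero]
    have hc : ∀ k : K, ∀ y : D, x * (algebraMap K D k * y) = algebraMap K D k * (x * y) := fun k y => by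
      rw [← mul_assoc, ← Algebra.commutes, mul_assoc]
    simp only [mul_add, hc, ← Algebra.commutes _ x] at h2
    have h3 := congrArg₂ (· - ·) h h2
    simp only [sub_zero] at h3
    rw [← h3]
    simp [Fin.sum_univ_four, sub_mul, mul_assoc]
    exact Or.inl (hr a x).symm) 3
  have h3 : f.coeff 3 = 0 := by
    have : algebraMap K D (f.coeff 3) = 0 := by
      have h := sub_eq_zero.mp key
      change i (χ.coeff 3) = algebraMap K D (f.coeff 3) at h
      rw [hc3, map_zero] at h
      exact h.symm
    simpa using this
  refine ⟨f.coeff 2, f.coeff 1, f.coeff 0, ?_⟩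
  rw [h3, map_zero, zero_mul, add_zero] at h0
  rw [← h0]
  abel
end
end


/-- scalars -/
def Cn (K : Type*) {D : Type*} [Field K] [Ring D] [Algebra K D] (z : D) : Prop := ∃ k : K, z = algebraMap K D k

section
variable {K : Type*} {D : Type u} [Field K] [DivisionRing D] [Algebra K D]

theorem Cn.comm {z : D} (h : Cn K z) (w : D) : z * w = w * z := by
  obtain ⟨k, rfl⟩ := h; exact Algebra.commutes k w
theorem Cn.add {z w : D} (h : Cn K z) (h' : Cn K w) : Cn K (z + w) := by
  obtain ⟨k, rfl⟩ := h; obtain ⟨l, rfl⟩ := h'; exact ⟨k + l, by simp⟩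
theorem Cn.mul {z w : D} (h : Cn K z) (h' : Cn K w) : Cn K (z * w) := by
  obtain ⟨k, rfl⟩ := h; obtain ⟨l, rfl⟩ := h'; exact ⟨k * l, by simp⟩
theorem Cn.inv {z : D} (h : Cn K z) : Cn K z⁻¹ := by
  obtain ⟨k, rfl⟩ := h; exact ⟨k⁻¹, by simp⟩
theorem Cn.one : Cn K (1 : D) := ⟨1, by simp⟩
theorem Cn.zero : Cn K (0 : D) := ⟨0, by simp⟩
theorem Cn.map (k : K) : Cn K (algebraMap K D k) := ⟨k, rfl⟩
theorem isQ_iff (z : D) : IsQ K z ↔ ∃ α β : D, Cn K α ∧ Cn K β ∧ z * z = α * z + β := by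
  constructor
  · rintro ⟨a, b, h⟩; exact ⟨_, _, ⟨a, rfl⟩, ⟨b, rfl⟩, h⟩
  · rintro ⟨_, _, ⟨a, rfl⟩, ⟨b, rfl⟩, h⟩; exact ⟨a, b, h⟩

theorem Cn.of_comm [Algebra.IsCentral K D] {z : D} (h : ∀ w, w * z = z * w) : Cn K z :=
  (Algebra.IsCentral.mem_center_iff K).mp (Subalgebra.mem_center_iff.mpr h)

theorem exists_not_comm [Algebra.IsCentral K D] {z : D} (h : ¬ Cn K z) : ∃ w, w * z ≠ z * w := by
  by_contra! h'
  exact h (Cn.of_comm h')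

section
variable (h2 : (2 : D) = 0)
include h2
theorem ct_add (z : D) : z + z = 0 := by rw [← two_mul, h2, zero_mul]
theorem ct_neg (z : D) : -z = z := by rw [neg_eq_iff_add_eq_zero, ct_add h2]
theorem ct_sub (z w : D) : z - w = z + w := by rw [sub_eq_add_neg, ct_neg h2]
theorem ct_iff (z w : D) : z = w ↔ z + w = 0 := by rw [← ct_sub h2, sub_eq_zero]

theorem ct_z (n : ℤ) (z : D) : (2 * n) • z = 0 := by
  rw [mul_comm, mul_smul, two_smul, ct_add h2, smul_zero]
theorem ct_n (n : ℕ) (z : D) : (2 * n) • z = 0 := by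
  rw [mul_comm, mul_smul, two_smul, ct_add h2, smul_zero]

theorem as_of_quad [Algebra.IsCentral K D] (hL : ∀ z p q : D, p * z = z * p → q * z = z * q → p * q ≠ q * p → IsQ K z)
    (e : D) (he : ¬ Cn K e) (hq : IsQ K e) : ∃ x : D, ¬ Cn K x ∧ ∃ β, Cn K β ∧ x * x = x + β := by
  have sep : ∀ e p q : D, ¬ Cn K e → Cn K p → Cn K q → e * e = p * e + q → p ≠ 0 →
      ∃ x : D, ¬ Cn K x ∧ ∃ β, Cn K β ∧ x * x = x + β := by
    intro e p q he hp hq h hp0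
    refine ⟨p⁻¹ * e, fun h => he ?_, p⁻¹ * p⁻¹ * q, (hp.inv.mul hp.inv).mul hq, ?_⟩
    · have := hp.mul h
      rwa [mul_inv_cancel_left₀ hp0] at this
    · have : p⁻¹ * e * (p⁻¹ * e) = p⁻¹ * p⁻¹ * (e * e) := by
        rw [mul_assoc, ← mul_assoc e, ← hp.inv.comm e]; simp only [mul_assoc]
      rw [this, h, mul_add, mul_assoc p⁻¹, inv_mul_cancel_left₀ hp0]
  obtain ⟨p, q, hp, hq, h⟩ := (isQ_iff e).mp hq
  by_cases hp0 : p ≠ 0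
  · exact sep e p q he hp hq h hp0
  push Not at hp0
  rw [hp0, zero_mul, zero_add] at h
  obtain ⟨z, hz⟩ := exists_not_comm he
  have he0 : e ≠ 0 := fun h => he (h ▸ Cn.zero)
  have hw0 : e * z + z * e ≠ 0 := fun h => hz ((ct_iff h2 _ _).mpr (by rwa [add_comm]))
  obtain ⟨w, hw⟩ : ∃ w, w = e * z + z * e := ⟨_, rfl⟩
  rw [← hw] at hw0
  have hwe : w⁻¹ * e = e * w⁻¹ := by
    have : w * e = e * w := by
      rw [hw, mul_add, add_mul, mul_assoc z, h, ← mul_assoc e e, h, hq.comm, add_comm, mul_assoc]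
    have : Commute w e := this
    exact this.inv_left₀
  obtain ⟨x, hx⟩ : ∃ x, x = z * w⁻¹ * e := ⟨_, rfl⟩
  have hex : e * x = x * e + e := by
    have : e * z = w + z * e := by rw [hw, add_assoc, ct_add h2, add_zero]
    rw [hx, ← mul_assoc, ← mul_assoc, this, add_mul, mul_inv_cancel₀ hw0, add_mul, one_mul, add_comm]
    congr 1
    rw [mul_assoc z e, ← hwe]; simp only [mul_assoc]
  have hne : e * x ≠ x * e := by rw [hex]; simpa using he0
  have hxC : ¬ Cn K x := fun h => hne (h.comm e).symm
  have hge : e * (x * x + x) = (x * x + x) * e := by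
    have : e * (x * x + x) = (e * x) * x + e * x := by noncomm_ring
    rw [this, hex, add_mul, mul_assoc x, hex]
    rw [ct_iff h2]
    have e1 := ct_add h2 (x * e)
    have e2 := ct_add h2 e
    have e3 := ct_add h2 (x * (x * e))
    calc _ = (x * (x * e) + x * (x * e)) + (x * e + x * e) + (x * e + x * e) + (e + e) := by noncomm_ring
      _ = 0 := by rw [e1, e2, e3]; simp
  obtain ⟨p', q', hp', hq', hg⟩ := (isQ_iff _).mp (hL (x * x + x) e x hge (by noncomm_ring) hne)
  by_cases hgC : Cn K (x * x + x)
  · exact ⟨x, hxC, _, hgC, by rw [add_comm, add_assoc, ct_add h2, add_zero]⟩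
  by_cases hp0' : p' ≠ 0
  · exact sep _ p' q' hgC hp' hq' hg hp0'
  push Not at hp0'
  rw [hp0', zero_mul, zero_add] at hg
  refine ⟨x * x, fun hC => ?_, q', hq', ?_⟩
  · have h1 := hC.comm e
    have : e * (x * x) = x * x * e + e := by
      have := hge
      rw [mul_add, add_mul, hex] at this
      rw [ct_iff h2] at this ⊢
      rw [← this]
      have e1 := ct_add h2 (x * e)
      calc _ = e * (x * x) + x * x * e + e + 0 := by noncomm_ring
        _ = _ := by rw [← e1]; noncomm_ring
    rw [this] at h1
    exact he0 (by simpa using h1)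
  · rw [← hg, ct_iff h2]
    have e1 := ct_add h2 (x * x * (x * x))
    have e2 := ct_add h2 (x * x * x)
    have e3 := ct_add h2 (x * x)
    calc _ = (x * x * (x * x) + x * x * (x * x)) + (x * x * x + x * x * x) + (x * x + x * x) := by noncomm_ring
      _ = 0 := by rw [e1, e2, e3]; simp

theorem exists_quad [Algebra.IsCentral K D] (h16 : Module.finrank K D = 16) : ∃ e : D, ¬ Cn K e ∧ IsQ K e := by
  have hL := isQ_of_comm (K := K) (D := D) h16
  obtain ⟨p, q, hpq⟩ : ∃ p q : D, p * q ≠ q * p := by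
    by_contra! h
    have := finrank_comm_le h16 ⊤ (fun a _ b _ => h a b)
    rw [show Module.finrank K (⊤ : Subalgebra K D) = Module.finrank K D from (Subalgebra.topEquiv (R := K) (A := D)).toLinearEquiv.finrank_eq] at this
    omega
  have hpC : ¬ Cn K p := fun h => hpq (h.comm q)
  obtain ⟨p, q, ha⟩ : ∃ p q : D, ¬ Cn K (p * q - q * p) := by
    by_cases h : Cn K (p * q - q * p)
    · refine ⟨p, p * q, fun h' => hpC ?_⟩
      have h1 : p * (p * q) - p * q * p = p * (p * q - q * p) := by noncomm_ring
      rw [h1] at h'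
      have := h'.mul h.inv
      rwa [mul_inv_cancel_right₀ (sub_ne_zero.mpr hpq)] at this
    · exact ⟨_, _, h⟩
  rcases comm_quartic h16 p q with h | ⟨α, β, γ, h⟩
  · exact ⟨_, ha, h⟩
  obtain ⟨a, ha'⟩ : ∃ a, a = p * q - q * p := ⟨_, rfl⟩
  rw [← ha'] at h ha
  obtain ⟨A, hA⟩ : ∃ A, A = algebraMap K D α := ⟨_, rfl⟩
  obtain ⟨B, hB⟩ : ∃ B, B = algebraMap K D β := ⟨_, rfl⟩
  obtain ⟨C, hC⟩ : ∃ C, C = algebraMap K D γ := ⟨_, rfl⟩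
  have hAC : Cn K A := ⟨_, hA⟩
  have hBC : Cn K B := ⟨_, hB⟩
  have hCC : Cn K C := ⟨_, hC⟩
  rw [← hA, ← hB, ← hC] at h
  clear ha' hA hB hC
  obtain ⟨d, hd⟩ := exists_not_comm ha
  have hd0 : d ≠ 0 := by rintro rfl; simp at hd
  obtain ⟨a', ha'⟩ : ∃ a', a' = d * a * d⁻¹ := ⟨_, rfl⟩
  have hs : SemiconjBy d a a' := by
    rw [SemiconjBy, ha', inv_mul_cancel_right₀ hd0]
  have hne : a + a' ≠ 0 := by
    intro h0
    rw [← ct_iff h2] at h0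
    rw [← h0] at hs
    exact hd hs
  have hcj : ∀ k, Cn K k → SemiconjBy d k k := fun k hk => (hk.comm d).symm
  have h' : a' ^ 4 + A * a' ^ 2 + B * a' + C = 0 := by
    have : SemiconjBy d (a ^ 4 + A * a ^ 2 + B * a + C) (a' ^ 4 + A * a' ^ 2 + B * a' + C) :=
      (((hs.pow_right 4).add_right ((hcj A hAC).mul_right (hs.pow_right 2))).add_right ((hcj B hBC).mul_right hs)).add_right (hcj C hCC)
    rw [SemiconjBy, h, mul_zero, eq_comm, mul_eq_zero] at this
    exact this.resolve_right hd0
  obtain ⟨b, hb⟩ : ∃ b, b = (a * a + a' * a') * (a + a')⁻¹ := ⟨_, rfl⟩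
  have hb' : b * (a + a') = a * a + a' * a' := by rw [hb, inv_mul_cancel_right₀ hne]
  obtain ⟨c, hc⟩ : ∃ c, c = a * a + b * a := ⟨_, rfl⟩
  have hc1 : a * a = b * a + c := by rw [hc, add_comm (a * a), ← add_assoc, ct_add h2, zero_add]
  have hc2 : a' * a' = b * a' + c := by
    rw [hc, ← add_assoc, add_right_comm, ← mul_add, add_comm a' a, hb', add_right_comm, ct_add h2, zero_add]
  have red : ∀ t : D, t * t = b * t + c → t ^ 4 + A * t ^ 2 + B * t + C =
      (b * b * b + c * b + b * c + A * b + B) * t + ((b * b + c) * c + A * c + C) := by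
    intro t ht
    have e2 : t ^ 2 = b * t + c := by rw [sq, ht]
    have e3 : t ^ 3 = (b * b + c) * t + b * c := by
      rw [pow_succ, e2, add_mul, mul_assoc, ht]; noncomm_ring
    have e4 : t ^ 4 = (b * b + c) * (b * t + c) + b * c * t := by
      rw [pow_succ, e3, add_mul, mul_assoc, ht]
    rw [e4, e2]; noncomm_ring
  rw [red a hc1] at h
  rw [red a' hc2] at h'
  have hr : b * b * b + c * b + b * c + A * b + B = 0 := by
    have := congrArg₂ (· + ·) h h'
    simp only [add_zero] at this
    rw [add_add_add_comm, ct_add h2, add_zero, ← mul_add, mul_eq_zero] at this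
    exact this.resolve_right hne
  by_cases hbc : b * c = c * b
  · have hcub : b * b * b + A * b + B = 0 := by
      rw [← hr, hbc, add_assoc (b * b * b) (c * b), ct_add h2, add_zero]
    obtain ⟨α, rfl⟩ := hAC
    obtain ⟨β, rfl⟩ := hBC
    have hQ := isQ_of_cubic h16 b 0 α β (by simpa using hcub)
    by_cases hbC : Cn K b
    · have hca : a * c = c * a := by
        rw [hc, mul_add, add_mul, ← mul_assoc a b, ← hbC.comm a, mul_assoc]; simp only [mul_assoc]
      have hcd : d * c = c * d := by
        have : SemiconjBy d (a * a + b * a) (a' * a' + b * a') := (hs.mul_right hs).add_right ((hcj b hbC).mul_right hs)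
        have h3 : a' * a' + b * a' = c := by rw [hc2, add_right_comm, ct_add h2, zero_add]
        rw [h3, ← hc] at this
        exact this
      by_cases hcC : Cn K c
      · exact ⟨a, ha, (isQ_iff a).mpr ⟨b, c, hbC, hcC, hc1⟩⟩
      · exact ⟨c, hcC, hL c d a hcd hca hd⟩
    · exact ⟨b, hbC, hQ⟩
  · have hb2 : c * (b * b) = b * b * c := by
      have h1 : b * (b * b * b + c * b + b * c + A * b + B) - (b * b * b + c * b + b * c + A * b + B) * b = 0 := by
        rw [hr]; simp
      have h3 : b * (A * b) = A * b * b := by rw [← mul_assoc, hAC.comm]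
      have h4 : b * B = B * b := (hBC.comm b).symm
      simp only [mul_add, add_mul, h3, h4] at h1
      rw [eq_comm, ← sub_eq_zero, ← h1]
      noncomm_ring
    have hQ := hL (b * b) b c (by noncomm_ring) hb2 hbc
    by_cases hC2 : Cn K (b * b)
    · refine ⟨b, fun h => hbc (h.comm c), (isQ_iff b).mpr ⟨0, b * b, Cn.zero, hC2, by simp⟩⟩
    · exact ⟨_, hC2, hQ⟩

theorem exists_as [Algebra.IsCentral K D] (h16 : Module.finrank K D = 16) :
    ∃ x : D, ¬ Cn K x ∧ ∃ β, Cn K β ∧ x * x = x + β := by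
  obtain ⟨e, he, hq⟩ := exists_quad (K := K) h2 h16
  exact as_of_quad h2 (isQ_of_comm h16) e he hq
end
end


section
variable {K : Type*} {D : Type u} [Field K] [DivisionRing D] [Algebra K D] (h2 : (2 : D) = 0)
include h2

theorem n2 (z : D) : (2 : ℕ) • z = 0 := by rw [two_nsmul, ct_add h2]

theorem n4 (z : D) : (4 : ℕ) • z = 0 := by rw [show 4 = 2 * 2 by rfl, mul_smul, n2 h2]

theorem z2 (z : D) : (2 : ℤ) • z = 0 := by rw [two_zsmul, ct_add h2]

theorem z4 (z : D) : (4 : ℤ) • z = 0 := by rw [show (4 : ℤ) = 2 * 2 by rfl, mul_smul, z2 h2]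

theorem ad_mem (x β z : D) (hβ : Cn K β) (hx : x * x = x + β) :
    (x * z + z * x) * x = x * (x * z + z * x) + (x * z + z * x) := by
  have e1 : (x * z + z * x) * x = x * z * x + z * (x * x) := by noncomm_ring
  have e2 : x * (x * z + z * x) = x * x * z + x * z * x := by noncomm_ring
  rw [e1, e2, hx, mul_add, add_mul, ← hβ.comm, ct_iff h2]
  abel_nf
  simp only [n2 h2, n4 h2, z2 h2, z4 h2, add_zero, zero_add]

theorem ad_mem' (x β z : D) (hβ : Cn K β) (hx : x * x = x + β) :
    (z + (x * z + z * x)) * x = x * (z + (x * z + z * x)) := by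
  rw [add_mul, ad_mem h2 x β z hβ hx, mul_add, ct_iff h2]
  simp only [mul_add]
  abel_nf
  simp only [n2 h2, n4 h2, z2 h2, z4 h2, add_zero, zero_add]

theorem polar (hK : ∃ l : K, l ≠ 0 ∧ l ≠ 1) (A : D → Prop) (hadd : ∀ u v, A u → A v → A (u + v))
    (hsm : ∀ (k : K) u, A u → A (algebraMap K D k * u)) (h4 : ∀ u, A u → Cn K (u * u * (u * u))) (u v : D) (hu : A u) (hv : A v) :
    Cn K (u * u * (u * v + v * u) + (u * v + v * u) * (u * u)) := by
  have h2K : (2 : K) = 0 := by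
    have : algebraMap K D 2 = 0 := by rw [map_ofNat, h2]
    simpa using this
  obtain ⟨q, hq⟩ : ∃ q, q = u * u := ⟨_, rfl⟩
  obtain ⟨q', hq'⟩ : ∃ q, q = v * v := ⟨_, rfl⟩
  obtain ⟨s, hs⟩ : ∃ q, q = u * v + v * u := ⟨_, rfl⟩
  rw [← hs, ← hq]
  have key : ∀ l : K, l ≠ 0 → Cn K ((q * s + s * q) + algebraMap K D l * (s * s + (q * q' + q' * q)) + algebraMap K D (l * l) * (s * q' + q' * s)) := by
    intro l hl
    obtain ⟨k, hk⟩ := h4 _ (hadd _ _ hu (hsm l v hv))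
    obtain ⟨k1, hk1⟩ := h4 _ hu
    obtain ⟨k2, hk2⟩ := h4 _ hv
    have e1 : (u + algebraMap K D l * v) * (u + algebraMap K D l * v) = q + algebraMap K D l * s + algebraMap K D (l * l) * q' := by
      rw [hq, hs, hq']
      simp only [← Algebra.smul_def, mul_add, add_mul, smul_mul_assoc, mul_smul_comm, smul_smul, smul_add]
      abel
    rw [e1] at hk
    rw [← hq] at hk1
    rw [← hq'] at hk2
    refine ⟨l⁻¹ * (k + k1 + l * l * l * l * k2), ?_⟩
    have e2 : algebraMap K D l * ((q * s + s * q) + algebraMap K D l * (s * s + (q * q' + q' * q)) + algebraMap K D (l * l) * (s * q' + q' * s))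
      = algebraMap K D k - algebraMap K D k1 - algebraMap K D (l * l * l * l) * algebraMap K D k2 := by
      rw [← hk, ← hk1, ← hk2]
      simp only [← Algebra.smul_def, mul_add, add_mul, smul_mul_assoc, mul_smul_comm, smul_smul, smul_add, ← mul_assoc]
      abel
    have hl' : algebraMap K D l ≠ 0 := by simpa using hl
    rw [ct_sub h2, ct_sub h2, ← map_mul, ← map_add, ← map_add] at e2
    rw [map_mul _ l⁻¹, ← e2, map_inv₀, inv_mul_cancel_left₀ hl']
  obtain ⟨l, hl0, hl1⟩ := hK
  have a1 := key 1 one_ne_zero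
  have a2 := key l hl0
  have a3 := key (l + 1) (fun h => hl1 (by linear_combination h - h2K))
  have := (a1.add a2).add a3
  convert this using 1
  have e : (l + 1) * (l + 1) = l * l + 1 := by linear_combination l * h2K
  rw [e, ct_iff h2]
  simp only [map_add, map_one, add_mul, mul_one, one_mul]
  abel_nf
  simp only [n2 h2, n4 h2, z2 h2, z4 h2, add_zero, zero_add]

theorem exists_y [Algebra.IsCentral K D] (h16 : Module.finrank K D = 16) (x : D) (hxC : ¬ Cn K x)
    (β : D) (hβ : Cn K β) (hx : x * x = x + β) :
    ∃ y : D, y * x = x * y ∧ ¬ Cn K y ∧ ¬ Cn K (x + y) ∧ ∃ γ, Cn K γ ∧ y * y = y + γ := by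
  by_contra hcon
  have hK : ∃ l : K, l ≠ 0 ∧ l ≠ 1 := by
    by_contra! h
    have hf : Finite K := by
      have : (Set.univ : Set K) ⊆ {0, 1} := fun l _ => by
        by_cases hl : l = 0
        · simp [hl]
        · simp [h l hl]
      exact Set.finite_univ_iff.mp ((Set.toFinite _).subset this)
    have : FiniteDimensional K D := Module.finite_of_finrank_pos (by omega)
    have : Finite D := Module.finite_of_finite K
    exact hxC (Cn.of_comm fun w => (littleWedderburn D).mul_comm w x)
  -- the odd part
  have hA0 : ∃ u, u ≠ 0 ∧ u * x = x * u + u := by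
    obtain ⟨w, hw⟩ := exists_not_comm hxC
    exact ⟨x * w + w * x, fun h => hw ((ct_iff h2 _ _).mpr (by rw [add_comm]; exact h)), ad_mem h2 x β w hβ hx⟩
  have hsq : ∀ u v : D, u * x = x * u + u → v * x = x * v + v → u * v * x = x * (u * v) := by
    intro u v hu hv
    rw [mul_assoc, hv, mul_add, ← mul_assoc, hu, add_mul, add_assoc, ct_add h2, add_zero, mul_assoc]
  have hCu : ∀ c u : D, c * x = x * c → u * x = x * u + u → c * u * x = x * (c * u) + c * u := by
    intro c u hc hu
    rw [mul_assoc, hu, mul_add, ← mul_assoc, hc, mul_assoc]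
  have hne : ∀ u : D, u ≠ 0 → u * x = x * u + u → u * x ≠ x * u := by
    intro u hu h h'
    rw [h] at h'
    exact hu (by simpa using h')
  have h4 : ∀ u : D, u * x = x * u + u → Cn K (u * u * (u * u)) := by
    intro u hu
    by_cases hu0 : u = 0
    · rw [hu0]; simpa using Cn.zero
    have hQ := isQ_of_comm (K := K) h16 (u * u) u x (by noncomm_ring) (hsq u u hu hu).symm (hne u hu0 hu)
    obtain ⟨s, t, hs, ht, h⟩ := (isQ_iff _).mp hQ
    by_cases hC : Cn K (u * u)
    · exact hC.mul hC
    by_cases hs0 : s = 0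
    · rw [h, hs0]; simpa using ht
    exfalso
    have hyC : ¬ Cn K (s⁻¹ * (u * u)) := fun hh => hC (by
      have := hs.mul hh
      rwa [mul_inv_cancel_left₀ hs0] at this)
    refine hcon ⟨s⁻¹ * (u * u), ?_, hyC, ?_, s⁻¹ * s⁻¹ * t, (hs.inv.mul hs.inv).mul ht, ?_⟩
    · rw [mul_assoc, hsq u u hu hu, ← mul_assoc, hs.inv.comm x, mul_assoc]
    · intro hh
      have h1 := hh.comm u
      have h3 : s⁻¹ * (u * u) * u = u * (s⁻¹ * (u * u)) := by
        rw [← mul_assoc u, ← hs.inv.comm u]; noncomm_ring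
      rw [add_mul, mul_add, h3] at h1
      exact hne u hu0 hu (add_right_cancel h1).symm
    · have : s⁻¹ * (u * u) * (s⁻¹ * (u * u)) = s⁻¹ * s⁻¹ * (u * u * (u * u)) := by
        rw [mul_assoc, ← mul_assoc (u * u), ← hs.inv.comm (u * u)]; simp only [mul_assoc]
      rw [this, h, mul_add, mul_assoc s⁻¹ s⁻¹ (s * _), inv_mul_cancel_left₀ hs0]
  have hP := polar h2 hK (fun u => u * x = x * u + u)
    (fun u v hu hv => by simp only [add_mul, mul_add, hu, hv]; abel)
    (fun k u hu => hCu _ _ (Algebra.commutes k x) hu) h4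
  -- θ
  have hθx : ∀ u : D, u ≠ 0 → u * x = x * u + u → u * x * u⁻¹ = x + 1 := by
    intro u hu0 hu
    rw [hu, add_mul, mul_inv_cancel_right₀ hu0, mul_inv_cancel₀ hu0]
  have hui : ∀ u : D, u ≠ 0 → u * x = x * u + u → u⁻¹ * x = x * u⁻¹ + u⁻¹ := by
    intro u hu0 hu
    have h1 : u * (u⁻¹ * x) = u * (x * u⁻¹ + u⁻¹) := by
      rw [mul_inv_cancel_left₀ hu0, mul_add, ← mul_assoc, hθx u hu0 hu, mul_inv_cancel₀ hu0, add_assoc, ct_add h2, add_zero]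
    exact mul_left_cancel₀ hu0 h1
  have hgen : ∀ u : D, u ≠ 0 → u * x = x * u + u → ∀ z, ∃ c c', c * x = x * c ∧ c' * x = x * c' ∧ z = c + c' * u := by
    intro u hu0 hu z
    refine ⟨z + (x * z + z * x), (x * z + z * x) * u⁻¹, ad_mem' h2 x β z hβ hx, hsq _ _ (ad_mem h2 x β z hβ hx) (hui u hu0 hu), ?_⟩
    rw [inv_mul_cancel_right₀ hu0, add_assoc, ct_add h2, add_zero]
  have hθC : ∀ u : D, u ≠ 0 → u * x = x * u + u → ∀ c, c * x = x * c → u * c * u⁻¹ * x = x * (u * c * u⁻¹) := by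
    intro u hu0 hu c hc
    rw [mul_assoc u]
    exact hsq _ _ hu (hCu _ _ hc (hui u hu0 hu))
  have hθm : ∀ u : D, u ≠ 0 → ∀ c d, u * (c * d) * u⁻¹ = (u * c * u⁻¹) * (u * d * u⁻¹) := by
    intro u hu0 c d
    simp only [mul_assoc, inv_mul_cancel_left₀ hu0]
  -- first: squares are central
  have hs2 : ∀ u : D, u * x = x * u + u → Cn K (u * u) := by
    intro u hu
    by_cases hu0 : u = 0
    · rw [hu0]; simpa using Cn.zero
    have hu4 : u * u * (u * u) ≠ 0 := by simp [hu0]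
    have θx := hθx u hu0 hu
    obtain ⟨θ, hθ⟩ : ∃ θ : D → D, ∀ c, θ c = u * c * u⁻¹ := ⟨_, fun _ => rfl⟩
    have hT : ∀ c, c * x = x * c → Cn K (θ (θ (θ c)) + θ (θ c) + θ c + c) := by
      intro c hc
      have h1 := (hP u (c * u) hu (hCu c u hc hu)).mul (h4 u hu).inv
      convert h1 using 1
      rw [eq_mul_inv_iff_mul_eq₀ hu4]
      simp only [hθ, mul_add, add_mul, mul_assoc, inv_mul_cancel_left₀ hu0]
      abel
    have hN : ∀ c, c * x = x * c → ∃ k l, Cn K k ∧ Cn K l ∧ c + θ (θ c) = k + l * x := by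
      intro c hc
      have h1 := hT c hc
      have h3 := hT (x * c) (by rw [mul_assoc, hc])
      have m : ∀ d, θ (x * d) = (x + 1) * θ d := fun d => by rw [hθ, hθm u hu0, θx, hθ]
      have m' : ∀ d, θ ((x + 1) * d) = x * θ d := fun d => by
        rw [hθ, hθm u hu0, mul_add, add_mul, θx, mul_one, mul_inv_cancel₀ hu0, add_assoc, ct_add h2, add_zero, hθ]
      rw [m, m', m] at h3
      refine ⟨_, _, h1.add h3, h1, ?_⟩
      rw [h1.comm x]
      rw [ct_iff h2]
      simp only [mul_add, add_mul, one_mul]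
      abel_nf
      simp only [n2 h2, n4 h2, z2 h2, z4 h2, add_zero, zero_add]
    obtain ⟨w, hw⟩ : ∃ w, w = u * u := ⟨_, rfl⟩
    have hw0 : w ≠ 0 := by rw [hw]; simp [hu0]
    have hwx : w * x = x * w := hw ▸ hsq u u hu hu
    have hθ2 : ∀ c, θ (θ c) = w * c * w⁻¹ := by
      intro c; rw [hθ, hθ, hw, mul_inv_rev]; simp only [mul_assoc]
    have hwC : ∀ c, c * x = x * c → c * w = w * c := by
      intro c hc
      obtain ⟨k, l, hk, hl, h⟩ := hN c hc
      obtain ⟨k', l', hk', hl', h'⟩ := hN (c * w) (by rw [mul_assoc, hwx, ← mul_assoc, hc, mul_assoc])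
      rw [hθ2] at h h'
      rw [← mul_assoc, mul_inv_cancel_right₀ hw0] at h'
      have h3 : (k + l * x) * w = c * w + w * c := by
        rw [← h, add_mul, inv_mul_cancel_right₀ hw0]
      obtain ⟨n, hn⟩ : ∃ n, n = k + l * x := ⟨_, rfl⟩
      have hnc : ∀ k l, Cn K k → Cn K l → (k + l * x) * c = c * (k + l * x) := by
        intro k l hk hl
        rw [add_mul, mul_add, hk.comm, mul_assoc, ← hc, ← mul_assoc, hl.comm, mul_assoc]
      have hn1 : n * c = c * n := hn ▸ hnc k l hk hl
      have hn2 : n * w * c = c * (n * w) := by rw [hn, h3, h']; exact hnc k' l' hk' hl'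
      rw [← hn] at h3
      have h5 : n * (n * w) = 0 := by
        rw [h3, mul_add, ← mul_assoc, ← mul_assoc, hn1, mul_assoc, ← hn2, ct_add h2]
      have hn0 : n = 0 := by simpa [hw0] using h5
      rw [hn0, zero_mul] at h3
      rw [ct_iff h2, ← h3]
    rw [← hw]
    refine Cn.of_comm fun z => ?_
    obtain ⟨c, c', hc, hc', rfl⟩ := hgen u hu0 hu z
    rw [add_mul, mul_add, hwC c hc, ← mul_assoc w, ← hwC c' hc', mul_assoc, mul_assoc, hw]
    simp only [mul_assoc]
  obtain ⟨u, hu0, hu⟩ := hA0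
  have θx := hθx u hu0 hu
  have huu : u * u ≠ 0 := by simp [hu0]
  have hcc : ∀ c, c * x = x * c → Cn K (c * (u * c * u⁻¹)) := by
    intro c hc
    have h1 := (hs2 _ (hCu c u hc hu)).mul (hs2 u hu).inv
    convert h1 using 1
    rw [eq_mul_inv_iff_mul_eq₀ huu]
    simp only [mul_assoc, inv_mul_cancel_left₀ hu0]
  have htr : ∀ c, c * x = x * c → Cn K (c + u * c * u⁻¹) := by
    intro c hc
    have h1 := ((hcc (c + 1) (by rw [add_mul, mul_add, hc]; simp)).add (hcc c hc)).add Cn.one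
    convert h1 using 1
    rw [ct_iff h2]
    simp only [mul_add, add_mul, one_mul, mul_one, mul_inv_cancel₀ hu0]
    abel_nf
    simp only [n2 h2, n4 h2, z2 h2, z4 h2, add_zero, zero_add]
  have hCN : ∀ c, c * x = x * c → ∃ k l : K, c = algebraMap K D k + algebraMap K D l * x := by
    intro c hc
    have h1 := htr c hc
    have h3 := htr (x * c) (by rw [mul_assoc, hc])
    rw [hθm u hu0, θx] at h3
    obtain ⟨k, hk⟩ := h1.add h3
    obtain ⟨l, hl⟩ := h1
    refine ⟨k, l, ?_⟩
    rw [← hk, ← hl, (htr c hc).comm, ct_iff h2]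
    simp only [mul_add, add_mul, one_mul, mul_one]
    abel_nf
    simp only [n2 h2, n4 h2, z2 h2, z4 h2, add_zero, zero_add]
  have hspan : (⊤ : Submodule K D) ≤ Submodule.span K (Set.range ![1, x, u, x * u]) := by
    intro z _
    obtain ⟨c, c', hc, hc', rfl⟩ := hgen u hu0 hu z
    obtain ⟨k, l, rfl⟩ := hCN c hc
    obtain ⟨k', l', rfl⟩ := hCN c' hc'
    have m : ∀ i, ![1, x, u, x * u] i ∈ Submodule.span K (Set.range ![1, x, u, x * u]) := fun i => Submodule.subset_span ⟨i, rfl⟩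
    have m0 := m 0
    have m1 := m 1
    have m2 := m 2
    have m3 := m 3
    simp only [Matrix.cons_val] at m0 m1 m2 m3
    rw [add_mul, mul_assoc, ← Algebra.smul_def, ← Algebra.smul_def, ← Algebra.smul_def, Algebra.algebraMap_eq_smul_one]
    exact add_mem (add_mem (Submodule.smul_mem _ _ m0) (Submodule.smul_mem _ _ m1)) (add_mem (Submodule.smul_mem _ _ m2) (Submodule.smul_mem _ _ m3))
  have h5 := finrank_range_le_card (R := K) ![1, x, u, x * u]
  rw [Set.finrank, top_le_iff.mp hspan, finrank_top, h16] at h5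
  simp at h5
end


/-- biquadratic data from a representation -/
def mkBiq {K L : Type*} [Field K] [Field L] [Algebra K L] (two : (2 : L) = 0) (x y : L) (σ τ : L →ₐ[K] L)
    (σx : σ x = x + 1) (σy : σ y = y) (τx : τ x = x) (τy : τ y = y + 1)
    (rep : ∀ l, ∃ a b c d : K, l = algebraMap K L a + algebraMap K L b * x + algebraMap K L c * y + algebraMap K L d * (x * y)) : Biq K L where
  two := two
  x := x
  y := y
  σ := σ
  τ := τ
  σx := σx
  σy := σy
  τx := τx
  τy := τy
  σσ l := by
    obtain ⟨a, b, c, d, rfl⟩ := rep l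
    simp only [map_add, map_mul, AlgHom.commutes, σx, σy, τx, τy, map_one]
    linear_combination (algebraMap K L b + algebraMap K L d * y) * two
  ττ l := by
    obtain ⟨a, b, c, d, rfl⟩ := rep l
    simp only [map_add, map_mul, AlgHom.commutes, σx, σy, τx, τy, map_one]
    linear_combination (algebraMap K L c + algebraMap K L d * x) * two
  στ l := by
    obtain ⟨a, b, c, d, rfl⟩ := rep l
    simp only [map_add, map_mul, AlgHom.commutes, σx, σy, τx, τy, map_one]
  fix l h1 h2 := by
    obtain ⟨a, b, c, d, rfl⟩ := rep l
    have h3 : algebraMap K L b + algebraMap K L d * y = 0 := by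
      simp only [map_add, map_mul, AlgHom.commutes, σx, σy, τx, τy, map_one] at h1
      linear_combination h1
    have h4 : algebraMap K L c + algebraMap K L d * x = 0 := by
      simp only [map_add, map_mul, AlgHom.commutes, σx, σy, τx, τy, map_one] at h2
      linear_combination h2
    have h5 := congrArg τ h3
    simp only [map_add, map_mul, AlgHom.commutes, σx, σy, τx, τy, map_one, map_zero] at h5
    have h6 : algebraMap K L d = 0 := by linear_combination h5 - h3
    exact ⟨a, by rw [h6] at h3 h4 ⊢; linear_combination -h3 * x - h4 * y⟩

section
variable {K : Type*} {D : Type u} [Field K] [DivisionRing D] [Algebra K D]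

theorem mk_hom {M : Type*} [Field M] [Algebra K M] (i : M →ₐ[K] D) (u : D) (hu : u ≠ 0)
    (h : ∀ m, ∃ m', u * i m = i m' * u) : ∃ σ : M →ₐ[K] M, ∀ m, u * i m = i (σ m) * u := by
  choose f hf using h
  have inj : ∀ m m', i m * u = i m' * u → m = m' := fun m m' h => i.toRingHom.injective (mul_right_cancel₀ hu h)
  refine ⟨AlgHom.mk' ⟨⟨⟨f, ?_⟩, ?_⟩, ?_, ?_⟩ ?_, hf⟩
  · refine inj _ _ ?_
    rw [← hf]; simp
  · intro a b
    refine inj _ _ ?_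
    rw [← hf, map_mul, map_mul, mul_assoc, ← hf b, ← mul_assoc, hf a, mul_assoc]
  · refine inj _ _ ?_
    simp [← hf]
  · intro a b
    refine inj _ _ ?_
    simp only
    rw [← hf, map_add, map_add, mul_add, hf a, hf b, add_mul]
  · intro c a
    refine inj _ _ ?_
    simp only [RingHom.coe_mk, MonoidHom.coe_mk, OneHom.coe_mk]
    rw [← hf, map_smul, map_smul, mul_smul_comm, hf a, smul_mul_assoc]

section
variable (h2 : (2 : D) = 0)
include h2

theorem pick [Algebra.IsCentral K D] (x y β γ : D) (hβ : Cn K β) (hx : x * x = x + β) (hγ : Cn K γ) (hy : y * y = y + γ)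
    (hxy : y * x = x * y) (hxC : ¬ Cn K x) :
    ∃ u, u ≠ 0 ∧ u * x = x * u + u ∧ (u * y = y * u ∨ u * y = y * u + u) := by
  obtain ⟨w, hw⟩ := exists_not_comm hxC
  obtain ⟨p, hp⟩ : ∃ p, p = x * w + w * x := ⟨_, rfl⟩
  have hp0 : p ≠ 0 := fun h => hw ((ct_iff h2 _ _).mpr (by rw [add_comm, ← hp, h]))
  have hpx : p * x = x * p + p := hp ▸ ad_mem h2 x β w hβ hx
  by_cases hq : y * p + p * y = 0
  · exact ⟨p, hp0, hpx, Or.inl ((ct_iff h2 _ _).mpr (by rw [add_comm, hq]))⟩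
  · refine ⟨_, hq, ?_, Or.inr (ad_mem h2 y γ p hγ hy)⟩
    rw [add_mul, mul_assoc, hpx, mul_assoc, hxy, ← mul_assoc, hpx, mul_add, ← mul_assoc, hxy]
    simp only [add_mul, mul_add, mul_assoc]
    abel

theorem pick_uv [Algebra.IsCentral K D] (x y β γ : D) (hβ : Cn K β) (hx : x * x = x + β) (hγ : Cn K γ) (hy : y * y = y + γ)
    (hxy : y * x = x * y) (hxC : ¬ Cn K x) (hyC : ¬ Cn K y) (hxyC : ¬ Cn K (x + y)) :
    (∃ u, u ≠ 0 ∧ u * x = x * u + u ∧ u * y = y * u) ∧ ∃ v, v ≠ 0 ∧ v * x = x * v ∧ v * y = y * v + v := by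
  have pr : ∀ u v x : D, u * x = x * u + u → v * x = x * v + v → u * v * x = x * (u * v) := by
    intro u v x hu hv
    rw [mul_assoc, hv, mul_add, ← mul_assoc, hu, add_mul, add_assoc, ct_add h2, add_zero, mul_assoc]
  have pr' : ∀ u v x : D, u * x = x * u + u → v * x = x * v → u * v * x = x * (u * v) + u * v := by
    intro u v x hu hv
    rw [mul_assoc, hv, ← mul_assoc, hu, add_mul, mul_assoc]
  have pr'' : ∀ u v x : D, u * x = x * u → v * x = x * v + v → u * v * x = x * (u * v) + u * v := by
    intro u v x hu hv
    rw [mul_assoc, hv, mul_add, ← mul_assoc, hu, mul_assoc]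
  have hz : (x + y) * (x + y) = (x + y) + (β + γ) := by
    rw [mul_add, add_mul, add_mul, hx, hy, hxy, ct_iff h2]
    abel_nf
    simp only [n2 h2, n4 h2, z2 h2, z4 h2, add_zero, zero_add]
  obtain ⟨p, hp0, hpx, hpy⟩ := pick h2 x y β γ hβ hx hγ hy hxy hxC
  obtain ⟨q, hq0, hqy, hqx⟩ := pick h2 y x γ β hγ hy hβ hx hxy.symm hyC
  obtain ⟨r, hr0, hrxy, hry⟩ := pick h2 (x + y) y _ _ (hβ.add hγ) hz hγ hy (by rw [mul_add, add_mul, hxy]) hxyC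
  have hrr : (r * x = x * r + r ∧ r * y = y * r) ∨ (r * x = x * r ∧ r * y = y * r + r) := by
    rw [mul_add, add_mul] at hrxy
    rcases hry with h | h
    · refine Or.inl ⟨?_, h⟩
      rw [h] at hrxy
      refine add_right_cancel (b := y * r) ?_
      rw [hrxy]; abel
    · refine Or.inr ⟨?_, h⟩
      rw [h] at hrxy
      refine add_right_cancel (b := y * r + r) ?_
      rw [hrxy]; abel
  rcases hpy with hpy | hpy <;> rcases hqx with hqx | hqx
  · exact ⟨⟨p, hp0, hpx, hpy⟩, q, hq0, hqx, hqy⟩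
  · exact ⟨⟨p, hp0, hpx, hpy⟩, p * q, mul_ne_zero hp0 hq0, pr _ _ _ hpx hqx, pr'' _ _ _ hpy hqy⟩
  · exact ⟨⟨p * q, mul_ne_zero hp0 hq0, pr' _ _ _ hpx hqx, pr _ _ _ hpy hqy⟩, q, hq0, hqx, hqy⟩
  · rcases hrr with ⟨hrx, hry⟩ | ⟨hrx, hry⟩
    · exact ⟨⟨r, hr0, hrx, hry⟩, p * r, mul_ne_zero hp0 hr0, pr _ _ _ hpx hrx, pr' _ _ _ hpy hry⟩
    · exact ⟨⟨p * r, mul_ne_zero hp0 hr0, pr' _ _ _ hpx hrx, pr _ _ _ hpy hry⟩, r, hr0, hrx, hry⟩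


theorem pick_nc (x y γ u : D) (hγ : Cn K γ) (hy : y * y = y + γ) (hxy : y * x = x * y) (hyC : ¬ Cn K y)
    (hu0 : u ≠ 0) (hux : u * x = x * u + u) (huy : u * y = y * u) :
    ∃ u, u ≠ 0 ∧ u * x = x * u + u ∧ u * y = y * u ∧ ¬ Cn K (u * u) := by
  by_cases h : Cn K (u * u)
  · have hy0 : y ≠ 0 := fun h => hyC (h ▸ Cn.zero)
    refine ⟨y * u, mul_ne_zero hy0 hu0, ?_, ?_, fun hc => hyC ?_⟩
    · rw [mul_assoc, hux, mul_add, ← mul_assoc, hxy, mul_assoc]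
    · rw [mul_assoc, huy]
    · have e : y * u * (y * u) = y * y * (u * u) := by rw [mul_assoc, ← mul_assoc u, huy]; simp only [mul_assoc]
      rw [e] at hc
      have h1 := hc.mul h.inv
      rw [mul_inv_cancel_right₀ (mul_ne_zero hu0 hu0), hy] at h1
      obtain ⟨k, hk⟩ := h1
      obtain ⟨l, rfl⟩ := hγ
      exact ⟨k - l, by rw [map_sub, ← hk]; abel⟩
  · exact ⟨u, hu0, hux, huy, h⟩

theorem cent_rep [Algebra.IsCentral K D] (h16 : Module.finrank K D = 16) (x y u v : D) (hxy : y * x = x * y)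
    (hu0 : u ≠ 0) (hux : u * x = x * u + u) (huy : u * y = y * u)
    (hv0 : v ≠ 0) (hvx : v * x = x * v) (hvy : v * y = y * v + v) (p : D) (hpx : p * x = x * p) (hpy : p * y = y * p) :
    ∃ a b c d : K, p = algebraMap K D a + algebraMap K D b * x + algebraMap K D c * y + algebraMap K D d * (x * y) := by
  have : FiniteDimensional K D := Module.finite_of_finrank_pos (by omega)
  have ind : LinearIndependent K ![(1 : D), x, y, x * y] := by
    rw [Fintype.linearIndependent_iff]
    intro g hg
    simp only [Fin.sum_univ_four, Matrix.cons_val] at hg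
    have e1 : (g 1 • (1 : D) + g 3 • y) * u = 0 := by
      have h := congrArg (fun z => u * z + z * u) hg
      simp only [mul_zero, zero_mul, add_zero] at h
      rw [← h]
      simp only [mul_add, add_mul, mul_smul_comm, smul_mul_assoc, ← mul_assoc u x, hux, huy, mul_one, one_mul, smul_add, mul_assoc]
      rw [ct_iff h2]
      abel_nf
      simp only [n2 h2, n4 h2, z2 h2, z4 h2, add_zero, zero_add]
    have e2 : (g 2 • (1 : D) + g 3 • x) * v = 0 := by
      have h := congrArg (fun z => v * z + z * v) hg
      simp only [mul_zero, zero_mul, add_zero] at h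
      rw [← h]
      simp only [mul_add, add_mul, mul_smul_comm, smul_mul_assoc, ← mul_assoc v x, hvx, hvy, mul_one, one_mul, smul_add, mul_assoc]
      rw [ct_iff h2]
      abel_nf
      simp only [n2 h2, n4 h2, z2 h2, z4 h2, add_zero, zero_add]
    have e1' := (mul_eq_zero.mp e1).resolve_right hu0
    have e2' := (mul_eq_zero.mp e2).resolve_right hv0
    have e3 : g 3 • v = 0 := by
      have h := congrArg (fun z => v * z + z * v) e1'
      simp only [mul_zero, zero_mul, add_zero] at h
      rw [← h]
      simp only [mul_add, add_mul, mul_smul_comm, smul_mul_assoc, hvy, mul_one, one_mul, smul_add]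
      rw [ct_iff h2]
      abel_nf
      simp only [n2 h2, n4 h2, z2 h2, z4 h2, add_zero, zero_add]
    have g3 : g 3 = 0 := (smul_eq_zero.mp e3).resolve_right hv0
    simp only [g3, zero_smul, add_zero, smul_eq_zero, one_ne_zero, or_false] at e1' e2'
    simp only [g3, e1', e2', zero_smul, add_zero, smul_eq_zero, one_ne_zero, or_false] at hg
    intro i
    fin_cases i <;> assumption
  have hcomm : ∀ a ∈ Algebra.adjoin K {x, y, p}, ∀ b ∈ Algebra.adjoin K {x, y, p}, a * b = b * a := by
    intro a ha b hb
    refine Algebra.commute_of_mem_adjoin_of_forall_mem_commute hb fun c hc => ?_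
    refine (Algebra.commute_of_mem_adjoin_of_forall_mem_commute ha fun d hd => ?_).symm
    rcases hc with rfl | rfl | rfl <;> rcases hd with rfl | rfl | rfl <;> first | rfl | assumption | (symm; assumption)
  have hle := finrank_comm_le h16 _ hcomm
  have hx : x ∈ Algebra.adjoin K {x, y, p} := Algebra.subset_adjoin (by simp)
  have hy : y ∈ Algebra.adjoin K {x, y, p} := Algebra.subset_adjoin (by simp)
  have hp : p ∈ Algebra.adjoin K {x, y, p} := Algebra.subset_adjoin (by simp)
  have hs : Submodule.span K (Set.range ![(1 : D), x, y, x * y]) ≤ Subalgebra.toSubmodule (Algebra.adjoin K {x, y, p}) := by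
    rw [Submodule.span_le]
    rintro _ ⟨i, rfl⟩
    fin_cases i
    exacts [(Algebra.adjoin K {x, y, p}).one_mem, hx, hy, (Algebra.adjoin K {x, y, p}).mul_mem hx hy]
  have heq := Submodule.eq_of_le_of_finrank_le hs (by rw [finrank_span_eq_card ind]; simpa using hle)
  have hp' : p ∈ Submodule.span K (Set.range ![(1 : D), x, y, x * y]) := by rw [heq]; exact hp
  rw [Submodule.mem_span_range_iff_exists_fun] at hp'
  obtain ⟨g, hg⟩ := hp'
  simp only [Fin.sum_univ_four, Matrix.cons_val] at hg
  exact ⟨g 0, g 1, g 2, g 3, by simp only [← hg, Algebra.smul_def, mul_one]⟩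

theorem exists_CP [Algebra.IsCentral K D] (h16 : Module.finrank K D = 16) :
    ∃ (M : Type u) (_ : Field M) (_ : Algebra K M) (S : Biq K M) (P : CP S D), S.τ P.b₁ ≠ P.b₁ ∧ S.σ P.b₂ ≠ P.b₂ := by
  have : FiniteDimensional K D := Module.finite_of_finrank_pos (by omega)
  obtain ⟨x, hxC, β, hβ, hx⟩ := exists_as (K := K) h2 h16
  obtain ⟨y, hxy, hyC, hxyC, γ, hγ, hy⟩ := exists_y h2 h16 x hxC β hβ hx
  obtain ⟨⟨u, hu0, hux, huy⟩, v, hv0, hvx, hvy⟩ := pick_uv h2 x y β γ hβ hx hγ hy hxy hxC hyC hxyC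
  obtain ⟨u, hu0, hux, huy, huC⟩ := pick_nc h2 x y γ u hγ hy hxy hyC hu0 hux huy
  obtain ⟨v, hv0, hvy, hvx, hvC⟩ := pick_nc h2 y x β v hβ hx hxy.symm hxC hv0 hvy hvx
  have rep := cent_rep (K := K) h2 h16 x y u v hxy hu0 hux huy hv0 hvx hvy
  have mem : ∀ p, p ∈ Subalgebra.centralizer K {x, y} ↔ p * x = x * p ∧ p * y = y * p := by
    intro p
    rw [Subalgebra.mem_centralizer_iff]
    exact ⟨fun h => ⟨(h x (by simp)).symm, (h y (by simp)).symm⟩, fun h g hg => by rcases hg with rfl | rfl; exacts [h.1.symm, h.2.symm]⟩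
  obtain ⟨M, _, _, i, hi⟩ := exists_field' (Subalgebra.centralizer K {x, y}) (by
    intro a ha b hb
    rw [mem] at ha hb
    obtain ⟨k, l, m, n, rfl⟩ := rep a ha.1 ha.2
    refine Commute.add_left (Commute.add_left (Commute.add_left (Algebra.commutes _ _) ?_) ?_) ?_
    · exact Commute.mul_left (Algebra.commutes _ _) hb.1.symm
    · exact Commute.mul_left (Algebra.commutes _ _) hb.2.symm
    · exact Commute.mul_left (Algebra.commutes _ _) (Commute.mul_left hb.1.symm hb.2.symm))
  have inj : Function.Injective i := i.toRingHom.injective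
  have ex : ∀ p, p * x = x * p → p * y = y * p → ∃ m, i m = p := by
    intro p h1 h2
    have : p ∈ i.range := by rw [hi, mem]; exact ⟨h1, h2⟩
    exact this
  have im : ∀ m, i m * x = x * i m ∧ i m * y = y * i m := by
    intro m
    rw [← mem, ← hi]
    exact ⟨m, rfl⟩
  obtain ⟨x', hx'⟩ := ex x rfl hxy.symm
  obtain ⟨y', hy'⟩ := ex y hxy rfl
  have two : (2 : M) = 0 := inj (by rw [map_ofNat, map_zero, h2])
  have sux : SemiconjBy u x (x + 1) := by rw [SemiconjBy, hux, add_mul, one_mul]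
  have svy : SemiconjBy v y (y + 1) := by rw [SemiconjBy, hvy, add_mul, one_mul]
  have suy : SemiconjBy u y y := huy
  have svx : SemiconjBy v x x := hvx
  have sux' : SemiconjBy u (x + 1) x := by
    have := sux.add_right (SemiconjBy.one_right u)
    rwa [add_assoc, ct_add h2, add_zero] at this
  have svy' : SemiconjBy v (y + 1) y := by
    have := svy.add_right (SemiconjBy.one_right v)
    rwa [add_assoc, ct_add h2, add_zero] at this
  obtain ⟨σ, hσ⟩ := mk_hom i u hu0 (fun m => by
    have h1 : SemiconjBy (u * i m * u⁻¹) x x := (sux'.mul_left (SemiconjBy.add_right (im m).1 (SemiconjBy.one_right _))).mul_left sux'.inv_symm_left₀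
    have h3 : SemiconjBy (u * i m * u⁻¹) y y := (suy.mul_left (im m).2).mul_left suy.inv_symm_left₀ 
    obtain ⟨m', hm'⟩ := ex _ h1 h3
    exact ⟨m', by rw [hm', inv_mul_cancel_right₀ hu0]⟩)
  obtain ⟨τ, hτ⟩ := mk_hom i v hv0 (fun m => by
    have h1 : SemiconjBy (v * i m * v⁻¹) x x := (svx.mul_left (im m).1).mul_left svx.inv_symm_left₀ 
    have h3 : SemiconjBy (v * i m * v⁻¹) y y := (svy'.mul_left (SemiconjBy.add_right (im m).2 (SemiconjBy.one_right _))).mul_left svy'.inv_symm_left₀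
    obtain ⟨m', hm'⟩ := ex _ h1 h3
    exact ⟨m', by rw [hm', inv_mul_cancel_right₀ hv0]⟩)
  have σx : σ x' = x' + 1 := inj (mul_right_cancel₀ hu0 (by rw [← hσ, map_add, hx', map_one]; exact sux))
  have σy : σ y' = y' := inj (mul_right_cancel₀ hu0 (by rw [← hσ, hy']; exact suy))
  have τx : τ x' = x' := inj (mul_right_cancel₀ hv0 (by rw [← hτ, hx']; exact svx))
  have τy : τ y' = y' + 1 := inj (mul_right_cancel₀ hv0 (by rw [← hτ, map_add, hy', map_one]; exact svy))
  obtain ⟨S, hSσ, hSτ⟩ : ∃ S : Biq K M, S.σ = σ ∧ S.τ = τ := ⟨mkBiq two x' y' σ τ σx σy τx τy (fun l => by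
    obtain ⟨a, b, c, d, h⟩ := rep (i l) (im l).1 (im l).2
    exact ⟨a, b, c, d, inj (by rw [h]; simp only [map_add, map_mul, AlgHom.commutes, hx', hy'])⟩), rfl, rfl⟩
  obtain ⟨b₁, hb₁⟩ := ex (u * u) (sux'.mul_left sux) (suy.mul_left suy)
  obtain ⟨b₂, hb₂⟩ := ex (v * v) (svx.mul_left svx) (svy'.mul_left svy)
  have sx1' : SemiconjBy (v * u) (x + 1) x := svx.mul_left sux'
  have sy1' : SemiconjBy (v * u) (y + 1) y := svy'.mul_left (suy.add_right (SemiconjBy.one_right u))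
  have sx2' : SemiconjBy (u * v) (x + 1) x := sux'.mul_left (svx.add_right (SemiconjBy.one_right v))
  have sy2' : SemiconjBy (u * v) (y + 1) y := suy.mul_left svy'
  obtain ⟨c, hc⟩ := ex (v * u * (u * v)⁻¹) (sx1'.mul_left sx2'.inv_symm_left₀) (sy1'.mul_left sy2'.inv_symm_left₀)
  have hn1 := mul_ne_zero hu0 hu0
  have hn2 := mul_ne_zero hv0 hv0
  refine ⟨M, inferInstance, inferInstance, S, ⟨i, u, v, b₁, b₂, c, ?_, ?_, hSσ ▸ hσ, hSτ ▸ hτ, hb₁.symm, hb₂.symm, ?_⟩, ?_, ?_⟩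
  · rintro rfl; exact hn1 (by rw [← hb₁, map_zero])
  · rintro rfl; exact hn2 (by rw [← hb₂, map_zero])
  · rw [hc, inv_mul_cancel_right₀ (mul_ne_zero hu0 hv0)]
  · intro h
    obtain ⟨k, hk⟩ := S.fix b₁ (by
      rw [hSσ]
      exact inj (mul_right_cancel₀ hu0 (by rw [← hσ, hb₁, mul_assoc]))) h
    exact huC ⟨k, by rw [← hb₁, ← hk, AlgHom.commutes]⟩
  · intro h
    obtain ⟨k, hk⟩ := S.fix b₂ h (by
      rw [hSτ]
      exact inj (mul_right_cancel₀ hv0 (by rw [← hτ, hb₂, mul_assoc])))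
    exact hvC ⟨k, by rw [← hb₂, ← hk, AlgHom.commutes]⟩
end
end


theorem final_descent {F K L R : Type u} [Field F] [Field K] [Field L] [Ring R] [Nontrivial R] [Algebra F K] [Algebra K L]
    [Algebra F L] [IsScalarTower F K L] [Algebra K R] (S : Biq K L) (P : CP S R) (h16 : Module.finrank K R = 16)
    (h1 : S.τ P.b₁ ≠ P.b₁) (h2 : S.σ P.b₂ ≠ P.b₂) : ∃ E : IntermediateField F K, TrdegLE F E 5 ∧
      ∃ (B : Type u) (_ : Ring B) (_ : Algebra E B),
        Module.finrank E B = 16 ∧ Algebra.IsCentral E B ∧ IsSimpleRing B ∧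
        Nonempty ((K ⊗[E] B) ≃ₐ[K] R) := by
  obtain ⟨D, u, v, b₁, b₂, c, hb₁, hb₂, hu, hv, huu, hvv, hvu⟩ := P
  simp only at h1 h2
  have two := S.two
  have inj : Function.Injective D := D.toRingHom.injective
  have cu : ∀ l m, D l * u = D m * u → l = m := by
    intro l m h
    have h := congrArg (· * u) h
    simp only [mul_assoc, huu, ← map_mul] at h
    exact mul_right_cancel₀ hb₁ (inj h)
  have cv : ∀ l m, D l * v = D m * v → l = m := by
    intro l m h
    have h := congrArg (· * v) h
    simp only [mul_assoc, hvv, ← map_mul] at h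
    exact mul_right_cancel₀ hb₂ (inj h)
  have σb : S.σ b₁ = b₁ := cu _ _ (by rw [← hu, ← huu, mul_assoc])
  have τb : S.τ b₂ = b₂ := cv _ _ (by rw [← hv, ← hvv, mul_assoc])
  have r1 : S.τ b₁ = c * S.σ c * b₁ := cv _ _ (by
    rw [← hv, ← huu, ← mul_assoc, hvu, mul_assoc, mul_assoc, hvu, ← mul_assoc u, hu, map_mul, map_mul, ← huu]
    simp only [mul_assoc])
  have r2 : b₂ = S.τ c * c * S.σ b₂ := cu _ _ (by
    rw [← hvv, mul_assoc, hvu, ← mul_assoc, hv, mul_assoc, ← mul_assoc v, hvu, mul_assoc, mul_assoc, hvv, hu]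
    simp only [map_mul, mul_assoc])
  have hc : c ≠ 0 := by
    rintro rfl
    exact hb₂ (by rw [r2]; simp)
  have hσb : S.σ b₂ ≠ 0 := fun h => hb₂ (by rw [r2, h, mul_zero])
  have σc : S.σ c = S.τ b₁ / (c * b₁) := by rw [r1]; field_simp
  have τc : S.τ c = b₂ / (c * S.σ b₂) := by rw [eq_div_iff (mul_ne_zero hc hσb)]; rw [← mul_assoc]; exact r2.symm
  obtain ⟨L0, hL0⟩ : ∃ L0, L0 = IntermediateField.adjoin F ({b₁, S.τ b₁, b₂, S.σ b₂, c} : Set L) := ⟨_, rfl⟩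
  have sub : ({b₁, S.τ b₁, b₂, S.σ b₂, c} : Set L) ⊆ L0 := hL0 ▸ IntermediateField.subset_adjoin F _
  have m1 : b₁ ∈ L0 := sub (by simp)
  have m2 : S.τ b₁ ∈ L0 := sub (by simp)
  have m3 : b₂ ∈ L0 := sub (by simp)
  have m4 : S.σ b₂ ∈ L0 := sub (by simp)
  have m5 : c ∈ L0 := sub (by simp)
  have σL : ∀ l ∈ L0, S.σ l ∈ L0 := by
    have : L0 ≤ L0.comap (S.σ.restrictScalars F) := by
      conv_lhs => rw [hL0]
      rw [IntermediateField.adjoin_le_iff]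
      rintro l (rfl | rfl | rfl | rfl | rfl)
      · exact (σb.symm ▸ m1 : S.σ l ∈ L0)
      · exact (by rw [← S.στ, σb]; exact m2 : S.σ (S.τ b₁) ∈ L0)
      · exact m4
      · exact (by rw [S.σσ]; exact m3 : S.σ (S.σ b₂) ∈ L0)
      · exact (by rw [σc]; exact div_mem m2 (mul_mem m5 m1) : S.σ l ∈ L0)
    exact this
  have τL : ∀ l ∈ L0, S.τ l ∈ L0 := by
    have : L0 ≤ L0.comap (S.τ.restrictScalars F) := by
      conv_lhs => rw [hL0]
      rw [IntermediateField.adjoin_le_iff]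
      rintro l (rfl | rfl | rfl | rfl | rfl)
      · exact m2
      · exact (by rw [S.ττ]; exact m1 : S.τ (S.τ b₁) ∈ L0)
      · exact (τb.symm ▸ m3 : S.τ l ∈ L0)
      · exact (by rw [S.στ, τb]; exact m4 : S.τ (S.σ b₂) ∈ L0)
      · exact (by rw [τc]; exact div_mem m3 (mul_mem m5 m4) : S.τ l ∈ L0)
    exact this
  let E : IntermediateField F K := L0.comap (IsScalarTower.toAlgHom F K L)
  have hE : ∀ k : K, k ∈ E ↔ algebraMap K L k ∈ L0 := fun k => Iff.rfl
  have trd : TrdegLE F E 5 := by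
    refine trdegLE_of_le 5 ?_
    let f : E →ₐ[F] L0 := ((IsScalarTower.toAlgHom F K L).comp E.val).codRestrict L0.toSubalgebra (fun e => e.2)
    refine (trdeg_le_of_injective f f.toRingHom.injective).trans ?_
    subst hL0
    refine (trdeg_adjoin_le _).trans ?_
    classical
    have h5 : (({b₁, S.τ b₁, b₂, S.σ b₂, c} : Set L)) = ↑(([b₁, S.τ b₁, b₂, S.σ b₂, c] : List L).toFinset) := by
      ext; simp
    rw [h5]
    refine Cardinal.mk_coe_finset.trans_le ?_
    exact_mod_cast List.toFinset_card_le _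
  refine ⟨E, trd, ?_⟩
  let L1 : IntermediateField E L := L0.toSubfield.toIntermediateField (fun e => e.2)
  have mL1 : ∀ l, l ∈ L1 ↔ l ∈ L0 := fun _ => Iff.rfl
  let σ1 : L1 →ₐ[E] L1 := ((S.σ.restrictScalars E).comp L1.val).codRestrict L1.toSubalgebra (fun e => σL _ e.2)
  let τ1 : L1 →ₐ[E] L1 := ((S.τ.restrictScalars E).comp L1.val).codRestrict L1.toSubalgebra (fun e => τL _ e.2)
  have n1 : b₁ + S.τ b₁ ≠ 0 := fun h => h1 (by linear_combination h - b₁ * two)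
  have n2 : b₂ + S.σ b₂ ≠ 0 := fun h => h2 (by linear_combination h - b₂ * two)
  have n1' : S.τ b₁ + b₁ ≠ 0 := by rwa [add_comm]
  have n2' : S.σ b₂ + b₂ ≠ 0 := by rwa [add_comm]
  let S1 : Biq E L1 := {
    two := Subtype.ext two
    x := ⟨b₂ / (b₂ + S.σ b₂), div_mem m3 (add_mem m3 m4)⟩
    y := ⟨b₁ / (b₁ + S.τ b₁), div_mem m1 (add_mem m1 m2)⟩
    σ := σ1
    τ := τ1
    σx := Subtype.ext (by
      change S.σ (b₂ / (b₂ + S.σ b₂)) = b₂ / (b₂ + S.σ b₂) + 1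
      rw [map_div₀, map_add, S.σσ]
      field_simp
      linear_combination -(b₂ * (b₂ + S.σ b₂)) * two)
    σy := Subtype.ext (by
      change S.σ (b₁ / (b₁ + S.τ b₁)) = b₁ / (b₁ + S.τ b₁)
      rw [map_div₀, map_add, ← S.στ, σb])
    τx := Subtype.ext (by
      change S.τ (b₂ / (b₂ + S.σ b₂)) = b₂ / (b₂ + S.σ b₂)
      rw [map_div₀, map_add, S.στ, τb])
    τy := Subtype.ext (by
      change S.τ (b₁ / (b₁ + S.τ b₁)) = b₁ / (b₁ + S.τ b₁) + 1
      rw [map_div₀, map_add, S.ττ]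
      field_simp
      linear_combination -(b₁ * (b₁ + S.τ b₁)) * two)
    σσ := fun l => Subtype.ext (S.σσ l)
    ττ := fun l => Subtype.ext (S.ττ l)
    στ := fun l => Subtype.ext (S.στ l)
    fix := fun l hl hl' => by
      obtain ⟨k, hk⟩ := S.fix l (congrArg Subtype.val hl) (congrArg Subtype.val hl')
      exact ⟨⟨k, (hE k).mpr (by rw [hk]; exact l.2)⟩, Subtype.ext hk⟩ }
  let P1 : CP S1 R := {
    D := (D.restrictScalars E).comp L1.val
    u := u
    v := v
    b₁ := ⟨b₁, m1⟩
    b₂ := ⟨b₂, m3⟩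
    c := ⟨c, m5⟩
    hb₁ := fun h => hb₁ (congrArg Subtype.val h)
    hb₂ := fun h => hb₂ (congrArg Subtype.val h)
    hu := fun l => hu l
    hv := fun l => hv l
    huu := huu
    hvv := hvv
    hvu := hvu }
  exact ⟨P1.sub, inferInstance, inferInstance, P1.finrank_sub, inferInstance, inferInstance, descent P1.sub.val h16 P1.finrank_sub⟩


theorem quat {F K D : Type u} [Field F] [Field K] [Algebra F K] [DivisionRing D] [Algebra K D] [Algebra.IsCentral K D]
    (h2 : (2 : D) = 0) (h4 : Module.finrank K D = 4) : ∃ E : IntermediateField F K, TrdegLE F E 5 ∧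
      ∃ B : Subalgebra E D, Module.finrank E B = 4 ∧ Algebra.IsCentral E B ∧ IsSimpleRing B := by
  obtain ⟨e, he⟩ : ∃ e : D, ¬ Cn K e := by
    by_contra! h
    have h1 := finrank_le_one (R := K) (1 : D) (fun w => by
      obtain ⟨k, hk⟩ := h w
      exact ⟨k, by rw [hk, Algebra.smul_def, mul_one]⟩)
    omega
  obtain ⟨x, hxC, _, ⟨α, rfl⟩, hx⟩ := as_of_quad (K := K) h2 (fun z _ _ _ _ _ => isQ_four h4 z) e he (isQ_four h4 e)
  obtain ⟨w, hw⟩ := exists_not_comm hxC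
  obtain ⟨u, hu⟩ : ∃ u, u = x * w + w * x := ⟨_, rfl⟩
  have hu0 : u ≠ 0 := fun h => hw ((ct_iff h2 _ _).mpr (by rw [add_comm, ← hu, h]))
  have hux : u * x = x * u + u := hu ▸ ad_mem h2 x _ w (Cn.map (K := K) α) hx
  obtain ⟨s, β, huu⟩ := isQ_four h4 u
  have hs : s = 0 := by
    have c1 : u * u * x = x * (u * u) := by
      rw [mul_assoc, hux, mul_add, ← mul_assoc, hux, add_mul, add_assoc, ct_add h2, add_zero, mul_assoc]
    rw [huu, ← Algebra.smul_def, add_mul, mul_add, smul_mul_assoc, hux, mul_smul_comm, Algebra.commutes β x, smul_add] at c1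
    have := add_right_cancel c1
    have := (left_eq_add.mp this.symm)
    exact (smul_eq_zero.mp this).resolve_right hu0
  rw [hs, map_zero, zero_mul, zero_add] at huu
  have indep1 : ∀ a b : K, a • (1 : D) + b • x = 0 → a = 0 ∧ b = 0 := by
    intro a b h
    have hb : b = 0 := by
      by_contra hb
      refine hxC ⟨b⁻¹ * -a, ?_⟩
      rw [map_mul, ← Algebra.smul_def, map_neg, Algebra.algebraMap_eq_smul_one a, ← eq_neg_of_add_eq_zero_right h, smul_smul, inv_mul_cancel₀ hb, one_smul]
    rw [hb, zero_smul, add_zero] at h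
    exact ⟨(smul_eq_zero.mp h).resolve_right one_ne_zero, hb⟩
  have ad : ∀ a b c d : K, x * (a • (1 : D) + b • x + c • u + d • (x * u)) + (a • (1 : D) + b • x + c • u + d • (x * u)) * x = (c • 1 + d • x) * u := by
    intro a b c d
    simp only [mul_add, add_mul, mul_smul_comm, smul_mul_assoc, mul_assoc, hux, mul_one, one_mul, smul_add]
    rw [ct_iff h2]
    abel_nf
    simp only [n2 h2, n4 h2, z2 h2, z4 h2, add_zero, zero_add]
  have ind0 : ∀ a b c d : K, (c • (1 : D) + d • x) * u = 0 → c = 0 ∧ d = 0 := by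
    intro a b c d h
    exact indep1 _ _ ((mul_eq_zero.mp h).resolve_right hu0)
  obtain ⟨E, hE⟩ : ∃ E, E = IntermediateField.adjoin F ({α, β} : Set K) := ⟨_, rfl⟩
  have hα : α ∈ E := hE ▸ IntermediateField.subset_adjoin F _ (by simp)
  have hβ : β ∈ E := hE ▸ IntermediateField.subset_adjoin F _ (by simp)
  have trd : TrdegLE F E 5 := by
    refine trdegLE_of_le 5 ?_
    subst hE
    refine (trdeg_adjoin_le _).trans ?_
    classical
    have h5 : ({α, β} : Set K) = ↑(([α, β] : List K).toFinset) := by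
      ext; simp
    rw [h5]
    refine Cardinal.mk_coe_finset.trans_le ?_
    exact_mod_cast (List.toFinset_card_le _).trans (by simp)
  have smE : ∀ (e : E) (z : D), e • z = (e : K) • z := fun _ _ => rfl
  let g : Fin 4 → D := ![1, x, u, x * u]
  let N : Submodule E D := Submodule.span E (Set.range g)
  have m : ∀ i, g i ∈ N := fun i => Submodule.subset_span ⟨i, rfl⟩
  have m0 : 1 ∈ N := m 0
  have m1 : x ∈ N := m 1
  have m2 : u ∈ N := m 2
  have m3 : x * u ∈ N := m 3
  have sα : ∀ z ∈ N, algebraMap K D α * z ∈ N := fun z hz => by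
    rw [← Algebra.smul_def]; exact N.smul_mem ⟨α, hα⟩ hz
  have sβ : ∀ z ∈ N, algebraMap K D β * z ∈ N := fun z hz => by
    rw [← Algebra.smul_def]; exact N.smul_mem ⟨β, hβ⟩ hz
  have xN : ∀ z ∈ N, x * z ∈ N := by
    have : N ≤ N.comap (LinearMap.mulLeft E x) := by
      refine Submodule.span_le.mpr ?_
      rintro _ ⟨i, rfl⟩
      change x * g i ∈ N
      fin_cases i
      · simpa [g] using m1
      · change x * x ∈ N
        rw [hx]
        simpa using add_mem m1 (sα 1 m0)
      · exact m3
      · change x * (x * u) ∈ N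
        rw [← mul_assoc, hx, add_mul]
        exact add_mem m3 (sα u m2)
    exact this
  have uN : ∀ z ∈ N, u * z ∈ N := by
    have : N ≤ N.comap (LinearMap.mulLeft E u) := by
      refine Submodule.span_le.mpr ?_
      rintro _ ⟨i, rfl⟩
      change u * g i ∈ N
      fin_cases i
      · simpa [g] using m2
      · change u * x ∈ N
        rw [hux]
        exact add_mem m3 m2
      · change u * u ∈ N
        rw [huu]
        simpa using sβ 1 m0
      · change u * (x * u) ∈ N
        rw [← mul_assoc, hux, add_mul, mul_assoc, huu, ← Algebra.commutes]
        exact add_mem (sβ x m1) (by simpa using sβ 1 m0)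
    exact this
  have rep : ∀ z, z ∈ N ↔ ∃ a b c d : E, (a : K) • (1 : D) + (b : K) • x + (c : K) • u + (d : K) • (x * u) = z := by
    intro z
    rw [Submodule.mem_span_range_iff_exists_fun]
    constructor
    · rintro ⟨f, hf⟩
      rw [Fin.sum_univ_four] at hf
      exact ⟨f 0, f 1, f 2, f 3, hf⟩
    · rintro ⟨a, b, c, d, h⟩
      refine ⟨![a, b, c, d], ?_⟩
      rw [Fin.sum_univ_four]
      exact h
  have mN : ∀ z w, z ∈ N → w ∈ N → z * w ∈ N := by
    intro z w hz hw
    obtain ⟨a, b, c, d, rfl⟩ := (rep z).mp hz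
    simp only [add_mul, smul_mul_assoc, one_mul, mul_assoc]
    exact add_mem (add_mem (add_mem (N.smul_mem a hw) (N.smul_mem b (xN _ hw))) (N.smul_mem c (uN _ hw))) (N.smul_mem d (xN _ (uN _ hw)))
  have ind : LinearIndependent E g := by
    rw [Fintype.linearIndependent_iff]
    intro f hf
    rw [Fin.sum_univ_four] at hf
    change (f 0 : K) • (1 : D) + (f 1 : K) • x + (f 2 : K) • u + (f 3 : K) • (x * u) = 0 at hf
    obtain ⟨e2, e3⟩ := ind0 0 0 (f 2) (f 3) (by rw [← ad (f 0) (f 1), hf]; simp)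
    rw [e2, e3, zero_smul, zero_smul, add_zero, add_zero] at hf
    obtain ⟨e0, e1⟩ := indep1 _ _ hf
    intro i
    fin_cases i
    exacts [Subtype.ext e0, Subtype.ext e1, Subtype.ext e2, Subtype.ext e3]
  let B : Subalgebra E D := N.toSubalgebra m0 mN
  have hB : ∀ z, z ∈ B ↔ z ∈ N := fun _ => Iff.rfl
  have fB : Module.finrank E B = 4 := (finrank_span_eq_card ind).trans (by simp)
  refine ⟨E, trd, B, fB, ⟨?_⟩, ?_⟩
  · intro z hz
    rw [Subalgebra.mem_center_iff] at hz
    have c1 : x * (z : D) = z * x := congrArg Subtype.val (hz ⟨x, m1⟩)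
    have c2 : u * (z : D) = z * u := congrArg Subtype.val (hz ⟨u, m2⟩)
    obtain ⟨a, b, c, d, h⟩ := (rep z).mp z.2
    obtain ⟨e2, e3⟩ := ind0 0 0 c d (by rw [← ad a b, h, c1, ct_add h2])
    rw [e2, e3, zero_smul, zero_smul, add_zero, add_zero] at h
    rw [← h] at c2
    simp only [mul_add, add_mul, mul_smul_comm, smul_mul_assoc, hux, mul_one, one_mul, smul_add, ← add_assoc] at c2
    have hb := (smul_eq_zero.mp (left_eq_add.mp c2.symm)).resolve_right hu0
    rw [hb, zero_smul, add_zero] at h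
    exact ⟨a, Subtype.ext (by rw [← h, ← Algebra.algebraMap_eq_smul_one]; rfl)⟩
  · have : FiniteDimensional E B := Module.finite_of_finrank_pos (by omega)
    let := divisionRingOfFiniteDimensional E B
    exact DivisionRing.isSimpleRing B

theorem mat_descent {F K D : Type u} [Field F] [Field K] [Algebra F K] [DivisionRing D] [Algebra K D]
    (n : ℕ) [NeZero n] (hD : n * n * Module.finrank K D = 16) (E : IntermediateField F K) (hE : TrdegLE F E 5)
    (B : Subalgebra E D) [Algebra.IsCentral E B] [IsSimpleRing B] (hB : Module.finrank E B = Module.finrank K D)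
    (A : Type u) [Ring A] [Algebra K A] (f : A ≃ₐ[K] Matrix (Fin n) (Fin n) D) :
    ∃ E : IntermediateField F K, TrdegLE F E 5 ∧
      ∃ (B : Type u) (_ : Ring B) (_ : Algebra E B),
        Module.finrank E B = 16 ∧ Algebra.IsCentral E B ∧ IsSimpleRing B ∧
        Nonempty ((K ⊗[E] B) ≃ₐ[K] A) := by
  have h1 : Module.finrank K (Matrix (Fin n) (Fin n) D) = 16 := by
    rw [Module.finrank_matrix]; simpa using hD
  have h2 : Module.finrank E (Matrix (Fin n) (Fin n) B) = 16 := by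
    rw [Module.finrank_matrix, hB]; simpa using hD
  obtain ⟨e⟩ := descent (K := K) (B.val.mapMatrix (m := Fin n)) h1 h2
  exact ⟨E, hE, Matrix (Fin n) (Fin n) B, inferInstance, inferInstance, h2, inferInstance, inferInstance, ⟨e.trans f.symm⟩⟩

theorem upper_bound (F : Type u) [Field F] [CharP F 2] : csaDegFourEdLE F 5 := by
  intro K _ _ A _ _ h16 hc hs
  have : FiniteDimensional K A := Module.finite_of_finrank_pos (by omega)
  have : IsArtinianRing A := IsArtinianRing.of_finite K A
  obtain ⟨n, hn, D, _, _, _, ⟨f⟩⟩ := IsSimpleRing.exists_algEquiv_matrix_divisionRing_finite K A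
  have hcD : Algebra.IsCentral K D := ⟨fun d hd => by
    have hm : Matrix.scalar (Fin n) d ∈ Subalgebra.center K (Matrix (Fin n) (Fin n) D) := by
      rw [Subalgebra.mem_center_iff] at hd ⊢
      intro M
      exact (Matrix.scalar_commute d (fun r => (hd r).symm) M).symm
    have hm' : f.symm (Matrix.scalar (Fin n) d) ∈ Subalgebra.center K A := by
      rw [Subalgebra.mem_center_iff] at hm ⊢
      intro a
      refine f.injective ?_
      rw [map_mul, map_mul, AlgEquiv.apply_symm_apply, hm]
    obtain ⟨k, hk⟩ := (Algebra.IsCentral.mem_center_iff K).mp hm'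
    rw [AlgEquiv.symm_apply_eq, AlgEquiv.commutes] at hk
    have := congrFun (congrFun hk 0) 0
    simp [Matrix.algebraMap_matrix_apply] at this
    exact ⟨k, this.symm⟩⟩
  have h2 : (2 : D) = 0 := by
    have h : (2 : F) = 0 := CharTwo.two_eq_zero
    have := congrArg (fun z => algebraMap K D (algebraMap F K z)) h
    simp only [map_ofNat, map_zero] at this
    exact this
  have hnD : n * n * Module.finrank K D = 16 := by
    rw [← h16, f.toLinearEquiv.finrank_eq, Module.finrank_matrix]; simp
  have hn4 : n = 1 ∨ n = 2 ∨ n = 4 := by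
    have hd : n * n ∣ 16 := ⟨_, hnD.symm⟩
    have : n ≤ 4 := by have := Nat.le_of_dvd (by norm_num) hd; nlinarith
    interval_cases n <;> simp_all
  rcases hn4 with rfl | rfl | rfl
  · have hD : Module.finrank K D = 16 := by omega
    obtain ⟨M, _, _, S, P, h3, h4⟩ := exists_CP (K := K) h2 hD
    let : Algebra F M := ((algebraMap K M).comp (algebraMap F K)).toAlgebra
    have : IsScalarTower F K M := IsScalarTower.of_algebraMap_eq fun _ => rfl
    obtain ⟨E, hE, B, r, a, h5, h6, h7, ⟨e⟩⟩ := final_descent (F := F) S P hD h3 h4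
    let g : D ≃ₐ[K] Matrix (Fin 1) (Fin 1) D := AlgEquiv.ofBijective (Matrix.scalarAlgHom (Fin 1) K) ⟨by
      intro a b h
      simpa using congrFun (congrFun h 0) 0, fun M => ⟨M 0 0, by ext i j; simp [Subsingleton.elim i 0, Subsingleton.elim j 0]⟩⟩
    exact ⟨E, hE, B, r, a, h5, h6, h7, ⟨e.trans (g.trans f.symm)⟩⟩
  · have hD : Module.finrank K D = 4 := by omega
    obtain ⟨E, hE, B, h3, h4, h5⟩ := quat (F := F) h2 hD
    exact mat_descent 2 hnD E hE B (h3.trans hD.symm) A f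
  · have hD : Module.finrank K D = 1 := by omega
    let E : IntermediateField F K := IntermediateField.adjoin F (∅ : Set K)
    have i1 : Algebra.IsCentral E (⊥ : Subalgebra E D) := ⟨fun z _ => by
      obtain ⟨e, he⟩ := Algebra.mem_bot.mp z.2
      exact ⟨e, Subtype.ext he⟩⟩
    have i2 : IsSimpleRing (⊥ : Subalgebra E D) := IsSimpleRing.of_ringEquiv (Algebra.botEquiv E D).symm.toRingEquiv inferInstance
    refine mat_descent 4 hnD E (trdegLE_of_le 5 ((trdeg_adjoin_le _).trans (by simp))) ⊥ ?_ A f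
    rw [Subalgebra.finrank_bot, hD]

/-- Over a field `F` of characteristic `2`, `4 ≤ ed(PGL₄) ≤ 5`. -/
theorem ed_pgl_four_between_four_and_five (F : Type u) [Field F] [CharP F 2] :
    (∀ m : ℕ, csaDegFourEdLE F m → 4 ≤ m) ∧ csaDegFourEdLE F 5 := by
  exact ⟨lower_bound F, upper_bound F⟩

end
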